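/- arXiv:1104.4957 — 2 statements merged into one kernel-verified Lean document; each statement's English description precedes it below -/
import Mathlib

section
/- Fix A ≥ 1. There exist constants C > 0 and N_0 > 0, depending only on A, such that for every integer N ≥ N_0, every positive integer k ≤ A·(log log N)/(log log log N), and every tuple v = (v_1,...,v_k) ∈ {−1,1}^k, one has | (1/π(N))·#{primes p ≤ N : χ_p(q_j) = v_j for all 1 ≤ j ≤ k} − 2^{−k} | ≤ C/(2^k (log N)^A). -/
open Complex in
/-- Consecutive values of `n ↦ n ^ (-s)` differ by at most `‖s‖ n ^ (-Re s - 1)`. -/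
lemma norm_natCast_cpow_neg_sub_le {s : ℂ} (hs : 0 < s.re) {n : ℕ} (hn : 1 ≤ n) :
    ‖((n + 1 : ℕ) : ℂ) ^ (-s) - (n : ℂ) ^ (-s)‖ ≤ ‖s‖ * (n : ℝ) ^ (-s.re - 1) := by
  have hn0 : (0 : ℝ) < n := by exact_mod_cast hn
  have key : ∀ x ∈ Set.Icc (n : ℝ) (n + 1), HasDerivWithinAt (fun y : ℝ => (y : ℂ) ^ (-s))
      ((-s) * (x : ℂ) ^ (-s - 1)) (Set.Icc (n : ℝ) (n + 1)) x := fun x hx =>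
    (hasDerivAt_ofReal_cpow_const (by linarith [hx.1]) (by
      intro h; simp [neg_eq_zero] at h; simp [h] at hs)).hasDerivWithinAt
  have := (convex_Icc (n : ℝ) ((n : ℝ) + 1)).norm_image_sub_le_of_norm_hasDerivWithin_le (𝕜 := ℝ)
    (C := ‖s‖ * (n : ℝ) ^ (-s.re - 1)) key (fun x hx => by
      have hx0 : 0 < x := by linarith [hx.1]
      rw [norm_mul, norm_neg, Complex.norm_cpow_eq_rpow_re_of_pos hx0]
      simp only [sub_re, neg_re, one_re]
      exact mul_le_mul_of_nonneg_left
        (Real.rpow_le_rpow_of_nonpos hn0 hx.1 (by linarith)) (norm_nonneg _))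
    (x := (n : ℝ)) (y := (n : ℝ) + 1) ⟨le_refl _, by linarith⟩ ⟨by linarith, le_refl _⟩
  simpa using this

lemma mul_rpow_le_rpow_sub_rpow {σ : ℝ} (hσ : 0 < σ) {n : ℕ} (hn : 1 ≤ n) :
    σ * ((n + 1 : ℕ) : ℝ) ^ (-σ - 1) ≤ (n : ℝ) ^ (-σ) - ((n + 1 : ℕ) : ℝ) ^ (-σ) := by
  have hn0 : (0 : ℝ) < n := by exact_mod_cast hn
  have hm0 : (0 : ℝ) < (n + 1 : ℕ) := by positivity
  set m : ℝ := ((n + 1 : ℕ) : ℝ) with hm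
  have hmn : (n : ℝ) = m * (1 - 1 / m) := by
    rw [mul_sub, mul_one_div_cancel hm0.ne', hm]; push_cast; ring
  have h1 : 0 < 1 - 1 / m := by
    by_contra h
    have := mul_nonpos_of_nonneg_of_nonpos hm0.le (not_lt.1 h)
    rw [← hmn] at this; linarith
  have h2 : 1 + σ / m ≤ (1 - 1 / m) ^ (-σ) := by
    rw [Real.rpow_def_of_pos h1]
    have hl : Real.log (1 - 1 / m) ≤ - (1 / m) := by
      have := Real.log_le_sub_one_of_pos h1; linarith
    have := Real.add_one_le_exp (Real.log (1 - 1 / m) * -σ)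
    have h3 : σ / m ≤ Real.log (1 - 1 / m) * -σ := by
      rw [div_eq_mul_one_div]; nlinarith
    linarith
  rw [hmn, Real.mul_rpow hm0.le h1.le, Real.rpow_sub_one hm0.ne']
  have h4 := Real.rpow_pos_of_pos hm0 (-σ)
  have := mul_le_mul_of_nonneg_left h2 h4.le
  have e : m ^ (-σ) * (1 + σ / m) = m ^ (-σ) + σ * (m ^ (-σ) / m) := by ring
  linarith

lemma sum_rpow_neg_sub_one_le {σ : ℝ} (hσ : 0 < σ) {N : ℕ} (hN : 1 ≤ N) (m : ℕ) :
    ∑ j ∈ Finset.range m, ((N + 1 + j : ℕ) : ℝ) ^ (-σ - 1) ≤ (N : ℝ) ^ (-σ) / σ := by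
  have h : ∑ j ∈ Finset.range m, σ * ((N + 1 + j : ℕ) : ℝ) ^ (-σ - 1)
      ≤ (N : ℝ) ^ (-σ) - ((N + m : ℕ) : ℝ) ^ (-σ) := by
    induction m with
    | zero => simp
    | succ m ih =>
      rw [Finset.sum_range_succ]
      have := mul_rpow_le_rpow_sub_rpow hσ (n := N + m) (by omega)
      rw [show N + 1 + m = N + m + 1 by ring]
      rw [show N + (m + 1) = N + m + 1 by ring]
      linarith
  rw [← Finset.mul_sum] at h
  rw [le_div_iff₀ hσ, mul_comm]
  have : 0 ≤ ((N + m : ℕ) : ℝ) ^ (-σ) := by positivity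
  linarith

lemma sum_rpow_sub_one_le {η : ℝ} (hη : 0 < η) (hη1 : η ≤ 1) (N : ℕ) :
    ∑ n ∈ Finset.range N, ((n + 1 : ℕ) : ℝ) ^ (η - 1) ≤ (N : ℝ) ^ η / η := by
  rw [le_div_iff₀ hη, Finset.sum_mul]
  induction N with
  | zero => simp [hη.ne']
  | succ n ih =>
    rw [Finset.sum_range_succ]
    have hm0 : (0 : ℝ) < (n + 1 : ℕ) := by positivity
    set m : ℝ := ((n + 1 : ℕ) : ℝ) with hm
    have hmn : (n : ℝ) = m * (1 + -(1 / m)) := by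
      rw [← sub_eq_add_neg, mul_sub, mul_one_div_cancel hm0.ne', hm]; push_cast; ring
    have hm1 : 1 / m ≤ 1 := by rw [div_le_one hm0, hm]; push_cast; linarith [n.cast_nonneg (α := ℝ)]
    have h := rpow_one_add_le_one_add_mul_self (s := -(1 / m)) (by linarith) hη.le hη1
    rw [hmn, Real.mul_rpow hm0.le (by linarith)] at ih
    have h4 := Real.rpow_pos_of_pos hm0 η
    have := mul_le_mul_of_nonneg_left h h4.le
    rw [Real.rpow_sub_one hm0.ne']
    have e : m ^ η * (1 + η * -(1 / m)) = m ^ η - m ^ η / m * η := by ring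
    linarith

lemma ZMod.sum_range_add_natCast {q : ℕ} [NeZero q] (Φ : ZMod q → ℂ) (a : ℕ) :
    ∑ i ∈ Finset.range q, Φ ((a + i : ℕ) : ZMod q) = ∑ z, Φ z := by
  have h1 : ∑ i ∈ Finset.range q, Φ ((a + i : ℕ) : ZMod q) = ∑ z : ZMod q, Φ (a + z) := by
    refine Finset.sum_bij' (fun i _ => (i : ZMod q)) (fun z _ => z.val) ?_ ?_ ?_ ?_ ?_
    · simp
    · intro z _; simpa using z.val_lt
    · intro i hi; simpa using ZMod.val_cast_of_lt (by simpa using hi)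
    · intro z _; simp
    · intro i _; simp
  rw [h1]
  exact Fintype.sum_equiv (Equiv.addLeft (a : ZMod q)) _ _ (fun z => rfl)

lemma ZMod.norm_sum_range_add_natCast_le {q : ℕ} [NeZero q] {Φ : ZMod q → ℂ} (h0 : ∑ z, Φ z = 0)
    (h1 : ∀ z, ‖Φ z‖ ≤ 1) (a m : ℕ) :
    ‖∑ i ∈ Finset.range m, Φ ((a + i : ℕ) : ZMod q)‖ ≤ q := by
  induction m using Nat.strong_induction_on generalizing a with
  | _ m ih =>
    by_cases hm : m < q
    · refine (norm_sum_le _ _).trans ?_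
      refine (Finset.sum_le_sum fun i _ => h1 _).trans ?_
      simpa using hm.le
    · obtain ⟨k, rfl⟩ := Nat.exists_eq_add_of_le (not_lt.1 hm)
      have hq := NeZero.pos q
      rw [Finset.sum_range_add, ZMod.sum_range_add_natCast, h0, zero_add]
      simpa [add_assoc] using ih k (by omega) (a + q)

lemma sum_range_mul_eq_abel {R : Type*} [CommRing R] (a b : ℕ → R) (m : ℕ) :
    ∑ j ∈ Finset.range m, a j * b j = (∑ i ∈ Finset.range m, a i) * b m
      - ∑ j ∈ Finset.range m, (∑ i ∈ Finset.range (j + 1), a i) * (b (j + 1) - b j) := by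
  induction m with
  | zero => simp
  | succ m ih =>
    simp only [Finset.sum_range_succ] at ih ⊢
    rw [ih]; ring

/-- The Abel-summed tail `∑_{n > N} Φ(n) n ^ (-s)` of the `L`-series of a function on `ZMod q`. -/
noncomputable def ZMod.abelTail {q : ℕ} (Φ : ZMod q → ℂ) (N : ℕ) (s : ℂ) : ℂ :=
  -∑' j : ℕ, (∑ i ∈ Finset.range (j + 1), Φ ((N + 1 + i : ℕ) : ZMod q)) *
    (((N + 1 + j + 1 : ℕ) : ℂ) ^ (-s) - ((N + 1 + j : ℕ) : ℂ) ^ (-s))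

section
variable {q : ℕ} [NeZero q] {Φ : ZMod q → ℂ}

lemma ZMod.norm_abelTail_term_le (h0 : ∑ z, Φ z = 0) (h1 : ∀ z, ‖Φ z‖ ≤ 1) (N j : ℕ) {s : ℂ}
    (hs : 0 < s.re) :
    ‖(∑ i ∈ Finset.range (j + 1), Φ ((N + 1 + i : ℕ) : ZMod q)) *
      (((N + 1 + j + 1 : ℕ) : ℂ) ^ (-s) - ((N + 1 + j : ℕ) : ℂ) ^ (-s))‖
      ≤ q * ‖s‖ * ((N + 1 + j : ℕ) : ℝ) ^ (-s.re - 1) := by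
  rw [norm_mul, mul_assoc]
  exact mul_le_mul (ZMod.norm_sum_range_add_natCast_le h0 h1 _ _)
    (norm_natCast_cpow_neg_sub_le hs (by omega)) (norm_nonneg _) (Nat.cast_nonneg _)

lemma summable_natCast_rpow_neg_sub_one {σ : ℝ} (hσ : 0 < σ) {N : ℕ} (hN : 1 ≤ N) :
    Summable fun j : ℕ => ((N + 1 + j : ℕ) : ℝ) ^ (-σ - 1) :=
  summable_of_sum_range_le (fun _ => by positivity) (sum_rpow_neg_sub_one_le hσ hN)

lemma ZMod.summable_abelTail (h0 : ∑ z, Φ z = 0) (h1 : ∀ z, ‖Φ z‖ ≤ 1) {N : ℕ} (hN : 1 ≤ N) {s : ℂ}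
    (hs : 0 < s.re) :
    Summable fun j : ℕ => (∑ i ∈ Finset.range (j + 1), Φ ((N + 1 + i : ℕ) : ZMod q)) *
      (((N + 1 + j + 1 : ℕ) : ℂ) ^ (-s) - ((N + 1 + j : ℕ) : ℂ) ^ (-s)) :=
  Summable.of_norm_bounded ((summable_natCast_rpow_neg_sub_one hs hN).mul_left (q * ‖s‖))
    fun j => ZMod.norm_abelTail_term_le h0 h1 N j hs

lemma ZMod.norm_abelTail_le (h0 : ∑ z, Φ z = 0) (h1 : ∀ z, ‖Φ z‖ ≤ 1) {N : ℕ} (hN : 1 ≤ N) {s : ℂ}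
    (hs : 0 < s.re) :
    ‖ZMod.abelTail Φ N s‖ ≤ q * ‖s‖ * ((N : ℝ) ^ (-s.re) / s.re) := by
  have hsum := (summable_natCast_rpow_neg_sub_one hs hN).mul_left (q * ‖s‖)
  rw [ZMod.abelTail, norm_neg]
  refine (tsum_of_norm_bounded hsum.hasSum fun j => ZMod.norm_abelTail_term_le h0 h1 N j hs).trans ?_
  rw [tsum_mul_left]
  gcongr
  exact Real.tsum_le_of_sum_range_le (fun _ => by positivity) (sum_rpow_neg_sub_one_le hs hN)

lemma ZMod.differentiableOn_abelTail (h0 : ∑ z, Φ z = 0) (h1 : ∀ z, ‖Φ z‖ ≤ 1) {N : ℕ} (hN : 1 ≤ N) :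
    DifferentiableOn ℂ (ZMod.abelTail Φ N) {s | 0 < s.re} := by
  intro s hs
  have hs : 0 < s.re := hs
  set U : Set ℂ := {z | s.re / 2 < z.re} ∩ Metric.ball 0 (‖s‖ + 1) with hU
  have hUo : IsOpen U := (isOpen_lt continuous_const Complex.continuous_re).inter Metric.isOpen_ball
  have hsU : s ∈ U := ⟨by simp; linarith, by simp⟩
  have hd : DifferentiableOn ℂ (fun z => ∑' j : ℕ,
      (∑ i ∈ Finset.range (j + 1), Φ ((N + 1 + i : ℕ) : ZMod q)) *
        (((N + 1 + j + 1 : ℕ) : ℂ) ^ (-z) - ((N + 1 + j : ℕ) : ℂ) ^ (-z))) U := by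
    refine Complex.differentiableOn_tsum_of_summable_norm
      ((summable_natCast_rpow_neg_sub_one (half_pos hs) hN).mul_left (q * (‖s‖ + 1)))
      (fun j => ?_) hUo fun j z hz => ?_
    · refine DifferentiableOn.const_mul (DifferentiableOn.sub ?_ ?_) _
      · exact (differentiable_id.neg.const_cpow
          (Or.inl (Nat.cast_ne_zero.2 (Nat.succ_ne_zero _)))).differentiableOn
      · exact (differentiable_id.neg.const_cpow
          (Or.inl (Nat.cast_ne_zero.2 (by omega)))).differentiableOn
    · have hz1 : s.re / 2 < z.re := hz.1
      have hz2 : ‖z‖ ≤ ‖s‖ + 1 := by simpa using (mem_ball_zero_iff.1 hz.2).le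
      refine (ZMod.norm_abelTail_term_le h0 h1 N j (by linarith)).trans ?_
      gcongr
      · exact_mod_cast (by omega : 1 ≤ N + 1 + j)
  exact ((hd.differentiableAt (hUo.mem_nhds hsU)).neg).differentiableWithinAt

lemma ZMod.LFunction_eq_sum_add_abelTail_of_one_lt_re (h0 : ∑ z, Φ z = 0) (h1 : ∀ z, ‖Φ z‖ ≤ 1)
    {N : ℕ} (hN : 1 ≤ N) {s : ℂ} (hs : 1 < s.re) :
    ZMod.LFunction Φ s = ∑ n ∈ Finset.range N, Φ ((n + 1 : ℕ) : ZMod q) * ((n + 1 : ℕ) : ℂ) ^ (-s)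
      + ZMod.abelTail Φ N s := by
  have hterm : ∀ n : ℕ, LSeries.term (fun n => Φ (n : ZMod q)) s (n + 1)
      = Φ ((n + 1 : ℕ) : ZMod q) * ((n + 1 : ℕ) : ℂ) ^ (-s) := fun n => by
    rw [LSeries.term_of_ne_zero (Nat.succ_ne_zero n), Complex.cpow_neg, div_eq_mul_inv]
  have hsum : LSeriesSummable (fun n => Φ (n : ZMod q)) s := ZMod.LSeriesSummable_of_one_lt_re Φ hs
  rw [ZMod.LFunction_eq_LSeries Φ hs]
  have hlim := hsum.hasSum.tendsto_sum_nat
  have hlim2 := hlim.comp (Filter.tendsto_add_atTop_nat (N + 1))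
  refine tendsto_nhds_unique hlim2 ?_
  have hs0 : 0 < s.re := by linarith
  have hb : Filter.Tendsto (fun m : ℕ => (∑ i ∈ Finset.range m, Φ ((N + 1 + i : ℕ) : ZMod q)) *
      ((N + 1 + m : ℕ) : ℂ) ^ (-s)) Filter.atTop (nhds 0) := by
    rw [tendsto_zero_iff_norm_tendsto_zero]
    have h2 : Filter.Tendsto (fun m : ℕ => (q : ℝ) * ((N + 1 + m : ℕ) : ℝ) ^ (-s.re)) Filter.atTop
        (nhds (q * 0)) := by
      refine Filter.Tendsto.const_mul _ ?_
      refine (tendsto_rpow_neg_atTop hs0).comp (tendsto_natCast_atTop_atTop.comp ?_)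
      exact Filter.tendsto_atTop_mono (fun m => by omega : ∀ m, m ≤ N + 1 + m) Filter.tendsto_id
    rw [mul_zero] at h2
    refine squeeze_zero (fun _ => norm_nonneg _) (fun m => ?_) h2
    rw [norm_mul, Complex.norm_natCast_cpow_of_pos (by omega), Complex.neg_re]
    exact mul_le_mul_of_nonneg_right (ZMod.norm_sum_range_add_natCast_le h0 h1 _ _) (by positivity)
  have hc := (ZMod.summable_abelTail h0 h1 hN hs0).hasSum.tendsto_sum_nat
  have := (hb.sub hc).const_add
    (∑ n ∈ Finset.range N, Φ ((n + 1 : ℕ) : ZMod q) * ((n + 1 : ℕ) : ℂ) ^ (-s))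
  rw [zero_sub] at this
  refine this.congr fun m => ?_
  simp only [Function.comp_apply]
  rw [add_comm m, Finset.sum_range_add _ (N + 1) m, Finset.sum_range_succ' _ N]
  simp only [LSeries.term_zero, add_zero, hterm]
  congr 1
  have := sum_range_mul_eq_abel (fun j => Φ ((N + 1 + j : ℕ) : ZMod q))
    (fun j => ((N + 1 + j : ℕ) : ℂ) ^ (-s)) m
  simp only [← add_assoc] at this
  rw [← this]
  refine Finset.sum_congr rfl fun j _ => ?_
  rw [show N + 1 + j = (N + j) + 1 by ring, hterm]

lemma ZMod.LFunction_eq_sum_add_abelTail (h0 : ∑ z, Φ z = 0) (h1 : ∀ z, ‖Φ z‖ ≤ 1)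
    {N : ℕ} (hN : 1 ≤ N) {s : ℂ} (hs : 0 < s.re) :
    ZMod.LFunction Φ s = ∑ n ∈ Finset.range N, Φ ((n + 1 : ℕ) : ZMod q) * ((n + 1 : ℕ) : ℂ) ^ (-s)
      + ZMod.abelTail Φ N s := by
  have hU : IsOpen {s : ℂ | 0 < s.re} := isOpen_lt continuous_const Complex.continuous_re
  have hf : AnalyticOnNhd ℂ (ZMod.LFunction Φ) {s : ℂ | 0 < s.re} :=
    (ZMod.differentiable_LFunction_of_sum_zero h0).differentiableOn.analyticOnNhd hU
  have hg : AnalyticOnNhd ℂ (fun s => ∑ n ∈ Finset.range N,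
      Φ ((n + 1 : ℕ) : ZMod q) * ((n + 1 : ℕ) : ℂ) ^ (-s) + ZMod.abelTail Φ N s)
      {s : ℂ | 0 < s.re} := by
    refine DifferentiableOn.analyticOnNhd ?_ hU
    refine DifferentiableOn.add ?_ (ZMod.differentiableOn_abelTail h0 h1 hN)
    refine DifferentiableOn.fun_sum fun n _ => DifferentiableOn.const_mul ?_ _
    exact (differentiable_id.neg.const_cpow
          (Or.inl (Nat.cast_ne_zero.2 (Nat.succ_ne_zero _)))).differentiableOn
  refine hf.eqOn_of_preconnected_of_eventuallyEq hg
    (convex_halfSpace_re_gt 0).isPreconnected (z₀ := 2) (by simp) ?_ hs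
  have : {s : ℂ | 1 < s.re} ∈ nhds (2 : ℂ) :=
    (isOpen_lt continuous_const Complex.continuous_re).mem_nhds (by simp)
  filter_upwards [this] with z hz
  exact ZMod.LFunction_eq_sum_add_abelTail_of_one_lt_re h0 h1 hN hz

/-- Convexity-type bound for `L`-functions of mean zero functions, left of and on the line `1`. -/
lemma ZMod.norm_LFunction_le (h0 : ∑ z, Φ z = 0) (h1 : ∀ z, ‖Φ z‖ ≤ 1) {η : ℝ} (hη : 0 < η)
    (hη1 : η ≤ 1 / 2) {s : ℂ} (hs : 1 - η ≤ s.re) :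
    ‖ZMod.LFunction Φ s‖ ≤ (2 / η + 8) * (q * (|s.im| + 2)) ^ η := by
  set X : ℝ := q * (|s.im| + 2) with hX
  have hq : (1 : ℝ) ≤ q := by exact_mod_cast NeZero.pos q
  have hX2 : 2 ≤ X := by
    rw [hX]; nlinarith [abs_nonneg s.im]
  set N := ⌊X⌋₊ with hNdef
  have hN : 1 ≤ N := Nat.one_le_floor_iff _ |>.2 (by linarith)
  have hNX : (N : ℝ) ≤ X := Nat.floor_le (by linarith)
  have hXN : X ≤ 2 * N := by
    have := (Nat.lt_floor_add_one X).le
    have h' : (1 : ℝ) ≤ N := by exact_mod_cast hN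
    linarith
  have hN0 : (1 : ℝ) ≤ N := by exact_mod_cast hN
  have hσ : 0 < s.re := by linarith
  rw [ZMod.LFunction_eq_sum_add_abelTail h0 h1 hN hσ]
  refine (norm_add_le _ _).trans ?_
  have hA : ‖∑ n ∈ Finset.range N, Φ ((n + 1 : ℕ) : ZMod q) * ((n + 1 : ℕ) : ℂ) ^ (-s)‖
      ≤ X ^ η / η := by
    refine (norm_sum_le _ _).trans (le_trans ?_ ((sum_rpow_sub_one_le hη (by linarith) N).trans ?_))
    · refine Finset.sum_le_sum fun n _ => ?_
      rw [norm_mul, Complex.norm_natCast_cpow_of_pos (by omega), Complex.neg_re]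
      calc _ ≤ 1 * ((n + 1 : ℕ) : ℝ) ^ (-s.re) := by gcongr; exact h1 _
        _ ≤ _ := by
          rw [one_mul]
          exact Real.rpow_le_rpow_of_exponent_le (by push_cast; linarith [n.cast_nonneg (α := ℝ)])
            (by linarith)
    · gcongr
  have hB : ‖ZMod.abelTail Φ N s‖ ≤ 8 * X ^ η := by
    refine (ZMod.norm_abelTail_le h0 h1 hN hσ).trans ?_
    have e1 : (N : ℝ) ^ (-s.re) ≤ (N : ℝ) ^ η * (N : ℝ)⁻¹ := by
      rw [← Real.rpow_neg_one, ← Real.rpow_add (by linarith)]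
      exact Real.rpow_le_rpow_of_exponent_le hN0 (by linarith)
    have e2 : q * ‖s‖ ≤ s.re * (4 * N) := by
      have : ‖s‖ ≤ s.re + |s.im| := by
        have := Complex.norm_le_abs_re_add_abs_im s
        rwa [abs_of_pos hσ] at this
      have h3 : ‖s‖ ≤ s.re * 2 * (|s.im| + 2) := by nlinarith [abs_nonneg s.im]
      calc q * ‖s‖ ≤ q * (s.re * 2 * (|s.im| + 2)) := by gcongr
        _ = s.re * 2 * X := by rw [hX]; ring
        _ ≤ s.re * 2 * (2 * N) := by gcongr
        _ = _ := by ring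
    calc q * ‖s‖ * ((N : ℝ) ^ (-s.re) / s.re)
        ≤ s.re * (4 * N) * (((N : ℝ) ^ η * (N : ℝ)⁻¹) / s.re) := by gcongr
      _ = 4 * (N : ℝ) ^ η := by field_simp
      _ ≤ 8 * X ^ η := by
        have : (N : ℝ) ^ η ≤ X ^ η := by gcongr
        have : 0 ≤ X ^ η := by positivity
        linarith
  have : 0 ≤ X ^ η / η := by positivity
  have e : (2 / η + 8) * X ^ η = 2 * (X ^ η / η) + 8 * X ^ η := by ring
  linarith

end

section
variable {q : ℕ} [NeZero q]

lemma one_le_conductor_mul (q : ℕ) [NeZero q] (t : ℝ) : (1 : ℝ) ≤ q * (|t| + 2) := by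
  have hq : (1 : ℝ) ≤ q := by exact_mod_cast NeZero.pos q
  nlinarith [abs_nonneg t]

lemma DirichletCharacter.norm_LFunction_le {χ : DirichletCharacter ℂ q} (hχ : χ ≠ 1) {η : ℝ}
    (hη : 0 < η) (hη1 : η ≤ 1 / 2) {s : ℂ} (hs : 1 - η ≤ s.re) :
    ‖χ.LFunction s‖ ≤ (2 / η + 8) * (q * (|s.im| + 2)) ^ η :=
  ZMod.norm_LFunction_le (MulChar.sum_eq_zero_of_ne_one hχ) χ.norm_le_one hη hη1 hs

end

lemma DirichletCharacter.exists_norm_iteratedDeriv_LFunction_le {η : ℝ} (hη : 0 < η) (j : ℕ) :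
    ∃ C : ℝ, 0 < C ∧ ∀ (q : ℕ) [NeZero q] (χ : DirichletCharacter ℂ q), χ ≠ 1 → ∀ s : ℂ,
      1 ≤ s.re → ‖iteratedDeriv j χ.LFunction s‖ ≤ C * (q * (|s.im| + 2)) ^ η := by
  wlog hη1 : η ≤ 1 / 2
  · obtain ⟨C, hC, h⟩ := this (η := 1 / 2) (by norm_num) j le_rfl
    refine ⟨C, hC, fun q _ χ hχ s hs => (h q χ hχ s hs).trans ?_⟩
    gcongr
    · exact one_le_conductor_mul q _
    · linarith
  refine ⟨j.factorial * ((2 / η + 8) * 2) / η ^ j, by positivity, fun q _ χ hχ s hs => ?_⟩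
  have hX := one_le_conductor_mul q s.im
  have := Complex.norm_iteratedDeriv_le_of_forall_mem_sphere_norm_le (n := j) (c := s) (R := η)
    (f := χ.LFunction) (C := (2 / η + 8) * 2 * (q * (|s.im| + 2)) ^ η) hη
    (DirichletCharacter.differentiable_LFunction hχ).diffContOnCl ?_
  · refine this.trans (le_of_eq ?_)
    ring
  · intro z hz
    have hz : ‖z - s‖ = η := by simpa [dist_eq_norm] using hz
    have hre : |z.re - s.re| ≤ η := by simpa [← hz] using Complex.abs_re_le_norm (z - s)
    have him : |z.im - s.im| ≤ η := by simpa [← hz] using Complex.abs_im_le_norm (z - s)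
    refine (DirichletCharacter.norm_LFunction_le hχ hη hη1
      (by linarith [(abs_le.1 hre).1])).trans ?_
    rw [mul_assoc (2 / η + 8)]
    gcongr
    have h2 : (q * (|z.im| + 2) : ℝ) ≤ 2 * (q * (|s.im| + 2)) := by
      have : |z.im| ≤ |s.im| + 1 := by
        have := abs_sub_abs_le_abs_sub z.im s.im
        linarith
      have hq : (0 : ℝ) ≤ q := by positivity
      nlinarith [abs_nonneg s.im]
    calc (q * (|z.im| + 2) : ℝ) ^ η ≤ (2 * (q * (|s.im| + 2))) ^ η := by gcongr
      _ = 2 ^ η * (q * (|s.im| + 2)) ^ η := Real.mul_rpow (by norm_num) (by linarith)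
      _ ≤ 2 * (q * (|s.im| + 2)) ^ η := by
        gcongr
        calc (2 : ℝ) ^ η ≤ 2 ^ (1 : ℝ) := Real.rpow_le_rpow_of_exponent_le (by norm_num) (by linarith)
          _ = 2 := by norm_num

open Complex in
lemma norm_ofReal_cpow_neg_sub_le {s : ℂ} (hs : 0 < s.re) {a x y : ℝ} (ha : 0 < a)
    (hx : x ∈ Set.Icc a (a + 1)) (hy : y ∈ Set.Icc a (a + 1)) :
    ‖(y : ℂ) ^ (-s) - (x : ℂ) ^ (-s)‖ ≤ ‖s‖ * a ^ (-s.re - 1) := by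
  have key : ∀ x ∈ Set.Icc a (a + 1), HasDerivWithinAt (fun y : ℝ => (y : ℂ) ^ (-s))
      ((-s) * (x : ℂ) ^ (-s - 1)) (Set.Icc a (a + 1)) x := fun x hx =>
    (hasDerivAt_ofReal_cpow_const (by linarith [hx.1]) (by
      intro h; simp [neg_eq_zero] at h; simp [h] at hs)).hasDerivWithinAt
  refine ((convex_Icc a (a + 1)).norm_image_sub_le_of_norm_hasDerivWithin_le (𝕜 := ℝ)
    (C := ‖s‖ * a ^ (-s.re - 1)) key (fun x hx => ?_) hx hy).trans ?_
  · have hx0 : 0 < x := by linarith [hx.1]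
    rw [norm_mul, norm_neg, Complex.norm_cpow_eq_rpow_re_of_pos hx0]
    simp only [sub_re, neg_re, one_re]
    exact mul_le_mul_of_nonneg_left
      (Real.rpow_le_rpow_of_nonpos ha hx.1 (by linarith)) (norm_nonneg _)
  · have : ‖y - x‖ ≤ 1 := by
      rw [Real.norm_eq_abs, abs_le]; constructor <;> linarith [hx.1, hx.2, hy.1, hy.2]
    have h2 : 0 ≤ ‖s‖ * a ^ (-s.re - 1) := by positivity
    nlinarith

open Complex in
lemma norm_natCast_cpow_sub_integral_le {s : ℂ} (hs : 1 < s.re) {n : ℕ} (hn : 1 ≤ n) :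
    ‖((n + 1 : ℕ) : ℂ) ^ (-s)
      - ((n : ℂ) ^ (1 - s) / (s - 1) - ((n + 1 : ℕ) : ℂ) ^ (1 - s) / (s - 1))‖
      ≤ ‖s‖ * (n : ℝ) ^ (-s.re - 1) := by
  have hn0 : (0 : ℝ) < n := by exact_mod_cast hn
  have hs1 : s - 1 ≠ 0 := by intro h; rw [sub_eq_zero] at h; simp [h] at hs
  have hs1' : 1 - s ≠ 0 := by rw [← neg_sub]; exact neg_ne_zero.2 hs1
  have key : ∀ x ∈ Set.Icc (n : ℝ) (n + 1), HasDerivWithinAt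
      (fun y : ℝ => (y : ℂ) ^ (1 - s) / (s - 1) + ((n + 1 : ℕ) : ℂ) ^ (-s) * y)
      (((n + 1 : ℕ) : ℂ) ^ (-s) - (x : ℂ) ^ (-s)) (Set.Icc (n : ℝ) (n + 1)) x := fun x hx => by
    have h1 := (hasDerivAt_ofReal_cpow_const (x := x) (by linarith [hx.1]) hs1').div_const (s - 1)
    have h2 := (Complex.ofRealCLM.hasDerivAt (x := x)).const_mul (((n + 1 : ℕ) : ℂ) ^ (-s))
    refine ((h1.add h2).congr_deriv ?_).hasDerivWithinAt
    rw [show (1 - s - 1 : ℂ) = -s by ring]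
    simp only [ofRealCLM_apply, ofReal_one, mul_one]
    field_simp
    ring
  have := (convex_Icc (n : ℝ) (n + 1)).norm_image_sub_le_of_norm_hasDerivWithin_le (𝕜 := ℝ)
    (C := ‖s‖ * (n : ℝ) ^ (-s.re - 1)) key (fun x hx => by
      have := norm_ofReal_cpow_neg_sub_le (s := s) (by linarith) hn0 hx
        (y := ((n + 1 : ℕ) : ℝ)) (by push_cast; exact ⟨by linarith, le_rfl⟩)
      simpa using this)
    (x := (n : ℝ)) (y := (n : ℝ) + 1) ⟨le_refl _, by linarith⟩ ⟨by linarith, le_refl _⟩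
  simp only [add_sub_cancel_left, norm_one, mul_one] at this
  refine le_trans (le_of_eq ?_) this
  congr 1
  push_cast
  ring

lemma norm_riemannZeta_le {η : ℝ} (hη : 0 < η) (hη1 : η ≤ 1) {s : ℂ} (hs : 1 < s.re)
    (hs2 : s.re ≤ 2) :
    ‖riemannZeta s‖ ≤ 1 / ‖s - 1‖ + (1 / η + 16) * (|s.im| + 2) ^ η := by
  set X : ℝ := |s.im| + 2 with hX
  have hX2 : 2 ≤ X := by rw [hX]; linarith [abs_nonneg s.im]
  set N := ⌊X⌋₊ with hNdef
  have hN : 1 ≤ N := Nat.one_le_floor_iff _ |>.2 (by linarith)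
  have hNX : (N : ℝ) ≤ X := Nat.floor_le (by linarith)
  have hN0 : (1 : ℝ) ≤ N := by exact_mod_cast hN
  have hXN : X ≤ 2 * N := by
    have := (Nat.lt_floor_add_one X).le
    linarith
  have hs0 : 0 < s.re := by linarith
  set g : ℕ → ℂ := fun n => (n : ℂ) ^ (1 - s) / (s - 1) with hg
  have hsum : HasSum (fun n : ℕ => ((n + 1 : ℕ) : ℂ) ^ (-s)) (riemannZeta s) := by
    have h1 := LSeriesHasSum_one hs
    have h2 := (hasSum_nat_add_iff' 1).2 h1
    simp only [Finset.range_one, Finset.sum_singleton, LSeries.term_zero, sub_zero] at h2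
    refine h2.congr_fun ?_ |> fun h => h
    intro n
    rw [LSeries.term_of_ne_zero (Nat.succ_ne_zero n), Complex.cpow_neg]
    simp
  have hlim := hsum.tendsto_sum_nat.comp (Filter.tendsto_add_atTop_nat N)
  have hglim : Filter.Tendsto (fun m : ℕ => g (m + N)) Filter.atTop (nhds 0) := by
    rw [tendsto_zero_iff_norm_tendsto_zero]
    have h2 : Filter.Tendsto (fun m : ℕ => ((m + N : ℕ) : ℝ) ^ (-(s.re - 1)) / ‖s - 1‖) Filter.atTop
        (nhds (0 / ‖s - 1‖)) :=
      ((tendsto_rpow_neg_atTop (by linarith)).comp (tendsto_natCast_atTop_atTop.comp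
        (Filter.tendsto_add_atTop_nat N))).div_const _
    rw [zero_div] at h2
    refine h2.congr fun m => ?_
    rw [hg, norm_div, Complex.norm_natCast_cpow_of_pos (by omega)]
    simp
  have htot := (hlim.add hglim)
  rw [add_zero] at htot
  refine le_of_tendsto htot.norm (Filter.Eventually.of_forall fun m => ?_)
  have hsplit : (((fun n => ∑ i ∈ Finset.range n, ((i + 1 : ℕ) : ℂ) ^ (-s)) ∘ fun a => a + N) m
      + g (m + N)) = ∑ i ∈ Finset.range N, ((i + 1 : ℕ) : ℂ) ^ (-s) + g N
      + ∑ j ∈ Finset.range m, (((N + j + 1 : ℕ) : ℂ) ^ (-s) - (g (N + j) - g (N + j + 1))) := by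
    simp only [Function.comp_apply]
    rw [add_comm m N, Finset.sum_range_add, Finset.sum_sub_distrib]
    have : ∑ j ∈ Finset.range m, (g (N + j) - g (N + j + 1)) = g N - g (N + m) := by
      induction m with
      | zero => simp
      | succ m ih => rw [Finset.sum_range_succ, ih]; rw [← add_assoc N m 1]; ring
    rw [this]; ring
  rw [hsplit]
  have h1 : ‖∑ n ∈ Finset.range N, ((n + 1 : ℕ) : ℂ) ^ (-s)‖ ≤ X ^ η / η := by
    refine (norm_sum_le _ _).trans (le_trans ?_ ((sum_rpow_sub_one_le hη hη1 N).trans ?_))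
    · refine Finset.sum_le_sum fun n _ => ?_
      rw [Complex.norm_natCast_cpow_of_pos (by omega), Complex.neg_re]
      exact Real.rpow_le_rpow_of_exponent_le (by push_cast; linarith [n.cast_nonneg (α := ℝ)])
            (by linarith)
    · gcongr
  have h2 : ‖g N‖ ≤ 1 / ‖s - 1‖ := by
    rw [hg, norm_div, Complex.norm_natCast_cpow_of_pos (by omega)]
    gcongr
    refine Real.rpow_le_one_of_one_le_of_nonpos hN0 ?_
    simp; linarith
  have h3 : ‖∑ j ∈ Finset.range m, (((N + j + 1 : ℕ) : ℂ) ^ (-s) - (g (N + j) - g (N + j + 1)))‖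
      ≤ 16 := by
    have hb : ∀ j ∈ Finset.range m,
        ‖(((N + j + 1 : ℕ) : ℂ) ^ (-s) - (g (N + j) - g (N + j + 1)))‖
        ≤ ‖s‖ * 8 * ((N + 1 + j : ℕ) : ℝ) ^ (-s.re - 1) := fun j _ => by
      refine (norm_natCast_cpow_sub_integral_le hs (n := N + j) (by omega)).trans ?_
      rw [mul_assoc]
      gcongr
      have hp : (0 : ℝ) < (N + j : ℕ) := by exact_mod_cast (by omega : 0 < N + j)
      have hle : ((N + 1 + j : ℕ) : ℝ) ≤ 2 * (N + j : ℕ) := by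
        exact_mod_cast (by omega : N + 1 + j ≤ 2 * (N + j))
      calc ((N + j : ℕ) : ℝ) ^ (-s.re - 1)
          = 2 ^ (s.re + 1) * (2 * ((N + j : ℕ) : ℝ)) ^ (-s.re - 1) := by
            rw [Real.mul_rpow (by norm_num) hp.le, ← mul_assoc, ← Real.rpow_add (by norm_num)]
            simp [show s.re + 1 + (-s.re - 1) = 0 by ring]
        _ ≤ 2 ^ (3 : ℝ) * ((N + 1 + j : ℕ) : ℝ) ^ (-s.re - 1) := by
            gcongr ?_ * ?_
            · exact Real.rpow_le_rpow_of_exponent_le (by norm_num) (by linarith)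
            · exact Real.rpow_le_rpow_of_nonpos (by positivity) hle (by linarith)
        _ = _ := by norm_num
    refine (norm_sum_le_of_le _ hb).trans ?_
    rw [← Finset.mul_sum]
    have hle := sum_rpow_neg_sub_one_le hs0 hN m
    have hN1 : (N : ℝ) ^ (-s.re) ≤ (N : ℝ)⁻¹ := by
      rw [← Real.rpow_neg_one]
      exact Real.rpow_le_rpow_of_exponent_le hN0 (by linarith)
    have hsn : ‖s‖ ≤ s.re * (2 * N) := by
      have := Complex.norm_le_abs_re_add_abs_im s
      rw [abs_of_pos hs0] at this
      nlinarith [abs_nonneg s.im]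
    calc ‖s‖ * 8 * ∑ j ∈ Finset.range m, ((N + 1 + j : ℕ) : ℝ) ^ (-s.re - 1)
        ≤ s.re * (2 * N) * 8 * ((N : ℝ)⁻¹ / s.re) := by
          gcongr
          exact hle.trans (by gcongr)
      _ = 16 := by field_simp; norm_num
  have h4 : 1 ≤ X ^ η := Real.one_le_rpow (by linarith) hη.le
  refine (norm_add_le _ _).trans ((add_le_add (norm_add_le _ _) le_rfl).trans ?_)
  have : (1 / η + 16) * X ^ η = X ^ η / η + 16 * X ^ η := by ring
  linarith

lemma DirichletCharacter.norm_LFunction_one_le (q : ℕ) [NeZero q] {η : ℝ}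
    (hη : 0 < η) (hη1 : η ≤ 1 / 2) {s : ℂ} (hs : 1 < s.re) (hs2 : s.re ≤ 2) :
    ‖(1 : DirichletCharacter ℂ q).LFunction s‖
      ≤ 1 / ‖s - 1‖ + (5 / η + 32) * (q * (|s.im| + 2)) ^ η := by
  set χ : DirichletCharacter ℂ q := 1
  have hq : (0 : ℝ) < q := by exact_mod_cast NeZero.pos q
  have hq1 : (1 : ℝ) ≤ q := by exact_mod_cast NeZero.pos q
  have hqc : (q : ℂ) ≠ 0 := by exact_mod_cast hq.ne'
  set m : ℂ := (∑ z, χ z) / q with hm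
  have hm1 : ‖m‖ ≤ 1 := by
    rw [hm, norm_div, Complex.norm_natCast, div_le_one hq]
    refine (norm_sum_le _ _).trans ((Finset.sum_le_sum fun z _ => χ.norm_le_one z).trans ?_)
    simp [ZMod.card]
  set Φ : ZMod q → ℂ := fun z => (χ z - m) / 2 with hΦ
  have h0 : ∑ z, Φ z = 0 := by
    rw [hΦ, ← Finset.sum_div, Finset.sum_sub_distrib]
    simp only [Finset.sum_const, Finset.card_univ, ZMod.card, nsmul_eq_mul, hm]
    field_simp
    simp
  have h1 : ∀ z, ‖Φ z‖ ≤ 1 := fun z => by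
    rw [hΦ, norm_div]
    have := (norm_sub_le (χ z) m).trans (add_le_add (χ.norm_le_one z) hm1)
    simp only [Complex.norm_ofNat]
    linarith
  have hL : χ.LFunction s = m * riemannZeta s + 2 * ZMod.LFunction Φ s := by
    rw [χ.LFunction_eq_LSeries hs, ZMod.LFunction_eq_LSeries Φ hs, ← LSeries_one_eq_riemannZeta hs,
      ← LSeries_smul, ← LSeries_smul, ← LSeries_add]
    · congr 1
      ext n
      simp [hΦ]
      ring
    · exact (LSeriesSummable_one_iff.2 hs).smul m
    · exact (ZMod.LSeriesSummable_of_one_lt_re Φ hs).smul 2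
  rw [hL]
  have hz := norm_riemannZeta_le hη (by linarith) hs hs2
  have hPhi := ZMod.norm_LFunction_le h0 h1 hη hη1 (s := s) (by linarith)
  have hX : (|s.im| + 2) ^ η ≤ (q * (|s.im| + 2)) ^ η := by
    gcongr
    nlinarith [abs_nonneg s.im]
  have hz2 : ‖m * riemannZeta s‖ ≤ ‖riemannZeta s‖ := by
    rw [norm_mul]; exact mul_le_of_le_one_left (norm_nonneg _) hm1
  have h3 : (1 / η + 16) * (|s.im| + 2) ^ η ≤ (1 / η + 16) * (q * (|s.im| + 2)) ^ η := by gcongr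
  refine (norm_add_le _ _).trans ?_
  rw [norm_mul 2, Complex.norm_ofNat]
  have e : (5 / η + 32) * (q * (|s.im| + 2)) ^ η = (1 / η + 16) * (q * (|s.im| + 2)) ^ η
    + 2 * ((2 / η + 8) * (q * (|s.im| + 2)) ^ η) := by ring
  linarith

open scoped ComplexOrder in
lemma iteratedDeriv_alternating_of_deriv_eq {f : ℂ → ℂ} {a : ℕ → ℂ} {x : ℝ} (ha : 0 ≤ a)
    (hx : LSeries.abscissaOfAbsConv a < x) (hf : AnalyticAt ℂ f x) (h0 : 0 ≤ f x)
    (hd : deriv f =ᶠ[nhds (x : ℂ)] fun s => -(LSeries a s * f s)) (m : ℕ) :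
    0 ≤ (-1) ^ m * iteratedDeriv m f x := by
  have hL : AnalyticAt ℂ (LSeries a) x :=
    LSeries_analyticOnNhd a x (by simpa using hx)
  induction m using Nat.strong_induction_on with
  | _ m ih =>
    rcases m with _ | m
    · simpa using h0
    · have e : iteratedDeriv (m + 1) f x = -∑ i ∈ Finset.range (m + 1),
          m.choose i * iteratedDeriv i (LSeries a) x * iteratedDeriv (m - i) f x := by
        rw [iteratedDeriv_succ', ← iteratedDeriv_fun_mul hL.contDiffAt hf.contDiffAt,
          ← iteratedDeriv_fun_neg]
        exact hd.iteratedDeriv_eq m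
      rw [e, pow_succ, mul_neg_one, neg_mul_neg, Finset.mul_sum]
      refine Finset.sum_nonneg fun i hi => ?_
      have hi' : i ≤ m := by simpa [Nat.lt_succ_iff] using hi
      have h1 := LSeries.iteratedDeriv_alternating ha hx i
      have h2 := ih (m - i) (by omega)
      have : (-1 : ℂ) ^ m = (-1) ^ i * (-1) ^ (m - i) := by
        rw [← pow_add, Nat.add_sub_cancel' hi']
      rw [this]
      have h3 := mul_nonneg (mul_nonneg (Nat.cast_nonneg (α := ℂ) (m.choose i)) h1) h2
      convert h3 using 1
      ring

lemma re_residue_ge_of_taylor {G : ℂ → ℂ} (hG : Differentiable ℂ G) {b : ℕ → ℝ} {r : ℂ}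
    {K c β : ℝ} (hb : ∀ m, 0 ≤ b m) (hc : c ≤ b 0)
    (hGb : ∀ m, iteratedDeriv m G 2 = (-1) ^ m * (m.factorial * (b m - r)))
    (hK : ∀ s ∈ Metric.sphere (2 : ℂ) (3 / 2), ‖G s‖ ≤ K) (hβ : 7 / 8 < β) (hβ1 : β < 1)
    (hle : (G β).re + r.re / (β - 1) ≤ 0) {M : ℕ} (hM : 1 ≤ M)
    (hKM : 4 * K * (3 / 4) ^ M ≤ c / 2) :
    c / 2 * (1 - β) ≤ r.re * (2 - β) ^ M := by
  have hK0 : 0 ≤ K := (norm_nonneg _).trans (hK (2 + (3 / 2 : ℝ)) (by simp))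
  set x := 2 - β with hxdef
  have hx0 : 0 < x := by linarith
  have hx1 : x - 1 = 1 - β := by rw [hxdef]; ring
  have hsum := Complex.hasSum_taylorSeries_of_entire hG 2 β
  have hterm : ∀ m : ℕ, ((m.factorial : ℂ)⁻¹ • ((β : ℂ) - 2) ^ m • iteratedDeriv m G 2)
      = ((b m : ℂ) - r) * (x ^ m : ℝ) := by
    intro m
    have : (m.factorial : ℂ) ≠ 0 := by exact_mod_cast m.factorial_ne_zero
    rw [hGb, show (β : ℂ) - 2 = -1 * (x : ℂ) by rw [hxdef]; push_cast; ring, mul_pow]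
    have h1 : (-1 : ℂ) ^ m * (-1) ^ m = 1 := by rw [← mul_pow]; simp
    simp only [smul_eq_mul]
    push_cast
    field_simp
    linear_combination ((b m : ℂ) - r) * (x : ℂ) ^ m * h1
  simp only [hterm] at hsum
  have hre := Complex.hasSum_re hsum
  have hre' : HasSum (fun m => (b m - r.re) * x ^ m) (G β).re := by
    convert hre using 2 with m
    rw [Complex.re_mul_ofReal]; simp
  have hbd : ∀ m, |b m - r.re| ≤ K * (2 / 3) ^ m := by
    intro m
    have h1 := Complex.norm_iteratedDeriv_le_of_forall_mem_sphere_norm_le m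
      (by norm_num : (0 : ℝ) < 3 / 2) hG.diffContOnCl hK
    have hf : (0 : ℝ) < m.factorial := by exact_mod_cast m.factorial_pos
    rw [hGb, norm_mul, norm_pow, norm_neg, norm_one, one_pow, one_mul, norm_mul,
      Complex.norm_natCast, mul_div_assoc, mul_le_mul_iff_right₀ hf] at h1
    have h2 := (Complex.abs_re_le_norm ((b m : ℂ) - r)).trans h1
    simp only [Complex.sub_re, Complex.ofReal_re] at h2
    refine h2.trans (le_of_eq ?_)
    rw [div_eq_mul_inv, ← inv_pow]
    norm_num
  rw [← hasSum_nat_add_iff' M] at hre'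
  have hgeo : HasSum (fun m => K * (3 / 4) ^ M * (3 / 4 : ℝ) ^ m) (K * (3 / 4) ^ M * 4) := by
    have := (hasSum_geometric_of_lt_one (by norm_num : (0 : ℝ) ≤ 3 / 4) (by norm_num)).mul_left
      (K * (3 / 4) ^ M)
    rwa [show (1 - 3 / 4 : ℝ)⁻¹ = 4 by norm_num] at this
  have htail : -(K * (3 / 4) ^ M * 4) ≤
      (G β).re - ∑ i ∈ Finset.range M, (b i - r.re) * x ^ i := by
    refine hasSum_le (fun m => ?_) hgeo.neg hre'
    have h1 : |(b (m + M) - r.re) * x ^ (m + M)| ≤ K * (3 / 4) ^ M * (3 / 4) ^ m := by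
      rw [abs_mul, abs_of_pos (pow_pos hx0 _)]
      calc _ ≤ K * (2 / 3) ^ (m + M) * (9 / 8) ^ (m + M) := by
            gcongr
            · exact hbd _
            · linarith
        _ = _ := by
          rw [mul_assoc, ← mul_pow, mul_assoc, ← pow_add, add_comm m M]; norm_num
    linarith [neg_abs_le ((b (m + M) - r.re) * x ^ (m + M))]
  have hhead : c - r.re * ((x ^ M - 1) / (x - 1))
      ≤ ∑ i ∈ Finset.range M, (b i - r.re) * x ^ i := by
    have hg : (∑ i ∈ Finset.range M, x ^ i) = (x ^ M - 1) / (x - 1) :=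
      geom_sum_eq (by linarith) M
    simp only [sub_mul, Finset.sum_sub_distrib, ← Finset.mul_sum, hg]
    have : b 0 ≤ ∑ i ∈ Finset.range M, b i * x ^ i := by
      refine le_trans (by simp) (Finset.single_le_sum (f := fun i => b i * x ^ i)
        (fun i _ => mul_nonneg (hb i) (pow_pos hx0 i).le) (Finset.mem_range.2 hM))
    linarith
  have hpos : 0 < 1 - β := by linarith
  have hkey : c / 2 ≤ r.re * x ^ M / (1 - β) := by
    have e : r.re * x ^ M / (1 - β) = r.re * ((x ^ M - 1) / (x - 1)) - r.re / (β - 1) := by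
      rw [hx1, show β - 1 = -(1 - β) by ring]
      field_simp
      ring
    rw [e]
    linarith
  rwa [le_div_iff₀ hpos] at hkey

lemma DirichletCharacter.hasDerivAt_LFunction {q : ℕ} [NeZero q] (χ : DirichletCharacter ℂ q)
    {s : ℂ} (hs : 1 < s.re) :
    HasDerivAt χ.LFunction
      (-(LSeries ((fun n : ℕ => χ n) * fun n => (ArithmeticFunction.vonMangoldt n : ℂ)) s
        * χ.LFunction s)) s := by
  have hd : DifferentiableAt ℂ χ.LFunction s :=
    DirichletCharacter.differentiableAt_LFunction χ s (Or.inl fun h => by simp [h] at hs)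
  refine hd.hasDerivAt.congr_deriv ?_
  have h0 : LSeries (fun n : ℕ => χ n) s ≠ 0 := χ.LSeries_ne_zero_of_one_lt_re hs
  rw [DirichletCharacter.LSeries_twist_vonMangoldt_eq χ hs, χ.deriv_LFunction_eq_deriv_LSeries hs,
    χ.LFunction_eq_LSeries hs]
  field_simp

lemma hasDerivAt_riemannZeta {s : ℂ} (hs : 1 < s.re) :
    HasDerivAt riemannZeta
      (-(LSeries (fun n => (ArithmeticFunction.vonMangoldt n : ℂ)) s * riemannZeta s)) s := by
  have hd : DifferentiableAt ℂ riemannZeta s :=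
    differentiableAt_riemannZeta fun h => by simp [h] at hs
  refine hd.hasDerivAt.congr_deriv ?_
  have h0 := riemannZeta_ne_zero_of_one_lt_re hs
  rw [ArithmeticFunction.LSeries_vonMangoldt_eq_deriv_riemannZeta_div hs]
  field_simp

open scoped ComplexOrder in
lemma DirichletCharacter.ofReal_le_LFunction_two {q : ℕ} [NeZero q] {χ : DirichletCharacter ℂ q}
    (hχ : χ.IsQuadratic) : ((2 - Real.pi ^ 2 / 6 : ℝ) : ℂ) ≤ χ.LFunction 2 := by
  have hs : (1 : ℝ) < (2 : ℂ).re := by norm_num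
  have h1 : HasSum (fun n : ℕ => 1 / (n : ℂ) ^ 2) (((Real.pi ^ 2 / 6 : ℝ)) : ℂ) := by
    have := Complex.hasSum_ofReal.2 hasSum_zeta_two
    simpa using this
  have h2 : HasSum (fun n : ℕ => if n = 1 then (2 : ℂ) else 0) 2 := hasSum_ite_eq 1 2
  have h3 := h2.sub h1
  rw [χ.LFunction_eq_LSeries hs]
  have h4 := (χ.LSeriesSummable_of_one_lt_re hs).hasSum
  push_cast
  push_cast at h3
  refine hasSum_le (fun n => ?_) h3 h4
  rcases eq_or_ne n 0 with rfl | hn0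
  · simp
  rw [LSeries.term_of_ne_zero hn0]
  have hc : (n : ℂ) ^ (2 : ℂ) = (n : ℂ) ^ 2 := by exact_mod_cast Complex.cpow_natCast (n : ℂ) 2
  rw [hc]
  rcases eq_or_ne n 1 with rfl | hn
  · simp; norm_num
  · have hp : (0 : ℂ) ≤ 1 / (n : ℂ) ^ 2 := by
      rw [show (1 : ℂ) / (n : ℂ) ^ 2 = ((1 / (n : ℝ) ^ 2 : ℝ) : ℂ) by push_cast; rfl]
      exact Complex.zero_le_real.2 (by positivity)
    simp only [hn, if_false, zero_sub]
    rcases hχ (n : ZMod q) with h | h | h <;> rw [h]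
    · simp
    · exact (neg_nonpos.2 hp).trans hp
    · rw [neg_div]

open ArithmeticFunction in
open scoped ComplexOrder in
lemma DirichletCharacter.alternating_iteratedDeriv_zeta_mul {q₁ q₂ q₃ : ℕ} [NeZero q₁] [NeZero q₂]
    [NeZero q₃] {χ₁ : DirichletCharacter ℂ q₁} {χ₂ : DirichletCharacter ℂ q₂}
    {χ₃ : DirichletCharacter ℂ q₃} (h₁ : χ₁.IsQuadratic) (h₂ : χ₂.IsQuadratic)
    (h₃ : χ₃.IsQuadratic) (hmul : ∀ n : ℕ, χ₃ n = χ₁ n * χ₂ n) (m : ℕ) :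
    0 ≤ (-1) ^ m * iteratedDeriv m
      (fun s => riemannZeta s * (χ₁.LFunction s * χ₂.LFunction s * χ₃.LFunction s)) 2 := by
  set a0 : ℕ → ℂ := fun n => (vonMangoldt n : ℂ) with ha0
  set a : ℕ → ℂ := a0 + (fun n : ℕ => χ₁ n) * a0 + (fun n : ℕ => χ₂ n) * a0
    + (fun n : ℕ => χ₃ n) * a0 with ha
  have hanon : 0 ≤ a := by
    intro n
    have e : a n = (1 + χ₁ n) * (1 + χ₂ n) * a0 n := by
      simp only [ha, Pi.add_apply, Pi.mul_apply, hmul]; ring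
    rw [e]
    refine mul_nonneg (mul_nonneg ?_ ?_) (Complex.zero_le_real.2 vonMangoldt_nonneg)
    · rcases h₁ (n : ZMod q₁) with h | h | h <;> rw [h] <;> norm_num
    · rcases h₂ (n : ZMod q₂) with h | h | h <;> rw [h] <;> norm_num
  have hsm0 : ∀ s : ℂ, 1 < s.re → LSeriesSummable a0 s := fun s hs => LSeriesSummable_vonMangoldt hs
  have hsm1 : ∀ s : ℂ, 1 < s.re → LSeriesSummable ((fun n : ℕ => χ₁ n) * a0) s :=
    fun s hs => DirichletCharacter.LSeriesSummable_twist_vonMangoldt χ₁ hs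
  have hsm2 : ∀ s : ℂ, 1 < s.re → LSeriesSummable ((fun n : ℕ => χ₂ n) * a0) s :=
    fun s hs => DirichletCharacter.LSeriesSummable_twist_vonMangoldt χ₂ hs
  have hsm3 : ∀ s : ℂ, 1 < s.re → LSeriesSummable ((fun n : ℕ => χ₃ n) * a0) s :=
    fun s hs => DirichletCharacter.LSeriesSummable_twist_vonMangoldt χ₃ hs
  have hsm : ∀ s : ℂ, 1 < s.re → LSeriesSummable a s := fun s hs =>
    (((hsm0 s hs).add (hsm1 s hs)).add (hsm2 s hs)).add (hsm3 s hs)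
  have habs : LSeries.abscissaOfAbsConv a < ((2 : ℝ) : EReal) := by
    refine lt_of_le_of_lt (LSeries.abscissaOfAbsConv_le_of_forall_lt_LSeriesSummable (x := 1)
      fun y hy => hsm y (by simpa using hy)) ?_
    exact_mod_cast (by norm_num : (1 : ℝ) < 2)
  have hd : ∀ s : ℂ, 1 < s.re → HasDerivAt
      (fun s => riemannZeta s * (χ₁.LFunction s * χ₂.LFunction s * χ₃.LFunction s))
      (-(LSeries a s * (riemannZeta s * (χ₁.LFunction s * χ₂.LFunction s * χ₃.LFunction s)))) s := by
    intro s hs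
    refine ((hasDerivAt_riemannZeta hs).mul (((χ₁.hasDerivAt_LFunction hs).mul
      (χ₂.hasDerivAt_LFunction hs)).mul (χ₃.hasDerivAt_LFunction hs))).congr_deriv ?_
    rw [ha, LSeries_add (((hsm0 s hs).add (hsm1 s hs)).add (hsm2 s hs)) (hsm3 s hs),
      LSeries_add ((hsm0 s hs).add (hsm1 s hs)) (hsm2 s hs), LSeries_add (hsm0 s hs) (hsm1 s hs)]
    simp only [ha0, Pi.mul_apply]
    ring
  have hopen : IsOpen {s : ℂ | 1 < s.re} := isOpen_lt continuous_const Complex.continuous_re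
  have h2 : (2 : ℂ) = ((2 : ℝ) : ℂ) := by norm_num
  have hnhds : {s : ℂ | 1 < s.re} ∈ nhds ((2 : ℝ) : ℂ) := hopen.mem_nhds (by simp)
  rw [h2]
  refine iteratedDeriv_alternating_of_deriv_eq hanon habs ?_ ?_ ?_ m
  · exact DifferentiableOn.analyticAt
      (fun s hs => (hd s hs).differentiableAt.differentiableWithinAt) hnhds
  · have hpi : (0 : ℂ) ≤ ((2 - Real.pi ^ 2 / 6 : ℝ) : ℂ) :=
      Complex.zero_le_real.2 (by nlinarith [Real.pi_lt_d2, Real.pi_pos])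
    rw [← h2]
    refine mul_nonneg ?_ (mul_nonneg (mul_nonneg ?_ ?_) ?_)
    · rw [riemannZeta_two]
      exact_mod_cast Complex.zero_le_real.2 (by positivity : (0 : ℝ) ≤ Real.pi ^ 2 / 6)
    · exact hpi.trans (ofReal_le_LFunction_two h₁)
    · exact hpi.trans (ofReal_le_LFunction_two h₂)
    · exact hpi.trans (ofReal_le_LFunction_two h₃)
  · filter_upwards [hnhds] with s hs
    exact (hd s hs).deriv

lemma exists_pow_three_quarters_le {K c β : ℝ} (hc : 0 < c) (hK : c / 8 ≤ K) (hβ1 : β < 1) :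
    ∃ M : ℕ, 1 ≤ M ∧ 4 * K * (3 / 4) ^ M ≤ c / 2 ∧
      (2 - β) ^ M ≤ Real.exp (1 - β) * (8 * K / c) ^ (4 * (1 - β)) := by
  have hY : 1 ≤ 8 * K / c := by rw [le_div_iff₀ hc]; linarith
  set Y := 8 * K / c with hYdef
  have hY0 : 0 < Y := by linarith
  have hlog : 0 ≤ Real.log Y := Real.log_nonneg hY
  refine ⟨⌊4 * Real.log Y⌋₊ + 1, by omega, ?_, ?_⟩
  · have h43 : 1 / 4 ≤ Real.log (4 / 3) := by
      have := Real.one_sub_inv_le_log_of_pos (by norm_num : (0 : ℝ) < 4 / 3)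
      norm_num at this ⊢
      linarith
    have h1 : Y ≤ (4 / 3) ^ (⌊4 * Real.log Y⌋₊ + 1) := by
      rw [← Real.log_le_log_iff hY0 (by positivity), Real.log_pow]
      have := Nat.lt_floor_add_one (4 * Real.log Y)
      push_cast
      nlinarith
    have h2 : (3 / 4 : ℝ) ^ (⌊4 * Real.log Y⌋₊ + 1) * (4 / 3) ^ (⌊4 * Real.log Y⌋₊ + 1) = 1 := by
      rw [← mul_pow]; norm_num
    have h3 : (3 / 4 : ℝ) ^ (⌊4 * Real.log Y⌋₊ + 1) * Y ≤ 1 := by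
      rw [← h2]; gcongr
    have h4 : 4 * K = Y * (c / 2) := by rw [hYdef]; field_simp; ring
    rw [h4]
    nlinarith
  · have hpos : 0 < 2 - β := by linarith
    have h1 : 2 - β ≤ Real.exp (1 - β) := by
      have := Real.add_one_le_exp (1 - β); linarith
    have h2 := Nat.floor_le (by positivity : 0 ≤ 4 * Real.log Y)
    calc (2 - β) ^ (⌊4 * Real.log Y⌋₊ + 1) ≤ Real.exp (1 - β) ^ (⌊4 * Real.log Y⌋₊ + 1) := by
          gcongr
      _ = Real.exp ((1 - β) + (1 - β) * (⌊4 * Real.log Y⌋₊ : ℝ)) := by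
          rw [← Real.exp_nat_mul]; congr 1; push_cast; ring
      _ ≤ Real.exp ((1 - β) + Real.log Y * (4 * (1 - β))) := by
          rw [Real.exp_le_exp]
          nlinarith [mul_le_mul_of_nonneg_left h2 (by linarith : 0 ≤ 1 - β)]
      _ = _ := by rw [Real.exp_add, Real.rpow_def_of_pos hY0]

lemma DirichletCharacter.norm_LFunction_le_of_mem_sphere {q : ℕ} [NeZero q]
    {χ : DirichletCharacter ℂ q} (hχ : χ ≠ 1) {s : ℂ} (hs : ‖s - 2‖ ≤ 3 / 2) :
    ‖χ.LFunction s‖ ≤ 24 * (q : ℝ) ^ (1 / 2 : ℝ) := by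
  have hre : 1 / 2 ≤ s.re := by
    have := (Complex.abs_re_le_norm (s - 2)).trans hs
    rw [abs_le] at this
    simp at this
    linarith
  have him : |s.im| ≤ 3 / 2 := by
    have := (Complex.abs_im_le_norm (s - 2)).trans hs
    simpa using this
  refine (norm_LFunction_le hχ (by norm_num : (0 : ℝ) < 1 / 2) le_rfl (by linarith)).trans ?_
  calc (2 / (1 / 2) + 8) * ((q : ℝ) * (|s.im| + 2)) ^ (1 / 2 : ℝ)
      ≤ 12 * ((q : ℝ) * 4) ^ (1 / 2 : ℝ) := by
        gcongr
        · norm_num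
        · linarith
    _ = 24 * (q : ℝ) ^ (1 / 2 : ℝ) := by
        rw [Real.mul_rpow (by positivity) (by norm_num), ← Real.sqrt_eq_rpow 4,
          show (4 : ℝ) = 2 ^ 2 by norm_num, Real.sqrt_sq (by norm_num)]
        ring

open scoped ComplexOrder in
lemma DirichletCharacter.exists_le_norm_LFunction_one_mul : ∃ c : ℝ, 0 < c ∧
    ∀ (q₁ q₂ q₃ : ℕ) [NeZero q₁] [NeZero q₂] [NeZero q₃] (χ₁ : DirichletCharacter ℂ q₁)
      (χ₂ : DirichletCharacter ℂ q₂) (χ₃ : DirichletCharacter ℂ q₃),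
      χ₁.IsQuadratic → χ₂.IsQuadratic → χ₃.IsQuadratic → χ₁ ≠ 1 → χ₂ ≠ 1 → χ₃ ≠ 1 →
      (∀ n : ℕ, χ₃ n = χ₁ n * χ₂ n) → ∀ β : ℝ, 7 / 8 < β → β < 1 →
      (riemannZeta β * (χ₁.LFunction β * χ₂.LFunction β * χ₃.LFunction β)).re ≤ 0 →
      c * (1 - β) * ((q₁ : ℝ) * q₂ * q₃) ^ (-(2 * (1 - β)))
        ≤ ‖χ₁.LFunction 1 * χ₂.LFunction 1 * χ₃.LFunction 1‖ := by
  obtain ⟨K₀, hK₀⟩ : ∃ K₀ : ℝ, ∀ s ∈ Metric.sphere (2 : ℂ) (3 / 2), ‖riemannZeta s‖ ≤ K₀ := by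
    refine (isCompact_sphere (2 : ℂ) (3 / 2)).exists_bound_of_continuousOn fun s hs => ?_
    refine (differentiableAt_riemannZeta fun h => ?_).continuousAt.continuousWithinAt
    rw [h] at hs
    norm_num [Complex.dist_eq] at hs
  have hK₀0 : 0 ≤ K₀ := (norm_nonneg _).trans (hK₀ (2 + (3 / 2 : ℝ)) (by simp))
  have hpi : 0 < 2 - Real.pi ^ 2 / 6 := by nlinarith [Real.pi_lt_d2, Real.pi_pos]
  set c₀ : ℝ := Real.pi ^ 2 / 6 * (2 - Real.pi ^ 2 / 6) ^ 3 with hc₀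
  have hc₀pos : 0 < c₀ := by positivity
  set K₁ : ℝ := (K₀ + 2) * 24 ^ 3 + c₀ with hK₁
  have hK₁pos : 0 < K₁ := by positivity
  refine ⟨c₀ / 2 * (Real.exp 1 * (8 * K₁ / c₀) ^ (4 : ℝ))⁻¹, by positivity, ?_⟩
  intro q₁ q₂ q₃ _ _ _ χ₁ χ₂ χ₃ h₁ h₂ h₃ n₁ n₂ n₃ hmul β hβ hβ1 hle
  set P : ℂ → ℂ := fun s => χ₁.LFunction s * χ₂.LFunction s * χ₃.LFunction s with hP
  have hPd : Differentiable ℂ P :=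
    ((differentiable_LFunction n₁).mul (differentiable_LFunction n₂)).mul
      (differentiable_LFunction n₃)
  set W : ℂ → ℂ := fun s => LFunctionTrivChar₁ 1 s * P s with hW
  have hWd : Differentiable ℂ W := (differentiable_LFunctionTrivChar₁ 1).mul hPd
  set G : ℂ → ℂ := dslope W 1 with hG
  have hGd : Differentiable ℂ G := by
    rw [← differentiableOn_univ]
    exact (Complex.differentiableOn_dslope Filter.univ_mem).2 hWd.differentiableOn
  have hGe : ∀ s : ℂ, s ≠ 1 → G s = riemannZeta s * P s - P 1 * (s - 1)⁻¹ := by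
    intro s hs
    have hs' : s - 1 ≠ 0 := sub_ne_zero.2 hs
    rw [hG, dslope_of_ne _ hs, slope_def_module, hW]
    simp only [LFunctionTrivChar₁, Function.update_self, Function.update_of_ne hs,
      LFunctionTrivChar, LFunction_modOne_eq, Nat.primeFactors_one, Finset.prod_empty, smul_eq_mul]
    field_simp
  set X : ℝ := (q₁ : ℝ) * q₂ * q₃ with hX
  have hq₁ : (1 : ℝ) ≤ q₁ := by exact_mod_cast NeZero.pos q₁
  have hq₂ : (1 : ℝ) ≤ q₂ := by exact_mod_cast NeZero.pos q₂
  have hq₃ : (1 : ℝ) ≤ q₃ := by exact_mod_cast NeZero.pos q₃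
  have hX1 : 1 ≤ X := one_le_mul_of_one_le_of_one_le (one_le_mul_of_one_le_of_one_le hq₁ hq₂) hq₃
  have hXs : 1 ≤ X ^ (1 / 2 : ℝ) := Real.one_le_rpow hX1 (by norm_num)
  have hPb : ∀ s : ℂ, ‖s - 2‖ ≤ 3 / 2 → ‖P s‖ ≤ 24 ^ 3 * X ^ (1 / 2 : ℝ) := by
    intro s hs
    rw [hP, norm_mul, norm_mul]
    calc _ ≤ (24 * (q₁ : ℝ) ^ (1 / 2 : ℝ)) * (24 * (q₂ : ℝ) ^ (1 / 2 : ℝ))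
          * (24 * (q₃ : ℝ) ^ (1 / 2 : ℝ)) := by
          gcongr
          · exact norm_LFunction_le_of_mem_sphere n₁ hs
          · exact norm_LFunction_le_of_mem_sphere n₂ hs
          · exact norm_LFunction_le_of_mem_sphere n₃ hs
      _ = _ := by
          rw [hX, Real.mul_rpow (by positivity) (by positivity),
            Real.mul_rpow (by positivity) (by positivity)]
          ring
  set K : ℝ := K₁ * X ^ (1 / 2 : ℝ) with hK
  have hKb : ∀ s ∈ Metric.sphere (2 : ℂ) (3 / 2), ‖G s‖ ≤ K := by
    intro s hs
    have hs2 : ‖s - 2‖ = 3 / 2 := by rwa [mem_sphere_iff_norm] at hs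
    have hs1 : 1 / 2 ≤ ‖s - 1‖ := by
      have := norm_sub_norm_le (s - 2) (-1)
      rw [hs2, norm_neg, norm_one, show s - 2 - -1 = s - 1 by ring] at this
      linarith
    have hne : s ≠ 1 := by
      rintro rfl
      norm_num at hs1
    rw [hGe s hne]
    have hinv : ‖(s - 1)⁻¹‖ ≤ 2 := by
      rw [norm_inv, inv_le_comm₀ (by linarith) (by norm_num)]
      linarith
    calc _ ≤ ‖riemannZeta s‖ * ‖P s‖ + ‖P 1‖ * ‖(s - 1)⁻¹‖ := by
          rw [← norm_mul, ← norm_mul]; exact norm_sub_le _ _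
      _ ≤ K₀ * (24 ^ 3 * X ^ (1 / 2 : ℝ)) + 24 ^ 3 * X ^ (1 / 2 : ℝ) * 2 := by
          gcongr
          · exact hK₀ s hs
          · exact hPb s hs2.le
          · exact hPb 1 (by norm_num)
      _ ≤ K := by
          rw [hK, hK₁]
          nlinarith
  have halt := alternating_iteratedDeriv_zeta_mul h₁ h₂ h₃ hmul
  set f : ℂ → ℂ := fun s => riemannZeta s * P s with hf
  set b : ℕ → ℝ := fun m => ((-1) ^ m * iteratedDeriv m f 2).re / m.factorial with hb
  have hbf : ∀ m, iteratedDeriv m f 2 = (-1) ^ m * (m.factorial * (b m : ℂ)) := by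
    intro m
    have h0 := halt m
    have h1 : (((-1) ^ m * iteratedDeriv m f 2).re : ℂ) = (-1) ^ m * iteratedDeriv m f 2 :=
      (Complex.eq_re_of_ofReal_le (r := 0) (by simpa using h0)).symm
    have h3 : (m.factorial : ℂ) ≠ 0 := by exact_mod_cast m.factorial_ne_zero
    rw [hb]
    push_cast
    rw [h1, mul_div_cancel₀ _ h3, ← mul_assoc, ← mul_pow]
    simp
  have hev : G =ᶠ[nhds 2] fun s => f s - P 1 * (s - 1)⁻¹ := by
    filter_upwards [isOpen_ne.mem_nhds (by norm_num : (2 : ℂ) ≠ 1)] with s hs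
    exact hGe s hs
  have hfan : AnalyticAt ℂ f 2 := by
    have hz : DifferentiableOn ℂ f {s | s ≠ 1} := fun s hs =>
      ((differentiableAt_riemannZeta hs).mul (hPd s)).differentiableWithinAt
    exact hz.analyticAt (isOpen_ne.mem_nhds (by norm_num))
  have hian : AnalyticAt ℂ (fun s : ℂ => P 1 * (s - 1)⁻¹) 2 :=
    analyticAt_const.mul ((analyticAt_id.sub analyticAt_const).inv (by norm_num))
  have hGb : ∀ m, iteratedDeriv m G 2 = (-1) ^ m * (m.factorial * (b m - P 1)) := by
    intro m
    rw [hev.iteratedDeriv_eq m, iteratedDeriv_fun_sub hfan.contDiffAt hian.contDiffAt, hbf,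
      iteratedDeriv_const_mul_field, iteratedDeriv_comp_sub_const m (fun z => z⁻¹) 1,
      iteratedDeriv_eq_iterate]
    change _ - P 1 * deriv^[m] Inv.inv ((2 : ℂ) - 1) = _
    rw [iter_deriv_inv]
    norm_num
    ring
  have hb0 : c₀ ≤ b 0 := by
    have hp : (0 : ℂ) ≤ ((2 - Real.pi ^ 2 / 6 : ℝ) : ℂ) := Complex.zero_le_real.2 hpi.le
    have hz : (0 : ℂ) ≤ ((Real.pi ^ 2 / 6 : ℝ) : ℂ) := Complex.zero_le_real.2 (by positivity)
    have h12 := mul_le_mul (ofReal_le_LFunction_two h₁) (ofReal_le_LFunction_two h₂) hp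
      (hp.trans (ofReal_le_LFunction_two h₁))
    have h123 := mul_le_mul_of_nonneg_left (mul_le_mul h12 (ofReal_le_LFunction_two h₃) hp
      ((mul_nonneg hp hp).trans h12)) hz
    have hre := (Complex.le_def.1 h123).1
    have e : b 0 = (f 2).re := by rw [hb]; simp
    rw [e, show f 2 = riemannZeta 2 * P 2 from rfl, riemannZeta_two]
    refine le_trans (le_of_eq ?_) (hre.trans (le_of_eq ?_))
    · simp only [← Complex.ofReal_mul, Complex.ofReal_re, hc₀]
      ring
    · push_cast
      rfl
  obtain ⟨M, hM, hKM, hMe⟩ := exists_pow_three_quarters_le (K := K) hc₀pos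
    (by rw [hK, hK₁]; nlinarith) hβ1
  have hres := re_residue_ge_of_taylor hGd (r := P 1) (fun m => ?_) hb0 hGb hKb hβ hβ1 ?_ hM hKM
  · have hYe : (8 * K / c₀) ^ (4 * (1 - β)) ≤ (8 * K₁ / c₀) ^ (4 : ℝ) * X ^ (2 * (1 - β)) := by
      have h1 : 1 ≤ 8 * K₁ / c₀ := by
        rw [le_div_iff₀ hc₀pos, hK₁]; nlinarith
      rw [hK, show 8 * (K₁ * X ^ (1 / 2 : ℝ)) / c₀ = 8 * K₁ / c₀ * X ^ (1 / 2 : ℝ) by ring,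
        Real.mul_rpow (by linarith) (by linarith), ← Real.rpow_mul (by linarith)]
      gcongr ?_ * ?_
      · exact Real.rpow_le_rpow_of_exponent_le h1 (by linarith)
      · exact le_of_eq (by ring_nf)
    have hE : (2 - β) ^ M
        ≤ Real.exp 1 * (8 * K₁ / c₀) ^ (4 : ℝ) * X ^ (2 * (1 - β)) := by
      rw [mul_assoc]
      refine hMe.trans ?_
      gcongr
      linarith
    have hXp : 0 < X ^ (2 * (1 - β)) := by positivity
    have hn : (P 1).re ≤ ‖P 1‖ := Complex.re_le_norm _
    have hkey : c₀ / 2 * (1 - β)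
        ≤ ‖P 1‖ * (Real.exp 1 * (8 * K₁ / c₀) ^ (4 : ℝ) * X ^ (2 * (1 - β))) := by
      refine hres.trans ?_
      have : 0 ≤ (2 - β) ^ M := pow_nonneg (by linarith) _
      gcongr
    rw [Real.rpow_neg (by linarith)]
    have hD : 0 < Real.exp 1 * (8 * K₁ / c₀) ^ (4 : ℝ) := by positivity
    calc _ = c₀ / 2 * (1 - β) / (Real.exp 1 * (8 * K₁ / c₀) ^ (4 : ℝ) * X ^ (2 * (1 - β))) := by
          field_simp
      _ ≤ _ := by rwa [div_le_iff₀ (by positivity)]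
  · rw [hb]
    have h0 := halt m
    exact div_nonneg (Complex.le_def.1 h0).1 (by positivity)
  · rw [hGe β (by exact_mod_cast hβ1.ne), Complex.sub_re]
    have : (P 1 * ((β : ℂ) - 1)⁻¹).re = (P 1).re / (β - 1) := by
      rw [show ((β : ℂ) - 1)⁻¹ = (((β - 1)⁻¹ : ℝ) : ℂ) by push_cast; rfl, Complex.re_mul_ofReal,
        div_eq_mul_inv]
    rw [this]
    linarith

lemma exists_jacobiSym_eq_neg_one {D : ℕ} (hD : ¬ IsSquare D) :
    ∃ n : ℕ, Odd n ∧ jacobiSym D n = -1 := by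
  have hD0 : 0 < D := Nat.pos_of_ne_zero fun h => hD (h ▸ ⟨0, rfl⟩)
  obtain ⟨r, s, hr, hs, hrs, hsq⟩ := Nat.sq_mul_squarefree_of_pos hD0
  have hr1 : r ≠ 1 := fun h => hD ⟨s, by rw [← hrs, h]; ring⟩
  obtain ⟨p, hp, r', rfl⟩ := Nat.exists_prime_and_dvd hr1
  obtain ⟨e, s', hs', rfl⟩ := Nat.exists_eq_pow_mul_and_not_dvd hs.ne' p hp.ne_one
  have hpr' : ¬ p ∣ r' := fun h => hp.not_isUnit (hsq p (Nat.mul_dvd_mul_left p h))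
  set t := s' ^ 2 * r' with ht
  have hpt : p.Coprime t := by
    rw [hp.coprime_iff_not_dvd, ht, hp.dvd_mul]
    rintro (h | h)
    · exact hs' (hp.dvd_of_dvd_pow h)
    · exact hpr' h
  have hDt : D = p ^ (2 * e + 1) * t := by rw [← hrs, ht]; ring
  have ht0 : 0 < t := Nat.pos_of_ne_zero fun h => by simp [hDt, h] at hD0
  have hval : ∀ n : ℕ, n % (4 * t) = 1 → jacobiSym p n = -1 →
      Odd n ∧ jacobiSym D n = -1 := by
    intro n hn hpn
    have hodd : Odd n := by
      rw [Nat.odd_iff]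
      have := Nat.mod_mod_of_dvd n (Dvd.intro (2 * t) (by ring) : 2 ∣ 4 * t)
      rw [hn] at this
      omega
    refine ⟨hodd, ?_⟩
    rw [hDt]
    push_cast
    rw [jacobiSym.mul_left, jacobiSym.pow_left, hpn, jacobiSym.mod_right' t hodd, hn,
      jacobiSym.one_right, pow_succ, pow_mul]
    norm_num
  rcases hp.eq_two_or_odd' with rfl | hpodd
  · obtain ⟨n, hn8, hnt⟩ := Nat.chineseRemainder
      (Nat.Coprime.pow_left 3 hpt : (2 ^ 3).Coprime t) 5 1
    refine ⟨n, hval n ?_ ?_⟩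
    · have h4 : n ≡ 1 [MOD 4] := (hn8.of_dvd (by norm_num : 4 ∣ 2 ^ 3)).trans (by decide)
      have := (Nat.modEq_and_modEq_iff_modEq_mul (Nat.Coprime.pow_left 2 hpt)).1 ⟨h4, hnt⟩
      have h5 : n % (2 ^ 2 * t) = 1 % (2 ^ 2 * t) := this
      rw [show (4 : ℕ) = 2 ^ 2 by norm_num, h5, Nat.mod_eq_of_lt]
      omega
    · have h8 : n % 8 = 5 := hn8
      have hodd : Odd n := by rw [Nat.odd_iff]; omega
      rw [show ((2 : ℕ) : ℤ) = 2 by rfl, jacobiSym.at_two hodd, ZMod.χ₈_nat_mod_eight, h8]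
      rfl
  · have := Fact.mk hp
    have hp2 : p ≠ 2 := fun h => by rw [h] at hpodd; exact absurd hpodd (by decide)
    obtain ⟨a, ha⟩ := FiniteField.exists_nonsquare (F := ZMod p)
      (by rwa [ZMod.ringChar_zmod_n])
    have hcop : (4 * t).Coprime p := by
      refine Nat.Coprime.symm (Nat.Coprime.mul_right ?_ hpt)
      exact Nat.Coprime.pow_right 2 (Nat.coprime_two_right.2 hpodd)
    obtain ⟨n, hn4, hna⟩ := Nat.chineseRemainder hcop 1 a.val
    have hn : n % (4 * t) = 1 := by
      have : n % (4 * t) = 1 % (4 * t) := hn4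
      rw [this, Nat.mod_eq_of_lt]; omega
    refine ⟨n, hval n hn ?_⟩
    have hn1 : n % 4 = 1 := by
      have := Nat.mod_mod_of_dvd n (Dvd.intro t rfl : 4 ∣ 4 * t)
      omega
    rw [jacobiSym.quadratic_reciprocity_one_mod_four' hpodd hn1, ← jacobiSym.legendreSym.to_jacobiSym,
      legendreSym.eq_neg_one_iff]
    have : ((n : ℤ) : ZMod p) = a := by
      have := (ZMod.natCast_eq_natCast_iff n a.val p).2 hna
      simpa using this
    rwa [this]

lemma exists_dirichletCharacter_eq_jacobiSym {D : ℕ} (hD : 0 < D) :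
    ∃ χ : DirichletCharacter ℂ (4 * D),
      ∀ n : ℕ, χ n = if Odd n then (jacobiSym D n : ℂ) else 0 := by
  have : NeZero (4 * D) := ⟨by omega⟩
  set F : ℕ → ℂ := fun n => if Odd n then (jacobiSym D n : ℂ) else 0 with hF
  have hmod : ∀ n, F (n % (4 * D)) = F n := by
    intro n
    have h2 : Even (4 * D) := ⟨2 * D, by ring⟩
    have hodd : Odd (n % (4 * D)) ↔ Odd n := by
      rw [Nat.odd_iff, Nat.odd_iff, Nat.mod_mod_of_dvd n h2.two_dvd]
    simp only [hF, hodd]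
    split_ifs with h
    · rw [← jacobiSym.mod_right' D h]
    · rfl
  have hmul : ∀ m n, F (m * n) = F m * F n := by
    intro m n
    simp only [hF, Nat.odd_mul]
    by_cases hm : Odd m <;> by_cases hn : Odd n <;> simp only [hm, hn, and_self, and_true,
      and_false, if_true, if_false, mul_zero, zero_mul]
    have : NeZero m := ⟨hm.pos.ne'⟩
    have : NeZero n := ⟨hn.pos.ne'⟩
    rw [jacobiSym.mul_right]
    push_cast
    rfl
  refine ⟨{ toFun := fun a => F a.val, map_one' := ?_, map_mul' := ?_, map_nonunit' := ?_ }, ?_⟩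
  · rw [ZMod.val_one'' (by omega)]
    simp [hF]
  · intro a b
    rw [ZMod.val_mul, hmod, hmul]
  · intro a ha
    by_contra hne
    apply ha
    have hodd : Odd a.val := by
      by_contra h
      exact hne (by simp [hF, h])
    have hj : jacobiSym D a.val ≠ 0 := by
      intro h
      exact hne (by simp [hF, h])
    have : NeZero a.val := ⟨hodd.pos.ne'⟩
    have hg : (D : ℤ).gcd a.val = 1 := by
      by_contra h
      exact hj ((jacobiSym.eq_zero_iff_not_coprime).2 h)
    have hcop : a.val.Coprime (4 * D) := by
      refine Nat.Coprime.mul_right ?_ ?_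
      · exact Nat.Coprime.pow_right 2 (Nat.coprime_two_right.2 hodd)
      · rw [Int.gcd_natCast_natCast] at hg
        exact Nat.Coprime.symm hg
    have := (ZMod.isUnit_iff_coprime a.val (4 * D)).2 hcop
    rwa [ZMod.natCast_zmod_val] at this
  · intro n
    change F (n : ZMod (4 * D)).val = F n
    rw [ZMod.val_natCast, hmod]

lemma eq_of_squarefree_of_isSquare_mul {a b : ℕ} (ha : Squarefree a) (hb : Squarefree b)
    (h : IsSquare (a * b)) : a = b := by
  have key : ∀ a b : ℕ, Squarefree a → IsSquare (a * b) → ∀ p : ℕ, p.Prime → p ∣ a → p ∣ b := by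
    rintro a b ha ⟨c, hc⟩ p hp ⟨a', rfl⟩
    have hpc : p ∣ c := by
      have : p ∣ c * c := hc ▸ (Dvd.intro a' rfl).mul_right b
      exact (hp.dvd_mul.1 this).elim id id
    obtain ⟨c', rfl⟩ := hpc
    have h1 : a' * b = p * (c' * c') := by
      have := hp.pos
      refine Nat.eq_of_mul_eq_mul_left this ?_
      linarith
    rcases hp.dvd_mul.1 (Dvd.intro _ h1.symm) with h2 | h2
    · exact absurd (ha p (Nat.mul_dvd_mul_left p h2)) hp.not_isUnit
    · exact h2
  rw [Nat.Squarefree.ext_iff ha hb]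
  exact fun p hp => ⟨key a b ha h p hp, key b a hb (by rwa [mul_comm]) p hp⟩

/-- The Dirichlet character modulo `4 * D` with value `J(D | n)` at odd `n`. -/
noncomputable def jacobiChar (D : ℕ) [NeZero D] : DirichletCharacter ℂ (4 * D) :=
  (exists_dirichletCharacter_eq_jacobiSym (NeZero.pos D)).choose

lemma jacobiChar_natCast (D : ℕ) [NeZero D] (n : ℕ) :
    jacobiChar D n = if Odd n then (jacobiSym D n : ℂ) else 0 :=
  (exists_dirichletCharacter_eq_jacobiSym (NeZero.pos D)).choose_spec n

lemma jacobiChar_isQuadratic (D : ℕ) [NeZero D] : (jacobiChar D).IsQuadratic := by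
  intro a
  obtain ⟨n, rfl⟩ := ZMod.natCast_zmod_surjective a
  rw [jacobiChar_natCast]
  split_ifs
  · rcases jacobiSym.trichotomy D n with h | h | h <;> simp [h]
  · simp

lemma jacobiChar_ne_one {D : ℕ} [NeZero D] (hD : ¬ IsSquare D) : jacobiChar D ≠ 1 := by
  intro h
  obtain ⟨n, hn, hj⟩ := exists_jacobiSym_eq_neg_one hD
  have h1 := jacobiChar_natCast D n
  rw [h, if_pos hn, hj] at h1
  by_cases hu : IsUnit (n : ZMod (4 * D))
  · rw [MulChar.one_apply hu] at h1
    norm_num at h1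
  · rw [MulChar.map_nonunit _ hu] at h1
    norm_num at h1

lemma jacobiChar_mul (D E : ℕ) [NeZero D] [NeZero E] (n : ℕ) :
    jacobiChar (D * E) n = jacobiChar D n * jacobiChar E n := by
  simp only [jacobiChar_natCast]
  split_ifs
  · push_cast
    rw [jacobiSym.mul_left]
    push_cast
    rfl
  · simp

open scoped ComplexConjugate in
lemma DirichletCharacter.im_LFunction_ofReal {q : ℕ} [NeZero q] {χ : DirichletCharacter ℂ q}
    (hχ : χ.IsQuadratic) (h1 : χ ≠ 1) (σ : ℝ) : (χ.LFunction σ).im = 0 := by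
  have hd := differentiable_LFunction h1
  have hd' : Differentiable ℂ (conj ∘ χ.LFunction ∘ conj) := fun s => by
    have := (hd (conj s)).conj_conj
    simpa using this
  have heq : conj ∘ χ.LFunction ∘ conj = χ.LFunction := by
    refine AnalyticOnNhd.eq_of_eventuallyEq (𝕜 := ℂ) (z₀ := 2)
      (fun s _ => hd'.analyticAt s) (fun s _ => hd.analyticAt s) ?_
    have hopen : IsOpen {s : ℂ | 1 < s.re} := isOpen_lt continuous_const Complex.continuous_re
    filter_upwards [hopen.mem_nhds (by simp : (2 : ℂ) ∈ {s : ℂ | 1 < s.re})] with s hs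
    have hs' : 1 < (conj s).re := by simpa using hs
    rw [Function.comp_apply, Function.comp_apply, χ.LFunction_eq_LSeries hs',
      χ.LFunction_eq_LSeries hs, LSeries, LSeries, Complex.conj_tsum]
    refine tsum_congr fun n => ?_
    rcases eq_or_ne n 0 with rfl | hn
    · simp
    · rw [LSeries.term_of_ne_zero hn, LSeries.term_of_ne_zero hn, map_div₀,
        Complex.cpow_conj _ _ (by rw [Complex.natCast_arg]; exact Real.pi_ne_zero.symm),
        Complex.conj_conj, Complex.conj_natCast]
      congr 1
      rcases hχ (n : ZMod q) with h | h | h <;> simp [h]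
  have := congrFun heq (σ : ℂ)
  simp only [Function.comp_apply, Complex.conj_ofReal] at this
  exact Complex.conj_eq_iff_im.1 this

lemma DirichletCharacter.re_LFunction_pos {q : ℕ} [NeZero q] {χ : DirichletCharacter ℂ q}
    (hχ : χ.IsQuadratic) (h1 : χ ≠ 1) {σ₀ : ℝ}
    (h0 : ∀ σ : ℝ, σ₀ < σ → σ < 1 → χ.LFunction σ ≠ 0) {σ : ℝ} (hσ : σ₀ < σ) (hσ2 : σ ≤ 2) :
    0 < (χ.LFunction σ).re := by
  have hcont : Continuous fun x : ℝ => (χ.LFunction x).re :=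
    Complex.continuous_re.comp ((differentiable_LFunction h1).continuous.comp
      Complex.continuous_ofReal)
  have h2 : 0 < (χ.LFunction (2 : ℝ)).re := by
    have := (Complex.le_def.1 (ofReal_le_LFunction_two hχ)).1
    rw [Complex.ofReal_re] at this
    have hpi : 0 < 2 - Real.pi ^ 2 / 6 := by nlinarith [Real.pi_lt_d2, Real.pi_pos]
    exact_mod_cast hpi.trans_le this
  by_contra! hneg
  obtain ⟨x, hx, hx0⟩ := intermediate_value_Icc hσ2 hcont.continuousOn
    (⟨hneg, h2.le⟩ : (0 : ℝ) ∈ Set.Icc _ _)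
  have hz : χ.LFunction x = 0 := Complex.ext hx0 (im_LFunction_ofReal hχ h1 x)
  rcases lt_or_ge x 1 with hlt | hge
  · exact h0 x (hσ.trans_le hx.1) hlt hz
  · exact χ.LFunction_ne_zero_of_one_le_re (Or.inl h1) (by simpa using hge) hz

lemma exists_riemannZeta_re_neg :
    ∃ η : ℝ, 0 < η ∧ ∀ β : ℝ, 1 - η < β → β < 1 → (riemannZeta β).re < 0 := by
  have h := riemannZeta_residue_one
  have h1 : ∀ᶠ s in nhdsWithin (1 : ℂ) {1}ᶜ, 0 < ((s - 1) * riemannZeta s).re := by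
    refine (Complex.continuous_re.tendsto _ |>.comp h).eventually (lt_mem_nhds ?_)
    simp
  rw [eventually_nhdsWithin_iff, Metric.eventually_nhds_iff] at h1
  obtain ⟨η, hη, h2⟩ := h1
  refine ⟨η, hη, fun β hβ hβ1 => ?_⟩
  have h3 := h2 (y := (β : ℂ)) (by
    rw [← Complex.ofReal_one, Complex.dist_of_im_eq (by simp)]
    simp only [Complex.ofReal_re, Real.dist_eq, abs_lt]
    constructor <;> linarith) (by
    simp only [Set.mem_compl_iff, Set.mem_singleton_iff]
    exact_mod_cast hβ1.ne)
  rw [show ((β : ℂ) - 1) = ((β - 1 : ℝ) : ℂ) by push_cast; rfl, Complex.re_ofReal_mul] at h3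
  by_contra! hc
  nlinarith

/-- There is an auxiliary modulus and a point `β` close to `1` at which all the products
`ζ(β) L(β, χ_E) L(β, χ_D) L(β, χ_ED)` are nonpositive. -/
lemma exists_jacobiChar_product_nonpos {η : ℝ} (hη : 0 < η) :
    ∃ (E : ℕ) (_ : NeZero E) (β : ℝ), ¬ IsSquare E ∧ 1 - η < β ∧ β < 1 ∧
      ∀ (D : ℕ) [NeZero D], ¬ IsSquare D → ¬ IsSquare (E * D) →
        (riemannZeta β * ((jacobiChar E).LFunction β * (jacobiChar D).LFunction β
          * (jacobiChar (E * D)).LFunction β)).re ≤ 0 := by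
  obtain ⟨η₀, hη₀, hz⟩ := exists_riemannZeta_re_neg
  by_cases hex : ∃ (E : ℕ) (_ : NeZero E) (β : ℝ), ¬ IsSquare E ∧ 1 - η < β ∧ β < 1 ∧
      (jacobiChar E).LFunction β = 0
  · obtain ⟨E, hE, β, h1, h2, h3, h4⟩ := hex
    refine ⟨E, hE, β, h1, h2, h3, fun D _ _ _ => ?_⟩
    simp [h4]
  · push Not at hex
    have h2 : ¬ IsSquare 2 := by
      rintro ⟨r, hr⟩
      have : r < 2 := by nlinarith
      interval_cases r <;> omega
    set m := min η η₀ with hm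
    have hm0 : 0 < m := lt_min hη hη₀
    have hβη : 1 - η < 1 - m / 2 := by linarith [min_le_left η η₀]
    have hβη₀ : 1 - η₀ < 1 - m / 2 := by linarith [min_le_right η η₀]
    refine ⟨2, inferInstance, 1 - m / 2, h2, hβη, by linarith, fun D _ hD h2D => ?_⟩
    have key : ∀ (D : ℕ) [NeZero D], ¬ IsSquare D →
        ∃ r : ℝ, 0 < r ∧ (jacobiChar D).LFunction ((1 - m / 2 : ℝ) : ℂ) = r := by
      intro D _ hD
      refine ⟨_, DirichletCharacter.re_LFunction_pos (jacobiChar_isQuadratic D)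
        (jacobiChar_ne_one hD) (fun σ hσ hσ1 => hex D inferInstance σ hD hσ hσ1) hβη
        (by linarith), ?_⟩
      exact Complex.ext (by simp) (DirichletCharacter.im_LFunction_ofReal
        (jacobiChar_isQuadratic D) (jacobiChar_ne_one hD) _)
    obtain ⟨r₁, p₁, e₁⟩ := key 2 h2
    obtain ⟨r₂, p₂, e₂⟩ := key D hD
    obtain ⟨r₃, p₃, e₃⟩ := key (2 * D) h2D
    rw [e₁, e₂, e₃, ← Complex.ofReal_mul, ← Complex.ofReal_mul, Complex.re_mul_ofReal]
    exact mul_nonpos_of_nonpos_of_nonneg (hz _ hβη₀ (by linarith)).le (by positivity)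

lemma Squarefree.not_isSquare {D : ℕ} (hD : Squarefree D) (hD1 : D ≠ 1) : ¬ IsSquare D := by
  rintro ⟨r, rfl⟩
  have := hD r dvd_rfl
  rw [Nat.isUnit_iff] at this
  exact hD1 (by rw [this])

/-- **Siegel's theorem** for the characters `jacobiChar D`. -/
theorem exists_le_norm_jacobiChar_LFunction_one {ε : ℝ} (hε : 0 < ε) :
    ∃ c : ℝ, 0 < c ∧ ∀ (D : ℕ) [NeZero D], Squarefree D → D ≠ 1 →
      c * (D : ℝ) ^ (-ε) ≤ ‖(jacobiChar D).LFunction 1‖ := by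
  set η := min (ε / 8) (1 / 8) with hηdef
  have hη : 0 < η := lt_min (by linarith) (by norm_num)
  have hηε : 5 * η ≤ ε := by linarith [min_le_left (ε / 8) (1 / 8)]
  have hη8 : η ≤ 1 / 8 := min_le_right _ _
  obtain ⟨E, hE, β, hEsq, hβη, hβ1, hprod⟩ := exists_jacobiChar_product_nonpos hη
  obtain ⟨c₀, hc₀, hcore⟩ := DirichletCharacter.exists_le_norm_LFunction_one_mul
  obtain ⟨C, hC, hbound⟩ := DirichletCharacter.exists_norm_iteratedDeriv_LFunction_le hη 0
  have hne : ∀ (D : ℕ) [NeZero D], ¬ IsSquare D → 0 < ‖(jacobiChar D).LFunction 1‖ :=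
    fun D _ hD => norm_pos_iff.2
      (DirichletCharacter.LFunction_apply_one_ne_zero (jacobiChar_ne_one hD))
  have hE0 : (0 : ℝ) < E := by exact_mod_cast NeZero.pos E
  set C₁ := ‖(jacobiChar E).LFunction 1‖ with hC₁
  have hC₁0 : 0 < C₁ := hne E hEsq
  set c₁ : ℝ := c₀ * (1 - β) * (64 * (E : ℝ) ^ 2) ^ (-(2 * η)) / (C₁ * (C * (8 * (E : ℝ)) ^ η))
    with hc₁
  have hβ0 : 0 < 1 - β := by linarith
  have hc₁0 : 0 < c₁ := by positivity
  have hmain : ∀ (D : ℕ) [NeZero D], ¬ IsSquare D → ¬ IsSquare (E * D) →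
      c₁ * (D : ℝ) ^ (-ε) ≤ ‖(jacobiChar D).LFunction 1‖ := by
    intro D _ hD hED
    have hD0 : (0 : ℝ) < D := by exact_mod_cast NeZero.pos D
    have hD1 : (1 : ℝ) ≤ D := by exact_mod_cast NeZero.pos D
    have hE1 : (1 : ℝ) ≤ E := by exact_mod_cast NeZero.pos E
    have h1 := hcore (4 * E) (4 * D) (4 * (E * D)) (jacobiChar E) (jacobiChar D)
      (jacobiChar (E * D)) (jacobiChar_isQuadratic E) (jacobiChar_isQuadratic D)
      (jacobiChar_isQuadratic (E * D)) (jacobiChar_ne_one hEsq) (jacobiChar_ne_one hD)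
      (jacobiChar_ne_one hED) (jacobiChar_mul E D) β (by linarith) hβ1 (hprod D hD hED)
    have h2 := hbound (4 * (E * D)) (jacobiChar (E * D)) (jacobiChar_ne_one hED) 1 (by simp)
    rw [iteratedDeriv_zero] at h2
    rw [norm_mul, norm_mul] at h1
    have h3 : ((4 * (E * D) : ℕ) : ℝ) * (|(1 : ℂ).im| + 2) = 8 * E * D := by
      push_cast; simp; ring
    have h4 : ((4 * E : ℕ) : ℝ) * (4 * D : ℕ) * (4 * (E * D) : ℕ) = 64 * E ^ 2 * D ^ 2 := by
      push_cast; ring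
    rw [h3, Real.mul_rpow (by positivity) (by positivity)] at h2
    rw [h4] at h1
    have hbig : (1 : ℝ) ≤ 64 * E ^ 2 * D ^ 2 := by nlinarith [one_le_pow₀ (n := 2) hE1, one_le_pow₀ (n := 2) hD1]
    have h5 : (64 * (E : ℝ) ^ 2) ^ (-(2 * η)) * (D : ℝ) ^ (-(4 * η))
        ≤ (64 * (E : ℝ) ^ 2 * (D : ℝ) ^ 2) ^ (-(2 * (1 - β))) := by
      have : (D : ℝ) ^ (-(4 * η)) = ((D : ℝ) ^ 2) ^ (-(2 * η)) := by
        rw [← Real.rpow_natCast, ← Real.rpow_mul hD0.le]; congr 1; push_cast; ring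
      rw [this, ← Real.mul_rpow (by positivity) (by positivity)]
      exact Real.rpow_le_rpow_of_exponent_le hbig (by linarith)
    set L := ‖(jacobiChar D).LFunction 1‖ with hL
    have h6 : c₀ * (1 - β) * ((64 * (E : ℝ) ^ 2) ^ (-(2 * η)) * (D : ℝ) ^ (-(4 * η)))
        ≤ C₁ * L * (C * ((8 * (E : ℝ)) ^ η * (D : ℝ) ^ η)) :=
      calc _ ≤ c₀ * (1 - β) * (64 * (E : ℝ) ^ 2 * (D : ℝ) ^ 2) ^ (-(2 * (1 - β))) := by gcongr
        _ ≤ _ := h1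
        _ ≤ _ := by gcongr
    calc c₁ * (D : ℝ) ^ (-ε) ≤ c₁ * (D : ℝ) ^ (-(5 * η)) := by
          gcongr ?_ * ?_
          exact Real.rpow_le_rpow_of_exponent_le hD1 (by linarith)
      _ = c₀ * (1 - β) * ((64 * (E : ℝ) ^ 2) ^ (-(2 * η)) * (D : ℝ) ^ (-(4 * η)))
          / (C₁ * (C * ((8 * (E : ℝ)) ^ η * (D : ℝ) ^ η))) := by
          rw [show -(5 * η) = -(4 * η) - η by ring, Real.rpow_sub hD0, hc₁]
          field_simp
      _ ≤ L := by
          rw [div_le_iff₀ (by positivity)]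
          linarith
  by_cases hex : ∃ (D₀ : ℕ) (_ : NeZero D₀), Squarefree D₀ ∧ D₀ ≠ 1 ∧ IsSquare (E * D₀)
  · obtain ⟨D₀, hD₀, hsq, hD₀1, hED₀⟩ := hex
    refine ⟨min c₁ ‖(jacobiChar D₀).LFunction 1‖,
      lt_min hc₁0 (hne D₀ (hsq.not_isSquare hD₀1)), fun D hD hDsq hD1 => ?_⟩
    have hDge : (1 : ℝ) ≤ D := by exact_mod_cast NeZero.pos D
    by_cases hED : IsSquare (E * D)
    · have hDD : D₀ = D := by
        refine eq_of_squarefree_of_isSquare_mul hsq hDsq ?_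
        obtain ⟨a, ha⟩ := hED₀
        obtain ⟨b, hb⟩ := hED
        have hdvd : E * E * (D₀ * D) = (a * b) * (a * b) := by
          calc E * E * (D₀ * D) = (E * D₀) * (E * D) := by ring
            _ = _ := by rw [ha, hb]; ring
        have : E ∣ a * b := by
          rw [← Nat.pow_dvd_pow_iff (two_ne_zero), sq, sq, ← hdvd]
          exact Dvd.intro _ rfl
        obtain ⟨d, hd⟩ := this
        refine ⟨d, ?_⟩
        have hEpos : 0 < E * E := Nat.mul_pos (NeZero.pos E) (NeZero.pos E)
        refine Nat.eq_of_mul_eq_mul_left hEpos ?_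
        rw [hdvd, hd]
        ring
      subst hDD
      calc _ ≤ min c₁ ‖(jacobiChar D₀).LFunction 1‖ * 1 := by
            gcongr
            exact Real.rpow_le_one_of_one_le_of_nonpos hDge (by linarith)
        _ ≤ _ := by rw [mul_one]; exact min_le_right _ _
    · refine le_trans ?_ (hmain D (hDsq.not_isSquare hD1) hED)
      gcongr
      exact min_le_left _ _
  · push Not at hex
    exact ⟨c₁, hc₁0, fun D hD hDsq hD1 => hmain D (hDsq.not_isSquare hD1) (hex D hD hDsq hD1)⟩

lemma DirichletCharacter.exists_norm_LFunction_sub_le {η : ℝ} (hη : 0 < η) :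
    ∃ C : ℝ, 0 < C ∧ ∀ (q : ℕ) [NeZero q] (χ : DirichletCharacter ℂ q), χ ≠ 1 →
      ∀ (s w : ℂ) (T : ℝ), 1 ≤ s.re → 1 ≤ w.re → |s.im| ≤ T → |w.im| ≤ T →
        ‖χ.LFunction s - χ.LFunction w‖ ≤ C * (q * (T + 2)) ^ η * ‖s - w‖ := by
  obtain ⟨C, hC, h⟩ := exists_norm_iteratedDeriv_LFunction_le hη 1
  refine ⟨C, hC, fun q _ χ hχ s w T hs hw hsT hwT => ?_⟩
  have hconv : Convex ℝ ({z : ℂ | 1 ≤ z.re} ∩ ({z : ℂ | z.im ≤ T} ∩ {z : ℂ | -T ≤ z.im})) :=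
    (convex_halfSpace_re_ge 1).inter ((convex_halfSpace_im_le T).inter (convex_halfSpace_im_ge (-T)))
  rw [abs_le] at hsT hwT
  refine hconv.norm_image_sub_le_of_norm_deriv_le (𝕜 := ℂ)
    (fun z _ => differentiable_LFunction hχ z) (fun z hz => ?_) ⟨hw, hwT.2, hwT.1⟩
    ⟨hs, hsT.2, hsT.1⟩
  rw [← iteratedDeriv_one]
  refine (h q χ hχ z hz.1).trans ?_
  have : |z.im| ≤ T := abs_le.2 ⟨hz.2.2, hz.2.1⟩
  gcongr

lemma DirichletCharacter.exists_pow_le_mul_norm_LFunction {η : ℝ} (hη : 0 < η) (hη1 : η ≤ 1 / 2) :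
    ∃ C : ℝ, 0 < C ∧ ∀ (q : ℕ) [NeZero q] (χ : DirichletCharacter ℂ q), χ.IsQuadratic →
      ∀ (σ t r u : ℝ), 0 < r → r ≤ 1 → 1 < σ → σ ≤ 2 → r ≤ ‖(σ + t * Complex.I : ℂ) - 1‖ →
        0 ≤ u → u ^ 4 ≤ σ - 1 →
        r * u ^ 12 ≤ C * ((q * (|t| + 2)) ^ η) ^ 4 * ‖χ.LFunction (σ + t * Complex.I)‖ ^ 4 := by
  set B : ℝ := 5 / η + 32 with hB
  have hB0 : 0 < B := by positivity
  refine ⟨(1 + B * 2) ^ 3 * (1 + B * 2), by positivity, ?_⟩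
  intro q _ χ hχ σ t r u hr hr1 hσ hσ2 hrs hu huσ
  set Y : ℝ := ((q : ℝ) * (|t| + 2)) ^ η with hY
  have hY1 : 1 ≤ Y := Real.one_le_rpow (one_le_conductor_mul q t) hη.le
  have hx : 0 < σ - 1 := by linarith
  have hprod := χ.norm_LFunction_product_ge_one hx t
  have hχ2 : χ ^ 2 = 1 := hχ.sq_eq_one
  have e1 : (1 : ℂ) + ((σ - 1 : ℝ) : ℂ) = σ := by push_cast; ring
  rw [hχ2, e1, LFunctionTrivChar, norm_mul, norm_mul, norm_pow, norm_pow] at hprod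
  rw [show (σ : ℂ) + Complex.I * t = σ + t * Complex.I by ring,
    show (σ : ℂ) + 2 * Complex.I * t = σ + (2 * t : ℝ) * Complex.I by push_cast; ring] at hprod
  have hq0 : (0 : ℝ) < q := by exact_mod_cast NeZero.pos q
  have h2Y : ∀ a : ℝ, 0 ≤ a → a ≤ 2 * |t| → ((q : ℝ) * (a + 2)) ^ η ≤ 2 * Y := by
    intro a ha0 ha
    calc ((q : ℝ) * (a + 2)) ^ η ≤ (2 * ((q : ℝ) * (|t| + 2))) ^ η := by
          refine Real.rpow_le_rpow (by positivity) ?_ hη.le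
          nlinarith [abs_nonneg t]
      _ = 2 ^ η * Y := by rw [Real.mul_rpow (by norm_num) (by positivity)]
      _ ≤ 2 * Y := by
          gcongr
          calc (2 : ℝ) ^ η ≤ 2 ^ (1 : ℝ) :=
                Real.rpow_le_rpow_of_exponent_le (by norm_num) (by linarith)
            _ = 2 := by norm_num
  have hL0 : ‖(1 : DirichletCharacter ℂ q).LFunction σ‖ ≤ (1 + B * 2) * Y / (σ - 1) := by
    refine (norm_LFunction_one_le q hη hη1 (s := σ) (by simpa using hσ) (by simpa using hσ2)).trans ?_
    have h1 : ‖(σ : ℂ) - 1‖ = σ - 1 := by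
      rw [show (σ : ℂ) - 1 = ((σ - 1 : ℝ) : ℂ) by push_cast; rfl, Complex.norm_real,
        Real.norm_of_nonneg hx.le]
    have h2 := h2Y 0 le_rfl (by positivity)
    rw [h1, Complex.ofReal_im, abs_zero, le_div_iff₀ hx, add_mul, one_div_mul_cancel hx.ne', ← hB]
    have h3 : B * ((q : ℝ) * (0 + 2)) ^ η * (σ - 1) ≤ B * (2 * Y) * 1 := by
      gcongr
      linarith
    linarith
  have hL2 : ‖(1 : DirichletCharacter ℂ q).LFunction (σ + (2 * t : ℝ) * Complex.I)‖
      ≤ (1 + B * 2) * Y / r := by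
    refine (norm_LFunction_one_le q hη hη1 (by simpa using hσ) (by simpa using hσ2)).trans ?_
    have h1 : r ≤ ‖(σ + (2 * t : ℝ) * Complex.I : ℂ) - 1‖ := by
      refine hrs.trans ?_
      rw [← abs_of_nonneg (norm_nonneg ((σ + t * Complex.I : ℂ) - 1)),
        ← abs_of_nonneg (norm_nonneg ((σ + (2 * t : ℝ) * Complex.I : ℂ) - 1)), ← sq_le_sq,
        ← Complex.normSq_eq_norm_sq, ← Complex.normSq_eq_norm_sq, Complex.normSq_apply,
        Complex.normSq_apply]
      simp
      nlinarith [sq_nonneg t]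
    have h2 := h2Y |2 * t| (abs_nonneg _) (by rw [abs_mul]; simp)
    have him : (σ + (2 * t : ℝ) * Complex.I : ℂ).im = 2 * t := by simp
    rw [him, ← hB, le_div_iff₀ hr, add_mul]
    have h3 : 1 / ‖(σ + (2 * t : ℝ) * Complex.I : ℂ) - 1‖ * r ≤ 1 := by
      rw [one_div_mul_eq_div, div_le_one (hr.trans_le h1)]
      exact h1
    have h4 : B * ((q : ℝ) * (|2 * t| + 2)) ^ η * r ≤ B * (2 * Y) * 1 := by gcongr
    linarith
  set N := ‖χ.LFunction (σ + t * Complex.I)‖ with hN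
  have hN0 : 0 ≤ N := norm_nonneg _
  have h5 : 1 ≤ ((1 + B * 2) * Y / (σ - 1)) ^ 3 * N ^ 4 * ((1 + B * 2) * Y / r) :=
    le_trans hprod (by gcongr)
  have h6 : r * (σ - 1) ^ 3 ≤ (1 + B * 2) ^ 3 * (1 + B * 2) * Y ^ 4 * N ^ 4 := by
    have e : ((1 + B * 2) * Y / (σ - 1)) ^ 3 * N ^ 4 * ((1 + B * 2) * Y / r)
        = (1 + B * 2) ^ 3 * (1 + B * 2) * Y ^ 4 * N ^ 4 / (r * (σ - 1) ^ 3) := by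
      field_simp
    rw [e, le_div_iff₀ (by positivity), one_mul] at h5
    exact h5
  refine le_trans ?_ h6
  rw [show u ^ 12 = (u ^ 4) ^ 3 by ring]
  gcongr

lemma DirichletCharacter.exists_le_norm_LFunction {η c₀ : ℝ} (hη : 0 < η) (hη1 : η ≤ 1 / 2)
    (hc₀ : 0 < c₀) :
    ∃ c : ℝ, 0 < c ∧ ∀ (q : ℕ) [NeZero q] (χ : DirichletCharacter ℂ q), χ.IsQuadratic → χ ≠ 1 →
      c₀ * (q : ℝ) ^ (-η) ≤ ‖χ.LFunction 1‖ → ∀ s : ℂ, 1 < s.re → s.re ≤ 2 →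
        c * (q * (|s.im| + 2)) ^ (-(11 * η)) ≤ ‖χ.LFunction s‖ := by
  obtain ⟨C, hC, hlip⟩ := exists_norm_LFunction_sub_le hη
  obtain ⟨K, hK, hpow⟩ := exists_pow_le_mul_norm_LFunction hη hη1
  set ρ := min 1 (c₀ / (2 * C)) with hρ
  have hρ0 : 0 < ρ := lt_min one_pos (by positivity)
  set K' := max 1 (K / ρ) with hK'
  have hK'1 : 1 ≤ K' := le_max_left _ _
  set κ := min 1 (1 / (2 * C * K')) with hκ
  have hκ0 : 0 < κ := lt_min one_pos (by positivity)
  refine ⟨min (c₀ / 2) (κ ^ 3 / (2 * K')), lt_min (by positivity) (by positivity), ?_⟩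
  intro q _ χ hχ hχ1 hL1 s hs hs2
  set X : ℝ := (q : ℝ) * (|s.im| + 2) with hX
  have hX1 : 1 ≤ X := one_le_conductor_mul q s.im
  have hX0 : 0 < X := by linarith
  have hq0 : (0 : ℝ) < q := by exact_mod_cast NeZero.pos q
  set Y : ℝ := X ^ η with hY
  have hY1 : 1 ≤ Y := Real.one_le_rpow hX1 hη.le
  have hY0 : 0 < Y := by linarith
  have hYneg : X ^ (-(11 * η)) = (Y ^ 11)⁻¹ := by
    rw [Real.rpow_neg hX0.le, hY, ← Real.rpow_natCast, ← Real.rpow_mul hX0.le]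
    congr 2; push_cast; ring
  have hL1' : c₀ * Y⁻¹ ≤ ‖χ.LFunction 1‖ := by
    refine le_trans ?_ hL1
    rw [← Real.rpow_neg hX0.le] 
    gcongr ?_ * ?_
    refine Real.rpow_le_rpow_of_nonpos hq0 ?_ (by linarith)
    rw [hX]; nlinarith [abs_nonneg s.im]
  rw [hYneg]
  set r := ρ * (Y ^ 2)⁻¹ with hr
  have hr0 : 0 < r := by positivity
  have hr1 : r ≤ 1 := by
    have h1 : (Y ^ 2)⁻¹ ≤ 1 := inv_le_one_of_one_le₀ (one_le_pow₀ hY1)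
    have h2 : ρ ≤ 1 := min_le_left _ _
    calc r ≤ 1 * 1 := by rw [hr]; gcongr
      _ = 1 := one_mul 1
  have hbig : (Y ^ 11)⁻¹ ≤ Y⁻¹ := by
    gcongr
    exact le_self_pow₀ hY1 (by norm_num)
  rcases le_total ‖s - 1‖ r with hnear | hfar
  · have h1 := hlip q χ hχ1 1 s |s.im| (by simp) hs.le (by simp) le_rfl
    rw [← hX, ← hY, norm_sub_rev 1 s] at h1
    have h2 : C * Y * ‖s - 1‖ ≤ c₀ / 2 * Y⁻¹ := by
      calc C * Y * ‖s - 1‖ ≤ C * Y * (c₀ / (2 * C) * (Y ^ 2)⁻¹) := by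
            gcongr
            refine hnear.trans ?_
            rw [hr]
            gcongr
            exact min_le_right _ _
        _ = c₀ / 2 * Y⁻¹ := by field_simp
    have h3 := norm_sub_norm_le (χ.LFunction 1) (χ.LFunction s)
    have h4 : min (c₀ / 2) (κ ^ 3 / (2 * K')) * (Y ^ 11)⁻¹ ≤ c₀ / 2 * Y⁻¹ := by
      gcongr
      exact min_le_left _ _
    have h5 : c₀ * Y⁻¹ = c₀ / 2 * Y⁻¹ + c₀ / 2 * Y⁻¹ := by ring
    linarith
  · set u := κ * (Y ^ 3)⁻¹ with hu
    have hu0 : 0 < u := by positivity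
    have hu1 : u ≤ 1 := by
      have h1 : (Y ^ 3)⁻¹ ≤ 1 := inv_le_one_of_one_le₀ (one_le_pow₀ hY1)
      have h2 : κ ≤ 1 := min_le_left _ _
      calc u ≤ 1 * 1 := by rw [hu]; gcongr
        _ = 1 := one_mul 1
    have hfin : min (c₀ / 2) (κ ^ 3 / (2 * K')) * (Y ^ 11)⁻¹ ≤ u ^ 3 / (2 * K' * Y ^ 2) := by
      calc _ ≤ κ ^ 3 / (2 * K') * (Y ^ 11)⁻¹ := by
            gcongr
            exact min_le_right _ _
        _ = _ := by rw [hu]; field_simp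
    have hlow : ∀ σ : ℝ, s.re ≤ σ → σ ≤ 2 → u ^ 4 ≤ σ - 1 →
        u ^ 3 / (K' * Y ^ 2) ≤ ‖χ.LFunction (σ + s.im * Complex.I)‖ := by
      intro σ hσ hσ2 huσ
      have hrσ : r ≤ ‖(σ + s.im * Complex.I : ℂ) - 1‖ := by
        refine hfar.trans ?_
        rw [← abs_of_nonneg (norm_nonneg (s - 1)),
          ← abs_of_nonneg (norm_nonneg ((σ + s.im * Complex.I : ℂ) - 1)), ← sq_le_sq,
          ← Complex.normSq_eq_norm_sq, ← Complex.normSq_eq_norm_sq, Complex.normSq_apply,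
          Complex.normSq_apply]
        simp
        nlinarith
      have h := hpow q χ hχ σ s.im r u hr0 hr1 (by linarith) hσ2 hrσ hu0.le huσ
      rw [← hX, ← hY] at h
      set N := ‖χ.LFunction (σ + s.im * Complex.I)‖ with hN
      have hN0 : 0 ≤ N := norm_nonneg _
      rw [div_le_iff₀ (by positivity)]
      rw [← pow_le_pow_iff_left₀ (by positivity) (by positivity) (by norm_num : 4 ≠ 0)]
      have h1 : u ^ 12 ≤ K / ρ * Y ^ 6 * N ^ 4 := by
        have : u ^ 12 = r * u ^ 12 * (Y ^ 2 / ρ) := by rw [hr]; field_simp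
        rw [this]
        calc _ ≤ K * Y ^ 4 * N ^ 4 * (Y ^ 2 / ρ) := by gcongr
          _ = _ := by ring
      calc (u ^ 3) ^ 4 = u ^ 12 := by ring
        _ ≤ K / ρ * Y ^ 6 * N ^ 4 := h1
        _ ≤ K' ^ 4 * Y ^ 8 * N ^ 4 := by
            gcongr
            · exact (le_max_right 1 (K / ρ)).trans (le_self_pow₀ hK'1 (by norm_num))
            · norm_num
        _ = _ := by ring
    have es : (s.re + s.im * Complex.I : ℂ) = s := Complex.re_add_im s
    rcases le_total (u ^ 4) (s.re - 1) with hcase | hcase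
    · have h := hlow s.re le_rfl hs2 hcase
      rw [es] at h
      refine hfin.trans (le_trans ?_ h)
      gcongr
      linarith
    · have hu4 : u ^ 4 ≤ 1 := pow_le_one₀ hu0.le hu1
      have h := hlow (1 + u ^ 4) (by linarith) (by linarith) (by linarith)
      set w : ℂ := ((1 + u ^ 4 : ℝ) : ℂ) + s.im * Complex.I with hw
      have hwim : w.im = s.im := by simp [hw, -Complex.ofReal_add]
      have hwre : w.re = 1 + u ^ 4 := by simp [hw, -Complex.ofReal_add]
      have h1 := hlip q χ hχ1 w s |s.im| (by rw [hwre]; nlinarith [pow_pos hu0 4]) hs.le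
        (by rw [hwim]) le_rfl
      rw [← hX, ← hY] at h1
      have h2 : ‖w - s‖ ≤ u ^ 4 := by
        have e : w - s = ((1 + u ^ 4 - s.re : ℝ) : ℂ) :=
          Complex.ext (by rw [Complex.sub_re, hwre, Complex.ofReal_re])
            (by rw [Complex.sub_im, hwim, Complex.ofReal_im, sub_self])
        rw [e, Complex.norm_real, Real.norm_of_nonneg (by linarith)]
        linarith
      have h3 := norm_sub_norm_le (χ.LFunction w) (χ.LFunction s)
      have h4 : C * Y * ‖w - s‖ ≤ u ^ 3 / (2 * K' * Y ^ 2) := by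
        calc C * Y * ‖w - s‖ ≤ C * Y * (u ^ 3 * (1 / (2 * C * K') * (Y ^ 3)⁻¹)) := by
              gcongr
              refine h2.trans ?_
              rw [pow_succ]
              gcongr
              rw [hu]
              gcongr
              exact min_le_right _ _
          _ = _ := by field_simp
      have h5 : u ^ 3 / (K' * Y ^ 2) = u ^ 3 / (2 * K' * Y ^ 2) + u ^ 3 / (2 * K' * Y ^ 2) := by
        field_simp; norm_num
      linarith

lemma exists_le_norm_jacobiChar_LFunction {δ : ℝ} (hδ : 0 < δ) :
    ∃ c : ℝ, 0 < c ∧ ∀ (D : ℕ) [NeZero D], Squarefree D → D ≠ 1 → ∀ s : ℂ, 1 < s.re → s.re ≤ 2 →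
      c * (((4 * D : ℕ) : ℝ) * (|s.im| + 2)) ^ (-δ) ≤ ‖(jacobiChar D).LFunction s‖ := by
  set η : ℝ := min (δ / 11) (1 / 2) with hη
  have hη0 : 0 < η := by positivity
  have hη1 : η ≤ 1 / 2 := min_le_right _ _
  have hη2 : 11 * η ≤ δ := by
    have := min_le_left (δ / 11) (1 / 2)
    rw [← hη] at this
    linarith
  obtain ⟨c₀, hc₀, h0⟩ := exists_le_norm_jacobiChar_LFunction_one hη0
  obtain ⟨c, hc, h⟩ := DirichletCharacter.exists_le_norm_LFunction hη0 hη1 hc₀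
  refine ⟨c, hc, fun D _ hD hD1 s hs hs2 => ?_⟩
  have hnsq : ¬ IsSquare D := hD.not_isSquare hD1
  have hD0 : (0 : ℝ) < D := by exact_mod_cast NeZero.pos D
  have hD4 : (D : ℝ) ≤ ((4 * D : ℕ) : ℝ) := by push_cast; linarith
  refine le_trans ?_ (h (4 * D) (jacobiChar D) (jacobiChar_isQuadratic D)
    (jacobiChar_ne_one hnsq) (le_trans ?_ (h0 D hD hD1)) s hs hs2)
  · gcongr
    exact one_le_conductor_mul (4 * D) s.im
  · gcongr ?_ * ?_
    exact Real.rpow_le_rpow_of_nonpos hD0 hD4 (by linarith)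

lemma DirichletCharacter.abscissaOfAbsConv_twist_vonMangoldt_lt {q : ℕ} (χ : DirichletCharacter ℂ q)
    {s : ℂ} (hs : 1 < s.re) :
    LSeries.abscissaOfAbsConv ((fun n : ℕ => χ n) * fun n => (ArithmeticFunction.vonMangoldt n : ℂ)) < s.re := by
  refine lt_of_le_of_lt ?_ (EReal.coe_lt_coe_iff.2 hs)
  refine LSeries.abscissaOfAbsConv_le_of_forall_lt_LSeriesSummable fun y hy => ?_
  exact LSeriesSummable_twist_vonMangoldt χ (by simpa using hy)

lemma DirichletCharacter.sum_choose_iteratedDeriv_mul_eq {q : ℕ} [NeZero q]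
    {χ : DirichletCharacter ℂ q} (hχ : χ ≠ 1) (k : ℕ) {s : ℂ} (hs : 1 < s.re) :
    ∑ i ∈ Finset.range (k + 1), (k.choose i : ℂ) *
      iteratedDeriv i (LSeries ((fun n : ℕ => χ n) * fun n => (ArithmeticFunction.vonMangoldt n : ℂ))) s *
        iteratedDeriv (k - i) χ.LFunction s = -iteratedDeriv (k + 1) χ.LFunction s := by
  set F := LSeries ((fun n : ℕ => χ n) * fun n => (ArithmeticFunction.vonMangoldt n : ℂ)) with hF
  have hFa : AnalyticAt ℂ F s :=
    LSeries_analyticOnNhd _ s (abscissaOfAbsConv_twist_vonMangoldt_lt χ hs)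
  have hLa : AnalyticAt ℂ χ.LFunction s := (differentiable_LFunction hχ).analyticAt s
  rw [← iteratedDeriv_fun_mul hFa.contDiffAt hLa.contDiffAt, iteratedDeriv_succ',
    ← iteratedDeriv_fun_neg]
  refine Filter.EventuallyEq.iteratedDeriv_eq k ?_
  filter_upwards [(isOpen_lt continuous_const Complex.continuous_re).mem_nhds hs] with z hz
  rw [(hasDerivAt_LFunction χ hz).deriv, neg_neg]

lemma exists_norm_iteratedDeriv_LSeries_jacobiChar_le (k : ℕ) : ∀ {δ : ℝ}, 0 < δ →
    ∃ C : ℝ, 0 < C ∧ ∀ (D : ℕ) [NeZero D], Squarefree D → D ≠ 1 → ∀ s : ℂ, 1 < s.re → s.re ≤ 2 →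
      ‖iteratedDeriv k (LSeries ((fun n : ℕ => jacobiChar D n) *
        fun n => (ArithmeticFunction.vonMangoldt n : ℂ))) s‖ ≤
        C * (((4 * D : ℕ) : ℝ) * (|s.im| + 2)) ^ δ := by
  induction k using Nat.strong_induction_on with
  | _ k ih =>
  intro δ hδ
  have hδ3 : 0 < δ / 3 := by positivity
  have ih' : ∀ i : ℕ, ∃ C : ℝ, 0 < C ∧ (i < k → ∀ (D : ℕ) [NeZero D], Squarefree D → D ≠ 1 →
      ∀ s : ℂ, 1 < s.re → s.re ≤ 2 →
      ‖iteratedDeriv i (LSeries ((fun n : ℕ => jacobiChar D n) *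
        fun n => (ArithmeticFunction.vonMangoldt n : ℂ))) s‖ ≤
        C * (((4 * D : ℕ) : ℝ) * (|s.im| + 2)) ^ (δ / 3)) := fun i => by
    by_cases hi : i < k
    · obtain ⟨C, hC, h⟩ := ih i hi hδ3
      exact ⟨C, hC, fun _ => h⟩
    · exact ⟨1, one_pos, fun h => absurd h hi⟩
  choose K hK hKb using ih'
  choose M hM hMb using fun j => DirichletCharacter.exists_norm_iteratedDeriv_LFunction_le hδ3 j
  obtain ⟨c, hc, hlow⟩ := exists_le_norm_jacobiChar_LFunction hδ3
  set E : ℝ := M (k + 1) + ∑ i ∈ Finset.range k, (k.choose i : ℝ) * K i * M (k - i) with hE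
  have hE0 : 0 < E := by
    have : 0 ≤ ∑ i ∈ Finset.range k, (k.choose i : ℝ) * K i * M (k - i) :=
      Finset.sum_nonneg fun i _ => by have := hK i; have := hM (k - i); positivity
    have := hM (k + 1)
    linarith
  refine ⟨E / c, by positivity, fun D _ hD hD1 s hs hs2 => ?_⟩
  have hnsq : ¬ IsSquare D := hD.not_isSquare hD1
  have hχ := jacobiChar_ne_one hnsq
  have hX1 : (1 : ℝ) ≤ ((4 * D : ℕ) : ℝ) * (|s.im| + 2) := one_le_conductor_mul (4 * D) s.im
  set X : ℝ := ((4 * D : ℕ) : ℝ) * (|s.im| + 2) with hX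
  set Y : ℝ := X ^ (δ / 3) with hY
  have hY1 : 1 ≤ Y := Real.one_le_rpow hX1 hδ3.le
  have hid := DirichletCharacter.sum_choose_iteratedDeriv_mul_eq hχ k hs
  rw [Finset.sum_range_succ, Nat.choose_self, Nat.cast_one, one_mul, Nat.sub_self,
    iteratedDeriv_zero] at hid
  set F := LSeries ((fun n : ℕ => jacobiChar D n) * fun n => (ArithmeticFunction.vonMangoldt n : ℂ))
    with hF
  have hL := hlow D hD hD1 s hs hs2
  rw [← hX, Real.rpow_neg (by positivity), ← hY] at hL
  have hub : ‖iteratedDeriv k F s‖ * ‖(jacobiChar D).LFunction s‖ ≤ E * Y ^ 2 := by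
    rw [← norm_mul, eq_sub_of_add_eq' hid, hE, add_mul, Finset.sum_mul]
    refine (norm_sub_le _ _).trans (add_le_add ?_ ((norm_sum_le _ _).trans
      (Finset.sum_le_sum fun i hi => ?_)))
    · rw [norm_neg]
      refine (hMb (k + 1) (4 * D) _ hχ s hs.le).trans ?_
      have := hM (k + 1)
      gcongr
      exact le_self_pow₀ hY1 two_ne_zero
    · rw [norm_mul, norm_mul, Complex.norm_natCast]
      have h1 := hKb i (Finset.mem_range.1 hi) D hD hD1 s hs hs2
      have h2 := hMb (k - i) (4 * D) _ hχ s hs.le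
      have := hK i
      calc _ ≤ (k.choose i : ℝ) * (K i * Y) * (M (k - i) * Y) := by gcongr
        _ = _ := by ring
  have hYX : X ^ δ = Y ^ 3 := by
    rw [hY, ← Real.rpow_natCast, ← Real.rpow_mul (by positivity)]
    congr 1; push_cast; ring
  rw [hYX]
  have h3 : ‖iteratedDeriv k F s‖ * (c * Y⁻¹) ≤ E * Y ^ 2 :=
    (mul_le_mul_of_nonneg_left hL (norm_nonneg _)).trans hub
  have hY0 : 0 < Y := by positivity
  calc ‖iteratedDeriv k F s‖ = ‖iteratedDeriv k F s‖ * (c * Y⁻¹) * (Y / c) := by field_simp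
    _ ≤ E * Y ^ 2 * (Y / c) := by gcongr
    _ = _ := by ring

lemma exists_norm_LSeries_logMul_jacobiChar_le (k : ℕ) {δ : ℝ} (hδ : 0 < δ) :
    ∃ C : ℝ, 0 < C ∧ ∀ (D : ℕ) [NeZero D], Squarefree D → D ≠ 1 → ∀ s : ℂ, 1 < s.re → s.re ≤ 2 →
      ‖LSeries (fun n : ℕ => (Real.log n : ℂ) ^ k * (jacobiChar D n *
        (ArithmeticFunction.vonMangoldt n : ℂ))) s‖ ≤
        C * (((4 * D : ℕ) : ℝ) * (|s.im| + 2)) ^ δ := by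
  obtain ⟨C, hC, h⟩ := exists_norm_iteratedDeriv_LSeries_jacobiChar_le k hδ
  refine ⟨C, hC, fun D _ hD hD1 s hs hs2 => ?_⟩
  refine le_of_eq_of_le ?_ (h D hD hD1 s hs hs2)
  rw [LSeries_iteratedDeriv k (DirichletCharacter.abscissaOfAbsConv_twist_vonMangoldt_lt _ hs),
    norm_mul, norm_pow, norm_neg, norm_one, one_pow, one_mul]
  congr 2
  have hk : ∀ (g : ℕ → ℂ) (j n : ℕ),
      LSeries.logMul^[j] g n = (Real.log n : ℂ) ^ j * g n := by
    intro g j n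
    induction j with
    | zero => simp
    | succ j ihj =>
      rw [Function.iterate_succ_apply', LSeries.logMul, ihj, pow_succ', mul_assoc]
      rw [← Complex.natCast_log]
  ext n
  rw [hk]
  rfl

lemma integrable_one_add_norm_rpow_neg_three_halves :
    MeasureTheory.Integrable fun t : ℝ => (1 + ‖t‖) ^ (-(3 / 2 : ℝ)) :=
  integrable_one_add_norm (by norm_num)

lemma norm_one_div_add_mul_I_sq_le {σ : ℝ} (hσ : 1 ≤ σ) (t : ℝ) :
    ‖1 / ((σ : ℂ) + t * Complex.I) ^ 2‖ ≤ 2 * (1 + ‖t‖) ^ (-2 : ℝ) := by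
  have h1 : ‖((σ : ℂ) + t * Complex.I)‖ ^ 2 = σ ^ 2 + t ^ 2 := by
    rw [← Complex.normSq_eq_norm_sq, Complex.normSq_add_mul_I]
  rw [norm_div, norm_one, norm_pow, h1, Real.rpow_neg (by positivity), Real.rpow_ofNat,
    ← div_eq_mul_inv, div_le_div_iff₀ (by positivity) (by positivity)]
  have h2 : ‖t‖ ^ 2 = t ^ 2 := sq_abs t
  nlinarith [sq_nonneg (1 - ‖t‖), norm_nonneg t]

lemma integrable_one_div_add_mul_I_sq {σ : ℝ} (hσ : 1 ≤ σ) :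
    MeasureTheory.Integrable fun t : ℝ => 1 / ((σ : ℂ) + t * Complex.I) ^ 2 := by
  have h : MeasureTheory.Integrable fun t : ℝ => 2 * (1 + ‖t‖) ^ (-2 : ℝ) :=
    (integrable_one_add_norm (by norm_num)).const_mul 2
  refine h.mono' ?_ (Filter.Eventually.of_forall fun t => norm_one_div_add_mul_I_sq_le hσ t)
  have : Continuous fun t : ℝ => 1 / ((σ : ℂ) + t * Complex.I) ^ 2 := by
    refine continuous_const.div (by fun_prop) fun t ht => ?_
    have := congrArg Complex.re (pow_eq_zero_iff two_ne_zero |>.1 ht)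
    simp at this
    linarith
  exact this.aestronglyMeasurable

lemma hasMellin_log_indicator_Ioc {s : ℂ} (hs : 0 < s.re) :
    HasMellin (fun t => Real.log t • Set.indicator (Set.Ioc 0 1) (fun _ => 1 : ℝ → ℂ) t) s
      (-(1 / s ^ 2)) := by
  have hfc : MeasureTheory.LocallyIntegrableOn (Set.indicator (Set.Ioc 0 1) (fun _ => 1 : ℝ → ℂ))
      (Set.Ioi 0) := by
    refine MeasureTheory.LocallyIntegrable.locallyIntegrableOn ?_ _
    exact (MeasureTheory.locallyIntegrable_const (1 : ℂ)).indicator measurableSet_Ioc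
  have htop : (Set.indicator (Set.Ioc 0 1) (fun _ => 1 : ℝ → ℂ)) =O[Filter.atTop]
      (· ^ (-(s.re + 1))) := by
    refine Filter.EventuallyEq.trans_isBigO ?_ (Asymptotics.isBigO_zero _ _)
    filter_upwards [Filter.eventually_gt_atTop 1] with t ht
    exact Set.indicator_of_notMem (fun h => absurd h.2 (not_le.2 ht)) _
  have hbot : (Set.indicator (Set.Ioc 0 1) (fun _ => 1 : ℝ → ℂ)) =O[nhdsWithin 0 (Set.Ioi 0)]
      (· ^ (-(0 : ℝ))) := by
    refine Asymptotics.IsBigO.of_bound 1 (Filter.Eventually.of_forall fun t => ?_)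
    rw [neg_zero, Real.rpow_zero, norm_one, mul_one]
    refine (norm_indicator_le_norm_self _ _).trans (by simp)
  obtain ⟨h1, h2⟩ := mellin_hasDerivAt_of_isBigO_rpow hfc htop (by linarith) hbot hs
  refine ⟨h1, h2.unique ?_⟩
  have h3 : HasDerivAt (fun z : ℂ => 1 / z) (-(1 / s ^ 2)) s := by
    have := hasDerivAt_inv (x := s) (by rintro rfl; simp at hs)
    simpa [one_div] using this
  refine h3.congr_of_eventuallyEq ?_
  filter_upwards [(isOpen_lt continuous_const Complex.continuous_re).mem_nhds hs] with z hz
  exact (hasMellin_one_Ioc hz).2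

lemma integral_cpow_mul_one_div_sq {σ x : ℝ} (hσ : 1 ≤ σ) (hx : 0 < x) :
    ∫ t : ℝ, (x : ℂ) ^ (-((σ : ℂ) + t * Complex.I)) * (1 / ((σ : ℂ) + t * Complex.I) ^ 2) =
      2 * Real.pi * ((max (-Real.log x) 0 : ℝ) : ℂ) := by
  set f : ℝ → ℂ := fun t => Real.log t • Set.indicator (Set.Ioc 0 1) (fun _ => 1 : ℝ → ℂ) t with hf
  have hfe : ∀ t : ℝ, 0 < t → f t = -((max (-Real.log t) 0 : ℝ) : ℂ) := by
    intro t ht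
    rw [hf]
    rcases le_or_gt t 1 with h | h
    · simp only
      rw [Set.indicator_of_mem (show t ∈ Set.Ioc (0 : ℝ) 1 from ⟨ht, h⟩),
        max_eq_left (by linarith [Real.log_nonpos ht.le h])]
      simp
    · simp only
      rw [Set.indicator_of_notMem (fun h' => absurd h'.2 (not_le.2 h)),
        max_eq_right (by linarith [Real.log_pos h])]
      simp
  have hm : ∀ t : ℝ, mellin f ((σ : ℂ) + t * Complex.I) = -(1 / ((σ : ℂ) + t * Complex.I) ^ 2) :=
    fun t => (hasMellin_log_indicator_Ioc (by simp; linarith)).2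
  have hcont : ContinuousAt f x := by
    have : ContinuousAt (fun t : ℝ => -((max (-Real.log t) 0 : ℝ) : ℂ)) x := by
      have := Real.continuousAt_log hx.ne'
      fun_prop
    refine this.congr ?_
    filter_upwards [lt_mem_nhds hx] with t ht
    exact (hfe t ht).symm
  have hinv := mellinInv_mellin_eq σ f hx (hasMellin_log_indicator_Ioc (by simp; linarith)).1
    (by
      refine (integrable_one_div_add_mul_I_sq hσ).neg.congr (Filter.Eventually.of_forall fun t => ?_)
      exact (hm t).symm) hcont
  rw [mellinInv, hfe x hx] at hinv
  simp_rw [hm, smul_eq_mul, mul_neg] at hinv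
  rw [MeasureTheory.integral_neg, smul_neg, neg_inj, Complex.real_smul] at hinv
  rw [← hinv, ← mul_assoc]
  have : (Real.pi : ℂ) ≠ 0 := by exact_mod_cast Real.pi_ne_zero
  have h2 : (2 : ℂ) * Real.pi * ((1 / (2 * Real.pi) : ℝ) : ℂ) = 1 := by
    push_cast
    field_simp
  rw [h2, one_mul]

lemma LSeriesSummable.integral_eq_sum {f : ℕ → ℂ} {σ y : ℝ} (hσ : 1 ≤ σ)
    (hf : LSeriesSummable f σ) (hy : 0 < y) :
    ∫ t : ℝ, LSeries f (σ + t * Complex.I) * (y : ℂ) ^ ((σ : ℂ) + t * Complex.I) *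
      (1 / ((σ : ℂ) + t * Complex.I) ^ 2) =
      2 * Real.pi * ∑ n ∈ Finset.Icc 1 ⌊y⌋₊, f n * (Real.log (y / n) : ℂ) := by
  set F : ℕ → ℝ → ℂ := fun n t => LSeries.term f (σ + t * Complex.I) n *
    (y : ℂ) ^ ((σ : ℂ) + t * Complex.I) * (1 / ((σ : ℂ) + t * Complex.I) ^ 2) with hF
  have hFn : ∀ n t, ‖F n t‖ = ‖LSeries.term f σ n‖ * y ^ σ * ‖1 / ((σ : ℂ) + t * Complex.I) ^ 2‖ := by
    intro n t
    rw [hF]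
    simp only
    rw [norm_mul, norm_mul, Complex.norm_cpow_eq_rpow_re_of_pos hy,
      LSeries.norm_term_eq, LSeries.norm_term_eq]
    simp
  have hFe : ∀ n : ℕ, n ≠ 0 → ∀ t, F n t = f n * ((((n : ℝ) / y : ℝ) : ℂ) ^
      (-((σ : ℂ) + t * Complex.I)) * (1 / ((σ : ℂ) + t * Complex.I) ^ 2)) := by
    intro n hn t
    rw [hF]
    simp only
    have hn0 : (0 : ℝ) < n := by exact_mod_cast Nat.pos_of_ne_zero hn
    rw [LSeries.term_of_ne_zero hn, Complex.ofReal_div, Complex.div_cpow_ofReal_nonneg hn0.le hy.le,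
      Complex.cpow_neg, Complex.cpow_neg, Complex.ofReal_natCast]
    field_simp
  have hFint : ∀ n, MeasureTheory.Integrable (F n) := by
    intro n
    refine ((integrable_one_div_add_mul_I_sq hσ).norm.const_mul
      (‖LSeries.term f σ n‖ * y ^ σ)).mono' ?_ (Filter.Eventually.of_forall fun t => (hFn n t).le)
    refine MeasureTheory.AEStronglyMeasurable.mul (Continuous.aestronglyMeasurable ?_)
      (integrable_one_div_add_mul_I_sq hσ).aestronglyMeasurable
    have hy' : (y : ℂ) ≠ 0 := by exact_mod_cast hy.ne'
    by_cases hn : n = 0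
    · subst hn; simp only [LSeries.term_zero, zero_mul]; exact continuous_const
    · simp_rw [LSeries.term_of_ne_zero hn]
      have hn' : (n : ℂ) ≠ 0 := by exact_mod_cast hn
      refine Continuous.mul (continuous_const.div ?_ fun t => ?_) ?_
      · exact Continuous.const_cpow (by fun_prop) (Or.inl hn')
      · simp [Complex.cpow_eq_zero_iff, hn]
      · exact Continuous.const_cpow (by fun_prop) (Or.inl hy')
  have hFint' : ∀ n : ℕ, ∫ t, F n t = if n ∈ Finset.Icc 1 ⌊y⌋₊ then
      2 * Real.pi * (f n * (Real.log (y / n) : ℂ)) else 0 := by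
    intro n
    by_cases hn : n = 0
    · subst hn; simp [hF]
    have hn0 : (0 : ℝ) < n := by exact_mod_cast Nat.pos_of_ne_zero hn
    simp_rw [hFe n hn]
    rw [MeasureTheory.integral_const_mul, integral_cpow_mul_one_div_sq hσ (div_pos hn0 hy),
      ← Real.log_inv, inv_div]
    split_ifs with h
    · rw [Finset.mem_Icc] at h
      have : (n : ℝ) ≤ y := (Nat.le_floor_iff hy.le).1 h.2
      rw [max_eq_left (Real.log_nonneg ((one_le_div hn0).2 this))]
      ring
    · rw [Finset.mem_Icc, not_and, not_le] at h
      have : y < n := (Nat.floor_lt hy.le).1 (h (Nat.one_le_iff_ne_zero.2 hn))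
      rw [max_eq_right (Real.log_nonpos (by positivity) ((div_le_one hn0).2 this.le))]
      simp
  have hsum : Summable fun n => ∫ t, ‖F n t‖ := by
    simp_rw [hFn, MeasureTheory.integral_const_mul]
    exact (hf.norm.mul_right _).mul_right _
  have h := (MeasureTheory.hasSum_integral_of_summable_integral_norm hFint hsum).tsum_eq
  have h2 : ∀ t, ∑' n, F n t = LSeries f (σ + t * Complex.I) *
      (y : ℂ) ^ ((σ : ℂ) + t * Complex.I) * (1 / ((σ : ℂ) + t * Complex.I) ^ 2) := by
    intro t
    rw [hF]
    simp only
    rw [tsum_mul_right, tsum_mul_right]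
    rfl
  simp_rw [h2] at h
  rw [← h, Finset.mul_sum]
  simp_rw [hFint']
  rw [tsum_eq_sum (s := Finset.Icc 1 ⌊y⌋₊) fun n hn => if_neg hn]
  exact Finset.sum_congr rfl fun n hn => if_pos hn

lemma LSeriesSummable.norm_sum_mul_log_le {f : ℕ → ℂ} {σ y K : ℝ} (hσ : 1 ≤ σ)
    (hf : LSeriesSummable f σ) (hy : 0 < y)
    (hK : ∀ t : ℝ, ‖LSeries f (σ + t * Complex.I)‖ ≤ K * (|t| + 2) ^ (1 / 2 : ℝ)) :
    ‖∑ n ∈ Finset.Icc 1 ⌊y⌋₊, f n * (Real.log (y / n) : ℂ)‖ ≤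
      (∫ t : ℝ, 4 * (1 + ‖t‖) ^ (-(3 / 2 : ℝ))) * (K * y ^ σ) := by
  have hK0 : 0 ≤ K := by
    have := (norm_nonneg _).trans (hK 0)
    exact nonneg_of_mul_nonneg_left this (by positivity)
  have h1 : ‖∫ t : ℝ, LSeries f (σ + t * Complex.I) * (y : ℂ) ^ ((σ : ℂ) + t * Complex.I) *
      (1 / ((σ : ℂ) + t * Complex.I) ^ 2)‖ ≤
      ∫ t : ℝ, 4 * (1 + ‖t‖) ^ (-(3 / 2 : ℝ)) * (K * y ^ σ) := by
    refine MeasureTheory.norm_integral_le_of_norm_le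
      ((integrable_one_add_norm_rpow_neg_three_halves.const_mul 4).mul_const _)
      (Filter.Eventually.of_forall fun t => ?_)
    rw [norm_mul, norm_mul, Complex.norm_cpow_eq_rpow_re_of_pos hy]
    have e1 : ((σ : ℂ) + t * Complex.I).re = σ := by simp
    have h2 : (|t| + 2) ^ (1 / 2 : ℝ) ≤ 2 * (1 + ‖t‖) ^ (1 / 2 : ℝ) := by
      calc (|t| + 2) ^ (1 / 2 : ℝ) ≤ (4 * (1 + ‖t‖)) ^ (1 / 2 : ℝ) := by
            gcongr
            rw [Real.norm_eq_abs]
            linarith [abs_nonneg t]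
        _ = _ := by
            rw [Real.mul_rpow (by norm_num) (by positivity)]
            congr 1
            rw [show (4 : ℝ) = 2 ^ (2 : ℝ) by norm_num, ← Real.rpow_mul (by norm_num)]
            norm_num
    have h3 : (1 + ‖t‖) ^ (-(3 / 2 : ℝ)) = (1 + ‖t‖) ^ (1 / 2 : ℝ) * (1 + ‖t‖) ^ (-2 : ℝ) := by
      rw [← Real.rpow_add (by positivity)]; norm_num
    rw [e1, h3]
    calc _ ≤ K * (2 * (1 + ‖t‖) ^ (1 / 2 : ℝ)) * y ^ σ * (2 * (1 + ‖t‖) ^ (-2 : ℝ)) := by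
          gcongr
          · exact (hK t).trans (by gcongr)
          · exact norm_one_div_add_mul_I_sq_le hσ t
      _ = _ := by ring
  rw [hf.integral_eq_sum hσ hy, MeasureTheory.integral_mul_const, norm_mul] at h1
  refine le_trans (le_mul_of_one_le_left (norm_nonneg _) ?_) h1
  rw [norm_mul, Complex.norm_real, Real.norm_of_nonneg Real.pi_pos.le]
  simp only [Complex.norm_ofNat]
  linarith [Real.pi_gt_three]

lemma norm_sum_Icc_le_of_sum_mul_log (f : ℕ → ℂ) (y : ℕ) (hy : 1 ≤ y) {h : ℝ} (hh : 0 < h) :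
    ‖∑ n ∈ Finset.Icc 1 y, f n‖ ≤
      (‖∑ n ∈ Finset.Icc 1 ⌊y * Real.exp h⌋₊, f n * (Real.log (y * Real.exp h / n) : ℂ)‖ +
        ‖∑ n ∈ Finset.Icc 1 y, f n * (Real.log (y / n) : ℂ)‖) / h +
        ∑ n ∈ Finset.Ioc y ⌊y * Real.exp h⌋₊, ‖f n‖ := by
  have hy0 : (0 : ℝ) < y := by exact_mod_cast hy
  have hle : y ≤ ⌊y * Real.exp h⌋₊ :=
    Nat.le_floor (le_mul_of_one_le_right hy0.le (Real.one_le_exp hh.le))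
  have hsplit : ∑ n ∈ Finset.Icc 1 ⌊y * Real.exp h⌋₊, f n * (Real.log (y * Real.exp h / n) : ℂ) =
      ∑ n ∈ Finset.Icc 1 y, f n * (Real.log (y / n) : ℂ) + h * ∑ n ∈ Finset.Icc 1 y, f n +
      ∑ n ∈ Finset.Ioc y ⌊y * Real.exp h⌋₊, f n * (Real.log (y * Real.exp h / n) : ℂ) := by
    have hu : Finset.Icc 1 ⌊y * Real.exp h⌋₊ =
        Finset.Icc 1 y ∪ Finset.Ioc y ⌊y * Real.exp h⌋₊ := by
      ext n; simp only [Finset.mem_union, Finset.mem_Icc, Finset.mem_Ioc]; omega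
    rw [hu, Finset.sum_union (Finset.disjoint_left.2 fun n hn hn' => by
      simp only [Finset.mem_Icc, Finset.mem_Ioc] at hn hn'; omega), Finset.mul_sum,
      ← Finset.sum_add_distrib]
    congr 1
    refine Finset.sum_congr rfl fun n hn => ?_
    have hn0 : (0 : ℝ) < n := by exact_mod_cast (Finset.mem_Icc.1 hn).1
    rw [mul_div_right_comm, Real.log_mul (by positivity) (Real.exp_pos h).ne', Real.log_exp]
    push_cast
    ring
  set G1 := ∑ n ∈ Finset.Icc 1 ⌊y * Real.exp h⌋₊, f n * (Real.log (y * Real.exp h / n) : ℂ)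
  set G0 := ∑ n ∈ Finset.Icc 1 y, f n * (Real.log (y / n) : ℂ)
  set A := ∑ n ∈ Finset.Icc 1 y, f n
  set R := ∑ n ∈ Finset.Ioc y ⌊y * Real.exp h⌋₊, f n * (Real.log (y * Real.exp h / n) : ℂ) with hR
  have hRb : ‖R‖ ≤ h * ∑ n ∈ Finset.Ioc y ⌊y * Real.exp h⌋₊, ‖f n‖ := by
    rw [hR, Finset.mul_sum]
    refine (norm_sum_le _ _).trans (Finset.sum_le_sum fun n hn => ?_)
    rw [Finset.mem_Ioc] at hn
    have hyn : (y : ℝ) < n := by exact_mod_cast hn.1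
    have hn0 : (0 : ℝ) < n := hy0.trans hyn
    have hnu : (n : ℝ) ≤ y * Real.exp h := (Nat.le_floor_iff (by positivity)).1 hn.2
    rw [norm_mul, mul_comm, Complex.norm_real,
      Real.norm_of_nonneg (Real.log_nonneg ((one_le_div hn0).2 hnu))]
    gcongr
    rw [Real.log_le_iff_le_exp (by positivity), div_le_iff₀ hn0, mul_comm]
    gcongr
  have hA : (h : ℂ) * A = G1 - G0 - R := by rw [hsplit]; ring
  have hA' : h * ‖A‖ ≤ ‖G1‖ + ‖G0‖ + ‖R‖ := by
    calc h * ‖A‖ = ‖(h : ℂ) * A‖ := by rw [norm_mul, Complex.norm_real, Real.norm_of_nonneg hh.le]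
      _ = ‖G1 - G0 - R‖ := by rw [hA]
      _ ≤ ‖G1 - G0‖ + ‖R‖ := norm_sub_le _ _
      _ ≤ _ := by gcongr; exact norm_sub_le _ _
  rw [← sub_le_iff_le_add, le_div_iff₀ hh]
  linarith

lemma LSeriesSummable_log_pow_mul_twist_vonMangoldt {q : ℕ} (χ : DirichletCharacter ℂ q) (k : ℕ)
    {s : ℂ} (hs : 1 < s.re) :
    LSeriesSummable (fun n : ℕ => (Real.log n : ℂ) ^ k *
      (χ n * (ArithmeticFunction.vonMangoldt n : ℂ))) s := by
  have h := DirichletCharacter.abscissaOfAbsConv_twist_vonMangoldt_lt χ hs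
  have key : ∀ k : ℕ, LSeries.abscissaOfAbsConv (fun n : ℕ => (Real.log n : ℂ) ^ k *
      (χ n * (ArithmeticFunction.vonMangoldt n : ℂ))) < s.re := by
    intro k
    induction k with
    | zero => simp only [pow_zero, one_mul]; exact h
    | succ k ih =>
      rw [← LSeries.abscissaOfAbsConv_logMul] at ih
      convert ih using 2
      ext n
      rw [LSeries.logMul, ← Complex.natCast_log, pow_succ']
      ring
  exact LSeriesSummable_of_abscissaOfAbsConv_lt_re (key k)

lemma exists_norm_sum_log_pow_jacobiChar_le (k : ℕ) {δ : ℝ} (hδ : 0 < δ) (hδ1 : δ ≤ 1 / 2) :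
    ∃ C : ℝ, 0 < C ∧ ∀ (D : ℕ) [NeZero D], Squarefree D → D ≠ 1 → ∀ N : ℕ, 3 ≤ N → ∀ h : ℝ,
      0 < h → h ≤ 1 → ∀ y : ℕ, y ≤ N →
      ‖∑ n ∈ Finset.Icc 1 y, (Real.log n : ℂ) ^ k * (jacobiChar D n *
        (ArithmeticFunction.vonMangoldt n : ℂ))‖ ≤
        C * (((4 * D : ℕ) : ℝ) ^ δ * N / h + Real.log N ^ (k + 1) * (h * N + 1)) := by
  obtain ⟨K, hK, hKb⟩ := exists_norm_LSeries_logMul_jacobiChar_le k hδ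
  set I : ℝ := ∫ t : ℝ, 4 * (1 + ‖t‖) ^ (-(3 / 2 : ℝ)) with hI
  have hI0 : 0 ≤ I := MeasureTheory.integral_nonneg fun t => by positivity
  set C : ℝ := 2 * I * K * Real.exp 3 + 2 ^ (k + 1) * 2 with hC
  refine ⟨C, by positivity, fun D _ hD hD1 N hN h hh hh1 y hyN => ?_⟩
  have hN3 : (3 : ℝ) ≤ N := by exact_mod_cast hN
  have hL1 : 1 ≤ Real.log N := by
    rw [Real.le_log_iff_exp_le (by linarith)]
    linarith [Real.exp_one_lt_d9]
  have hrhs : 0 ≤ C * (((4 * D : ℕ) : ℝ) ^ δ * N / h + Real.log N ^ (k + 1) * (h * N + 1)) := by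
    positivity
  rcases Nat.eq_zero_or_pos y with rfl | hy
  · simpa using hrhs
  set f : ℕ → ℂ := fun n => (Real.log n : ℂ) ^ k * (jacobiChar D n *
    (ArithmeticFunction.vonMangoldt n : ℂ)) with hf
  have hy1 : (1 : ℝ) ≤ y := by exact_mod_cast hy
  have hyN' : (y : ℝ) ≤ N := by exact_mod_cast hyN
  set σ : ℝ := 1 + 1 / Real.log N with hσ
  have hinv1 : 1 / Real.log N ≤ 1 := by rw [div_le_one (by linarith)]; exact hL1
  have hinv0 : 0 < 1 / Real.log N := by positivity
  have hσ1 : 1 < σ := by linarith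
  have hσ2 : σ ≤ 2 := by linarith
  set P : ℝ := ((4 * D : ℕ) : ℝ) ^ δ with hP
  have hsumm : LSeriesSummable f σ :=
    LSeriesSummable_log_pow_mul_twist_vonMangoldt _ k (by simpa using hσ1)
  have hLb : ∀ t : ℝ, ‖LSeries f (σ + t * Complex.I)‖ ≤ K * P * (|t| + 2) ^ (1 / 2 : ℝ) := by
    intro t
    have h1 := hKb D hD hD1 (σ + t * Complex.I) (by simpa using hσ1) (by simpa using hσ2)
    have e : ((σ : ℂ) + t * Complex.I).im = t := by simp
    rw [e, Real.mul_rpow (by positivity) (by positivity), ← hP, ← mul_assoc] at h1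
    refine h1.trans ?_
    gcongr
    linarith [abs_nonneg t]
  have hNσ : (N : ℝ) ^ σ = N * Real.exp 1 := by
    rw [hσ, Real.rpow_add (by linarith), Real.rpow_one,
      Real.rpow_def_of_pos (by linarith) (1 / Real.log N),
      mul_one_div_cancel (by linarith)]
  have hG : ∀ z : ℝ, 0 < z → z ≤ N * Real.exp 1 →
      ‖∑ n ∈ Finset.Icc 1 ⌊z⌋₊, f n * (Real.log (z / n) : ℂ)‖ ≤ I * K * Real.exp 3 * (P * N) := by
    intro z hz hz2
    refine (LSeriesSummable.norm_sum_mul_log_le hσ1.le hsumm hz hLb).trans ?_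
    have : z ^ σ ≤ N * Real.exp 3 := by
      calc z ^ σ ≤ (N * Real.exp 1) ^ σ := by gcongr
        _ = N * Real.exp 1 * Real.exp σ := by
            rw [Real.mul_rpow (by positivity) (by positivity), hNσ, ← Real.exp_mul, one_mul]
        _ ≤ N * Real.exp 1 * Real.exp 2 := by gcongr
        _ = _ := by rw [mul_assoc, ← Real.exp_add]; norm_num
    calc _ ≤ I * (K * P * (N * Real.exp 3)) := by gcongr
      _ = _ := by ring
  have hmain := norm_sum_Icc_le_of_sum_mul_log f y hy hh
  have hG1 := hG (y * Real.exp h) (by positivity) (by gcongr)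
  have hG0 := hG y (by linarith) (hyN'.trans (le_mul_of_one_le_right (by linarith)
    (Real.one_le_exp zero_le_one)))
  rw [Nat.floor_natCast] at hG0
  have htail : ∑ n ∈ Finset.Ioc y ⌊y * Real.exp h⌋₊, ‖f n‖ ≤
      2 ^ (k + 1) * 2 * (Real.log N ^ (k + 1) * (h * N + 1)) := by
    have hterm : ∀ n ∈ Finset.Ioc y ⌊y * Real.exp h⌋₊, ‖f n‖ ≤ (2 * Real.log N) ^ (k + 1) := by
      intro n hn
      rw [Finset.mem_Ioc] at hn
      have hyn : (y : ℝ) < n := by exact_mod_cast hn.1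
      have hnu : (n : ℝ) ≤ y * Real.exp h := (Nat.le_floor_iff (by positivity)).1 hn.2
      have hn3 : (n : ℝ) ≤ N * N := by
        calc (n : ℝ) ≤ N * Real.exp 1 := hnu.trans (by gcongr)
          _ ≤ N * N := by gcongr; linarith [Real.exp_one_lt_d9]
      have hlog0 : 0 ≤ Real.log n := Real.log_nonneg (by linarith)
      have hlog : Real.log n ≤ 2 * Real.log N := by
        rw [two_mul, ← Real.log_mul (by linarith) (by linarith)]
        exact Real.log_le_log (by linarith) hn3
      rw [hf]
      simp only
      rw [norm_mul, norm_pow, norm_mul, Complex.norm_real, Complex.norm_real,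
        Real.norm_of_nonneg hlog0, Real.norm_of_nonneg ArithmeticFunction.vonMangoldt_nonneg, pow_succ (2 * Real.log (N : ℝ))]
      refine mul_le_mul (pow_le_pow_left₀ hlog0 hlog k) ?_
        (mul_nonneg (norm_nonneg _) ArithmeticFunction.vonMangoldt_nonneg) (by positivity)
      calc ‖jacobiChar D n‖ * ArithmeticFunction.vonMangoldt n ≤ 1 * Real.log n :=
            mul_le_mul ((jacobiChar D).norm_le_one _) ArithmeticFunction.vonMangoldt_le_log
              ArithmeticFunction.vonMangoldt_nonneg zero_le_one
        _ ≤ _ := by linarith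
    refine (Finset.sum_le_card_nsmul _ _ _ hterm).trans ?_
    rw [Nat.card_Ioc, nsmul_eq_mul]
    have hexp : Real.exp h ≤ 1 + 2 * h := by
      have := Real.abs_exp_sub_one_le (x := h) (by rw [abs_of_pos hh]; exact hh1)
      rw [abs_of_pos hh] at this
      linarith [le_abs_self (Real.exp h - 1)]
    have hcard : ((⌊y * Real.exp h⌋₊ - y : ℕ) : ℝ) ≤ 2 * (h * N + 1) := by
      have hle : y ≤ ⌊y * Real.exp h⌋₊ :=
        Nat.le_floor (le_mul_of_one_le_right (by linarith) (Real.one_le_exp hh.le))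
      rw [Nat.cast_sub hle]
      have h1 := Nat.floor_le (show 0 ≤ y * Real.exp h by positivity)
      have h2 : y * Real.exp h ≤ y * (1 + 2 * h) := by gcongr
      have h3 : y * h ≤ N * h := by gcongr
      linarith
    calc _ ≤ 2 * (h * N + 1) * (2 * Real.log N) ^ (k + 1) := by gcongr
      _ = _ := by rw [mul_pow]; ring
  refine hmain.trans ?_
  have hgg : (‖∑ n ∈ Finset.Icc 1 ⌊y * Real.exp h⌋₊, f n * (Real.log (y * Real.exp h / n) : ℂ)‖ +
        ‖∑ n ∈ Finset.Icc 1 y, f n * (Real.log (y / n) : ℂ)‖) / h ≤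
      2 * I * K * Real.exp 3 * (P * N / h) := by
    calc _ ≤ (I * K * Real.exp 3 * (P * N) + I * K * Real.exp 3 * (P * N)) / h := by gcongr
      _ = _ := by ring
  have hp1 : 0 ≤ P * N / h := by positivity
  have hp2 : 0 ≤ Real.log N ^ (k + 1) * (h * N + 1) := by positivity
  have hp3 : 0 ≤ 2 * I * K * Real.exp 3 := by positivity
  have hp4 : (0 : ℝ) ≤ 2 ^ (k + 1) * 2 := by positivity
  have hp5 := mul_nonneg hp3 hp2
  have hp6 := mul_nonneg hp4 hp1
  calc _ ≤ 2 * I * K * Real.exp 3 * (P * N / h) +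
        2 ^ (k + 1) * 2 * (Real.log N ^ (k + 1) * (h * N + 1)) := add_le_add hgg htail
    _ ≤ _ := by rw [hC, add_mul, mul_add, mul_add]; linarith

lemma norm_sum_Ioc_mul_antitone_le {f : ℕ → ℂ} {g : ℕ → ℝ} {m N : ℕ} {M : ℝ}
    (hf : ∀ y ≤ N, ‖∑ n ∈ Finset.Icc 1 y, f n‖ ≤ M)
    (hg : ∀ i, m < i → g (i + 1) ≤ g i) (hg0 : ∀ i, m < i → 0 ≤ g i) :
    ‖∑ n ∈ Finset.Ioc m N, f n * (g n : ℂ)‖ ≤ 2 * M * g (m + 1) := by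
  set A : ℕ → ℂ := fun y => ∑ n ∈ Finset.Icc 1 y, f n with hA
  have hM0 : 0 ≤ M := (norm_nonneg _).trans (hf 0 (Nat.zero_le _))
  have hstep : ∀ y, f (y + 1) = A (y + 1) - A y := fun y => by
    rw [hA]; simp only; rw [Finset.sum_Icc_succ_top (by omega), add_sub_cancel_left]
  rcases le_or_gt N m with hNm | hNm
  · rw [Finset.Ioc_eq_empty (by omega), Finset.sum_empty, norm_zero]
    have := hg0 (m + 1) (by omega)
    positivity
  have key : ∀ j : ℕ, m + 1 + j ≤ N →
      ‖∑ n ∈ Finset.Ioc m (m + 1 + j), f n * (g n : ℂ) - g (m + 1 + j) * A (m + 1 + j)‖ ≤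
        M * (2 * g (m + 1) - g (m + 1 + j)) := by
    intro j
    induction j with
    | zero =>
      intro hj
      have h0 := hg0 (m + 1) (by omega)
      rw [add_zero, Finset.sum_Ioc_succ_top le_rfl, Finset.Ioc_self, Finset.sum_empty, zero_add,
        hstep, show (A (m + 1) - A m) * (g (m + 1) : ℂ) - g (m + 1) * A (m + 1) =
          -(g (m + 1) * A m) by ring, norm_neg, norm_mul, Complex.norm_real, Real.norm_of_nonneg h0]
      have := hf m (by omega)
      nlinarith [mul_le_mul_of_nonneg_left this h0]
    | succ j ih =>
      intro hj
      have h1 := hg (m + 1 + j) (by omega)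
      have h2 := hf (m + 1 + j) (by omega)
      rw [← add_assoc, Finset.sum_Ioc_succ_top (by omega), hstep]
      have e : ∑ n ∈ Finset.Ioc m (m + 1 + j), f n * (g n : ℂ) +
          (A (m + 1 + j + 1) - A (m + 1 + j)) * (g (m + 1 + j + 1) : ℂ) -
          g (m + 1 + j + 1) * A (m + 1 + j + 1) =
          (∑ n ∈ Finset.Ioc m (m + 1 + j), f n * (g n : ℂ) - g (m + 1 + j) * A (m + 1 + j)) +
          ((g (m + 1 + j) - g (m + 1 + j + 1) : ℝ) : ℂ) * A (m + 1 + j) := by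
        push_cast; ring
      rw [e]
      refine (norm_add_le _ _).trans ?_
      rw [norm_mul, Complex.norm_real, Real.norm_of_nonneg (by linarith)]
      have h3 := ih (by omega)
      have h4 := mul_le_mul_of_nonneg_left h2 (sub_nonneg.2 h1)
      linarith
  obtain ⟨j, rfl⟩ := Nat.exists_eq_add_of_le (Nat.succ_le_of_lt hNm)
  have h1 := key j le_rfl
  have h2 := hf (m + 1 + j) le_rfl
  have h3 := hg0 (m + 1 + j) (by omega)
  simp only [Nat.succ_eq_add_one] at *
  have h4 : ‖(g (m + 1 + j) : ℂ) * A (m + 1 + j)‖ ≤ g (m + 1 + j) * M := by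
    rw [norm_mul, Complex.norm_real, Real.norm_of_nonneg h3]
    exact mul_le_mul_of_nonneg_left h2 h3
  have h5 := norm_add_le (∑ n ∈ Finset.Ioc m (m + 1 + j), f n * (g n : ℂ) -
    g (m + 1 + j) * A (m + 1 + j)) (g (m + 1 + j) * A (m + 1 + j))
  rw [sub_add_cancel] at h5
  linarith

lemma norm_sum_prime_sub_sum_Ioc_le {q : ℕ} (χ : DirichletCharacter ℂ q) {m N : ℕ} (hm : 2 ≤ m)
    (hmN : m ≤ N) :
    ‖∑ p ∈ (Finset.range (N + 1)).filter Nat.Prime, χ p -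
      ∑ n ∈ Finset.Ioc m N, χ n * (ArithmeticFunction.vonMangoldt n : ℂ) / Real.log n‖ ≤
      m + 2 * √N * Real.log N := by
  have hN1 : (1 : ℝ) ≤ N := by exact_mod_cast (by omega : 1 ≤ N)
  have hlog : ∀ n ∈ Finset.Ioc m N, 1 ≤ Real.log n := by
    intro n hn
    have h3 : (3 : ℝ) ≤ n := by
      have := (Finset.mem_Ioc.1 hn).1
      exact_mod_cast (by omega : 3 ≤ n)
    rw [Real.le_log_iff_exp_le (by linarith)]
    linarith [Real.exp_one_lt_d9]
  have hu : Finset.range (N + 1) = insert 0 (Finset.Ioc 0 m) ∪ Finset.Ioc m N := by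
    ext n; simp only [Finset.mem_union, Finset.mem_range, Finset.mem_Ioc, Finset.mem_insert]; omega
  have hdisj : Disjoint ((insert 0 (Finset.Ioc 0 m)).filter Nat.Prime)
      ((Finset.Ioc m N).filter Nat.Prime) := by
    refine Finset.disjoint_filter_filter (Finset.disjoint_left.2 fun n hn hn' => ?_)
    simp only [Finset.mem_insert, Finset.mem_Ioc] at hn hn'; omega
  rw [hu, Finset.filter_union, Finset.sum_union hdisj,
    ← Finset.sum_filter_add_sum_filter_not (Finset.Ioc m N) Nat.Prime
      (fun n => χ n * (ArithmeticFunction.vonMangoldt n : ℂ) / Real.log n)]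
  have hp : ∑ n ∈ (Finset.Ioc m N).filter Nat.Prime,
      χ n * (ArithmeticFunction.vonMangoldt n : ℂ) / Real.log n =
      ∑ n ∈ (Finset.Ioc m N).filter Nat.Prime, χ n := by
    refine Finset.sum_congr rfl fun n hn => ?_
    rw [Finset.mem_filter] at hn
    rw [ArithmeticFunction.vonMangoldt_apply_prime hn.2]
    have : (Real.log n : ℂ) ≠ 0 := by exact_mod_cast (by linarith [hlog n hn.1] : Real.log n ≠ 0)
    field_simp
  rw [hp, add_comm (∑ n ∈ (Finset.Ioc m N).filter Nat.Prime, χ n), add_sub_add_right_eq_sub]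
  refine (norm_sub_le _ _).trans (add_le_add ?_ ?_)
  · refine (norm_sum_le_of_le _ fun n _ => χ.norm_le_one _).trans ?_
    rw [Finset.sum_const, nsmul_eq_mul, mul_one]
    have : (insert 0 (Finset.Ioc 0 m)).filter Nat.Prime ⊆ Finset.Ioc 0 m := by
      intro n hn
      rw [Finset.mem_filter, Finset.mem_insert] at hn
      exact hn.1.resolve_left hn.2.ne_zero
    exact_mod_cast (Finset.card_le_card this).trans (by simp)
  · refine le_trans ?_ (Chebyshev.psi_sub_theta_le hN1)
    rw [Chebyshev.psi_sub_theta_eq_sum_not_prime, Nat.floor_natCast]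
    refine (norm_sum_le _ _).trans (le_trans (Finset.sum_le_sum (fun n hn => ?_))
      (Finset.sum_le_sum_of_subset_of_nonneg (Finset.filter_subset_filter _
        (Finset.Ioc_subset_Ioc_left (Nat.zero_le m)))
        fun n _ _ => ArithmeticFunction.vonMangoldt_nonneg))
    have hl := hlog n (Finset.mem_filter.1 hn).1
    rw [norm_div, norm_mul, Complex.norm_real, Complex.norm_real,
      Real.norm_of_nonneg ArithmeticFunction.vonMangoldt_nonneg, Real.norm_of_nonneg (by linarith)]
    refine (div_le_self (mul_nonneg (norm_nonneg _) ArithmeticFunction.vonMangoldt_nonneg) hl).trans ?_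
    exact mul_le_of_le_one_left ArithmeticFunction.vonMangoldt_nonneg (χ.norm_le_one _)

lemma exists_forall_log_pow_le (b : ℕ) : ∃ N₀ : ℕ, ∀ N : ℕ, N₀ ≤ N → Real.log N ^ b ≤ N := by
  have h := (Real.isLittleO_pow_log_id_atTop (n := b)).bound one_pos
  have h2 := tendsto_natCast_atTop_atTop (R := ℝ) |>.eventually h
  obtain ⟨N₀, hN₀⟩ := Filter.eventually_atTop.1 h2
  refine ⟨N₀, fun N hN => (le_abs_self _).trans ?_⟩
  simpa using hN₀ N hN

lemma exists_norm_sum_prime_jacobiChar_le {B : ℝ} (hB : 1 ≤ B) (b : ℕ) :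
    ∃ C : ℝ, 0 < C ∧ ∃ N₀ : ℕ, ∀ N : ℕ, N₀ ≤ N → ∀ (D : ℕ) [NeZero D], Squarefree D → D ≠ 1 →
      ((4 * D : ℕ) : ℝ) ≤ Real.log N ^ B →
      ‖∑ p ∈ (Finset.range (N + 1)).filter Nat.Prime, jacobiChar D p‖ ≤ C * (N / Real.log N ^ b) := by
  have hδ0 : (0 : ℝ) < 1 / (2 * B) := by positivity
  have hδ1 : 1 / (2 * B) ≤ 1 / 2 := one_div_le_one_div_of_le (by norm_num) (by linarith)
  obtain ⟨C, hC, h⟩ := exists_norm_sum_log_pow_jacobiChar_le (2 * b) hδ0 hδ1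
  obtain ⟨N₀, hN₀⟩ := exists_forall_log_pow_le (2 * (b + 2))
  refine ⟨6 * C * 2 ^ (2 * b + 1) + 2, by positivity, max N₀ 21, fun N hN D _ hD hD1 hDN => ?_⟩
  have hN21 : 21 ≤ N := (le_max_right _ _).trans hN
  have hN21' : (21 : ℝ) ≤ N := by exact_mod_cast hN21
  set L : ℝ := Real.log N with hL
  have hL3 : 3 ≤ L := by
    rw [hL, Real.le_log_iff_exp_le (by linarith)]
    refine le_trans ?_ hN21'
    rw [show (3 : ℝ) = ((3 : ℕ) : ℝ) * 1 by norm_num, Real.exp_nat_mul]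
    calc Real.exp 1 ^ 3 ≤ 2.7182818286 ^ 3 := by gcongr; exact Real.exp_one_lt_d9.le
      _ ≤ 21 := by norm_num
  have hL0 : 0 < L := by linarith
  have hLs : L ^ (b + 2) ≤ √N := by
    refine Real.le_sqrt_of_sq_le ?_
    rw [← pow_mul, mul_comm]
    exact hN₀ N ((le_max_left _ _).trans hN)
  have hsN : √N * √N = N := Real.mul_self_sqrt (by linarith)
  have hs0 : 0 ≤ √(N : ℝ) := Real.sqrt_nonneg _
  set m := Nat.sqrt N with hm
  have hm2 : 2 ≤ m := Nat.le_sqrt.2 (by omega)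
  have hmN : m ≤ N := Nat.sqrt_le_self N
  have hms : (m : ℝ) ≤ √N := Real.nat_sqrt_le_real_sqrt
  have hms' : √N ≤ ((m + 1 : ℕ) : ℝ) := by push_cast; exact Real.real_sqrt_le_nat_sqrt_succ
  have hlogm : L / 2 ≤ Real.log ((m + 1 : ℕ) : ℝ) := by
    rw [hL, ← Real.log_sqrt (by linarith)]
    exact Real.log_le_log (Real.sqrt_pos.2 (by linarith)) hms'
  set g : ℕ → ℝ := fun n => (Real.log n ^ (2 * b + 1))⁻¹ with hg
  have hlogpos : ∀ i : ℕ, m < i → 0 < Real.log i := fun i hi =>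
    Real.log_pos (by exact_mod_cast (by omega : 1 < i))
  have hNb : 1 ≤ N / L ^ b := by
    rw [one_le_div (by positivity)]
    calc L ^ b ≤ L ^ (b + 2) := pow_le_pow_right₀ (by linarith) (by omega)
      _ ≤ √N := hLs
      _ ≤ √N * √N := le_mul_of_one_le_right hs0 (Real.one_le_sqrt.2 (by linarith))
      _ = N := hsN
  set M : ℝ := C * (L * N * L ^ b + L ^ (2 * b + 1) * (N / L ^ b + 1)) with hM
  have hA : ∀ y ≤ N, ‖∑ n ∈ Finset.Icc 1 y, (Real.log n : ℂ) ^ (2 * b) * (jacobiChar D n *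
        (ArithmeticFunction.vonMangoldt n : ℂ))‖ ≤ M := by
    intro y hy
    refine (h D hD hD1 N (by omega) (L ^ b)⁻¹ (by positivity)
      (inv_le_one_of_one_le₀ (one_le_pow₀ (by linarith))) y hy).trans ?_
    rw [hM, ← hL]
    have hP : ((4 * D : ℕ) : ℝ) ^ (1 / (2 * B)) ≤ L := by
      calc ((4 * D : ℕ) : ℝ) ^ (1 / (2 * B)) ≤ (L ^ B) ^ (1 / (2 * B)) := by gcongr
        _ = L ^ (1 / 2 : ℝ) := by
            rw [← Real.rpow_mul hL0.le]; congr 1; field_simp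
        _ ≤ L ^ (1 : ℝ) := Real.rpow_le_rpow_of_exponent_le (by linarith) (by norm_num)
        _ = L := Real.rpow_one L
    rw [div_inv_eq_mul, inv_mul_eq_div]
    gcongr
  have habel := norm_sum_Ioc_mul_antitone_le (g := g) (m := m) hA
    (fun i hi => by
      have := hlogpos i hi
      have hi0 : (0 : ℝ) < i := by exact_mod_cast (by omega : 0 < i)
      exact inv_anti₀ (pow_pos this _) (pow_le_pow_left₀ this.le
        (Real.log_le_log hi0 (by push_cast; linarith)) _))
    (fun i hi => by have := hlogpos i hi; simp only [hg]; positivity)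
  have hgm : g (m + 1) ≤ 2 ^ (2 * b + 1) / L ^ (2 * b + 1) := by
    rw [← div_pow, ← inv_div, inv_pow]
    simp only [hg]
    gcongr
  have habel2 : ‖∑ n ∈ Finset.Ioc m N, jacobiChar D n * (ArithmeticFunction.vonMangoldt n : ℂ) /
      Real.log n‖ ≤ 6 * C * 2 ^ (2 * b + 1) * (N / L ^ b) := by
    have e : ∑ n ∈ Finset.Ioc m N, jacobiChar D n * (ArithmeticFunction.vonMangoldt n : ℂ) /
        Real.log n = ∑ n ∈ Finset.Ioc m N, (Real.log n : ℂ) ^ (2 * b) * (jacobiChar D n *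
        (ArithmeticFunction.vonMangoldt n : ℂ)) * (g n : ℂ) := by
      refine Finset.sum_congr rfl fun n hn => ?_
      have : (Real.log n : ℂ) ≠ 0 := by
        exact_mod_cast (hlogpos n (Finset.mem_Ioc.1 hn).1).ne'
      simp only [hg]
      rw [Complex.ofReal_inv, Complex.ofReal_pow, pow_succ]
      field_simp
    rw [e]
    refine habel.trans ?_
    calc 2 * M * g (m + 1) ≤ 2 * M * (2 ^ (2 * b + 1) / L ^ (2 * b + 1)) := by gcongr
      _ = 2 * C * 2 ^ (2 * b + 1) * (N / L ^ b + (N / L ^ b + 1)) := by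
          rw [hM]
          field_simp
          ring
      _ ≤ 2 * C * 2 ^ (2 * b + 1) * (N / L ^ b + (N / L ^ b + N / L ^ b)) := by gcongr
      _ = _ := by ring
  have herr : m + 2 * √N * L ≤ 2 * (N / L ^ b) := by
    rw [← mul_div_assoc, le_div_iff₀ (by positivity)]
    have h1 : L ^ b * (1 + 2 * L) ≤ 2 * √N := by
      calc L ^ b * (1 + 2 * L) ≤ L ^ b * (2 * L ^ 2) := by gcongr; nlinarith
        _ = 2 * L ^ (b + 2) := by ring
        _ ≤ _ := by gcongr
    calc (m + 2 * √N * L) * L ^ b ≤ (√N + 2 * √N * L) * L ^ b := by gcongr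
      _ = √N * (L ^ b * (1 + 2 * L)) := by ring
      _ ≤ √N * (2 * √N) := by gcongr
      _ = 2 * N := by rw [mul_left_comm, hsN]
  have hfin := norm_sum_prime_sub_sum_Ioc_le (jacobiChar D) hm2 hmN
  rw [← hL] at hfin
  have := norm_sub_norm_le (∑ p ∈ (Finset.range (N + 1)).filter Nat.Prime, jacobiChar D p)
    (∑ n ∈ Finset.Ioc m N, jacobiChar D n * (ArithmeticFunction.vonMangoldt n : ℂ) / Real.log n)
  linarith

lemma jacobiSym_prod_left {ι : Type*} (S : Finset ι) (q : ι → ℕ) (p : ℕ) :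
    jacobiSym ((∏ j ∈ S, q j : ℕ) : ℤ) p = ∏ j ∈ S, jacobiSym (q j) p := by
  classical
  induction S using Finset.induction_on with
  | empty => simp [jacobiSym.one_left]
  | insert a S ha ih =>
    rw [Finset.prod_insert ha, Finset.prod_insert ha, Nat.cast_mul, jacobiSym.mul_left, ih]

lemma abs_two_pow_mul_ite_sub_prod_le {k : ℕ} {q : Fin k → ℕ} (hq : ∀ j, (q j).Prime)
    {w : Fin k → ℤ} (hw : ∀ j, w j = 1 ∨ w j = -1) {p : ℕ} (hp : p.Prime) :
    |2 ^ k * (if ∀ j, jacobiSym (q j) p = w j then (1 : ℤ) else 0) -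
      ∏ j, (1 + w j * jacobiSym (q j) p)| ≤ 2 ^ k * if ∃ j, q j = p then (1 : ℤ) else 0 := by
  have htri : ∀ j, 0 ≤ 1 + w j * jacobiSym (q j) p ∧ 1 + w j * jacobiSym (q j) p ≤ 2 := by
    intro j
    rcases hw j with h | h <;> rcases jacobiSym.trichotomy (q j) p with h' | h' | h' <;>
      rw [h, h'] <;> norm_num
  have h0 : 0 ≤ ∏ j, (1 + w j * jacobiSym (q j) p) := Finset.prod_nonneg fun j _ => (htri j).1
  have h2 : ∏ j, (1 + w j * jacobiSym (q j) p) ≤ 2 ^ k := by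
    refine (Finset.prod_le_prod (fun j _ => (htri j).1) fun j _ => (htri j).2).trans ?_
    simp
  have hk : (0 : ℤ) < 2 ^ k := by positivity
  by_cases hex : ∃ j, q j = p
  · rw [if_pos hex, mul_one, abs_le]
    split_ifs <;> constructor <;> linarith
  · rw [if_neg hex, mul_zero]
    refine le_of_eq (abs_eq_zero.2 (sub_eq_zero.2 ?_))
    push Not at hex
    have : NeZero p := ⟨hp.ne_zero⟩
    have hne : ∀ j, jacobiSym (q j) p ≠ 0 := by
      intro j h
      rw [jacobiSym.eq_zero_iff_not_coprime, Int.gcd_natCast_natCast] at h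
      exact h ((Nat.coprime_primes (hq j) hp).2 (hex j))
    split_ifs with hall
    · rw [mul_one, Finset.prod_eq_pow_card (b := (2 : ℤ))]
      · simp
      · intro j _
        rcases hw j with h | h <;> rw [hall j, h] <;> norm_num
    · push Not at hall
      obtain ⟨j, hj⟩ := hall
      rw [mul_zero, eq_comm, Finset.prod_eq_zero (Finset.mem_univ j)]
      rcases hw j with h | h <;> rcases jacobiSym.trichotomy (q j) p with h' | h' | h' <;>
        simp_all

lemma abs_two_pow_mul_card_sub_le {k N : ℕ} {q : Fin k → ℕ} (hq : ∀ j, (q j).Prime)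
    {w : Fin k → ℤ} (hw : ∀ j, w j = 1 ∨ w j = -1) {M : ℝ} (hM0 : 0 ≤ M)
    (hM : ∀ S : Finset (Fin k), S.Nonempty →
      |((∑ p ∈ (Finset.range (N + 1)).filter Nat.Prime,
        jacobiSym ((∏ j ∈ S, q j : ℕ) : ℤ) p : ℤ) : ℝ)| ≤ M) :
    |2 ^ k * (((Finset.range (N + 1)).filter
        (fun p => p.Prime ∧ ∀ j, jacobiSym (q j) p = w j)).card : ℝ) -
      ((Finset.range (N + 1)).filter Nat.Prime).card| ≤ 2 ^ k * (k + M) := by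
  classical
  set P := (Finset.range (N + 1)).filter Nat.Prime with hP
  have hprime : ∀ p ∈ P, p.Prime := fun p hp => (Finset.mem_filter.1 hp).2
  have hcard : (((Finset.range (N + 1)).filter
      (fun p => p.Prime ∧ ∀ j, jacobiSym (q j) p = w j)).card : ℤ) =
      ∑ p ∈ P, if ∀ j, jacobiSym (q j) p = w j then (1 : ℤ) else 0 := by
    rw [← Finset.filter_filter, ← hP, Finset.card_filter]
    push_cast
    rfl
  set I := ((Finset.range (N + 1)).filter
      (fun p => p.Prime ∧ ∀ j, jacobiSym (q j) p = w j)).card with hI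
  have h1 : |2 ^ k * (I : ℤ) - ∑ p ∈ P, ∏ j, (1 + w j * jacobiSym (q j) p)| ≤ 2 ^ k * k := by
    rw [hcard, Finset.mul_sum, ← Finset.sum_sub_distrib]
    refine (Finset.abs_sum_le_sum_abs _ _).trans ((Finset.sum_le_sum fun p hp =>
      abs_two_pow_mul_ite_sub_prod_le hq hw (hprime p hp)).trans ?_)
    rw [← Finset.mul_sum]
    gcongr
    rw [Finset.sum_boole]
    have : P.filter (fun p => ∃ j, q j = p) ⊆ Finset.univ.image q := by
      intro p hp
      obtain ⟨j, hj⟩ := (Finset.mem_filter.1 hp).2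
      exact Finset.mem_image.2 ⟨j, Finset.mem_univ j, hj⟩
    have := (Finset.card_le_card this).trans Finset.card_image_le
    rw [Finset.card_univ, Fintype.card_fin] at this
    exact_mod_cast this
  have h2 : ∑ p ∈ P, ∏ j, (1 + w j * jacobiSym (q j) p) = P.card +
      ∑ S ∈ (Finset.univ : Finset (Fin k)).powerset.erase ∅, (∏ j ∈ S, w j) *
        ∑ p ∈ P, jacobiSym ((∏ j ∈ S, q j : ℕ) : ℤ) p := by
    simp_rw [Finset.prod_one_add, Finset.mul_sum]
    rw [Finset.sum_comm, ← Finset.add_sum_erase _ _ (Finset.empty_mem_powerset _)]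
    congr 1
    · simp
    · refine Finset.sum_congr rfl fun S _ => Finset.sum_congr rfl fun p _ => ?_
      rw [Finset.prod_mul_distrib, jacobiSym_prod_left]
  have h3 : |((∑ S ∈ (Finset.univ : Finset (Fin k)).powerset.erase ∅, (∏ j ∈ S, w j) *
        ∑ p ∈ P, jacobiSym ((∏ j ∈ S, q j : ℕ) : ℤ) p : ℤ) : ℝ)| ≤ 2 ^ k * M := by
    rw [Int.cast_sum]
    refine (Finset.abs_sum_le_sum_abs _ _).trans ((Finset.sum_le_sum (g := fun _ => M)
      fun S hS => ?_).trans ?_)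
    · rw [Int.cast_mul, abs_mul]
      have hwS : |((∏ j ∈ S, w j : ℤ) : ℝ)| = 1 := by
        rw [← Int.cast_abs, Finset.abs_prod, Finset.prod_eq_one, Int.cast_one]
        intro j _
        rcases hw j with h | h <;> rw [h] <;> norm_num
      rw [hwS, one_mul]
      exact hM S (Finset.nonempty_iff_ne_empty.2 (Finset.ne_of_mem_erase hS))
    · rw [Finset.sum_const, nsmul_eq_mul]
      gcongr
      have := Finset.card_le_card (Finset.erase_subset ∅ (Finset.univ : Finset (Fin k)).powerset)
      rw [Finset.card_powerset, Finset.card_univ, Fintype.card_fin] at this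
      exact_mod_cast this
  have h1' : |2 ^ k * (I : ℝ) -
      ((∑ p ∈ P, ∏ j, (1 + w j * jacobiSym (q j) p) : ℤ) : ℝ)| ≤ 2 ^ k * k := by
    exact_mod_cast h1
  rw [h2, Int.cast_add, Int.cast_natCast] at h1'
  rw [abs_le] at *
  constructor <;> linarith [h1'.1, h1'.2, h3.1, h3.2]

lemma div_four_mul_log_le_primeCounting {n : ℕ} (hn : 4 ≤ n) :
    (n : ℝ) / (4 * Real.log n) ≤ Nat.primeCounting n := by
  have hn' : (4 : ℝ) ≤ n := by exact_mod_cast hn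
  have hlog : 0 < Real.log n := Real.log_pos (by linarith)
  refine le_trans ?_ (Chebyshev.pi_ge n)
  rw [div_le_div_iff₀ (by positivity) hlog]
  have h1 : Real.log ((n + 1) / 4) ≤ (n + 1) / 4 - 1 := Real.log_le_sub_one_of_pos (by positivity)
  rw [Real.log_div (by positivity) (by norm_num), show (4 : ℝ) = 2 ^ 2 by norm_num,
    Real.log_pow] at h1
  have h2 := Real.log_two_gt_d9
  have h3 := Real.log_two_lt_d9
  push_cast at h1
  have h4 : (n : ℝ) * 0.69 ≤ n * Real.log 2 := by gcongr; linarith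
  have h5 : (n : ℝ) / 4 ≤ n * Real.log 2 - Real.log (n + 1) := by linarith
  nlinarith

lemma nth_prime_le_mul_sq (j : ℕ) : Nat.nth Nat.Prime j ≤ 64 * (j + 1) ^ 2 := by
  set n := 64 * (j + 1) ^ 2 with hn
  have hn64 : 64 ≤ n := by nlinarith [Nat.zero_le j]
  have hn' : (64 : ℝ) ≤ n := by exact_mod_cast hn64
  have hsq : √(n : ℝ) = 8 * (j + 1) := by
    rw [hn]; push_cast
    rw [show (64 : ℝ) * (j + 1) ^ 2 = (8 * (j + 1)) ^ 2 by ring, Real.sqrt_sq (by positivity)]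
  have hlog : Real.log n < 2 * √n := by
    have := Real.log_sqrt (show (0 : ℝ) ≤ n by linarith)
    have h2 := Real.log_le_sub_one_of_pos (Real.sqrt_pos.2 (show (0 : ℝ) < n by linarith))
    linarith
  have hlog0 : 0 < Real.log n := Real.log_pos (by linarith)
  have h1 := div_four_mul_log_le_primeCounting (n := n) (by omega)
  have h2 : (j + 1 : ℝ) < n / (4 * Real.log n) := by
    rw [lt_div_iff₀ (by positivity)]
    have := Real.mul_self_sqrt (show (0 : ℝ) ≤ n by linarith)
    rw [hsq] at this hlog
    have hj : (0 : ℝ) < j + 1 := by positivity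
    nlinarith
  have h3 : j < Nat.count Nat.Prime (n + 1) := by
    have : (j + 1 : ℝ) < Nat.primeCounting n := h2.trans_le h1
    have : j + 1 < Nat.primeCounting n := by exact_mod_cast this
    have e : Nat.primeCounting n = Nat.count Nat.Prime (n + 1) := rfl
    omega
  exact Nat.lt_succ_iff.1 (Nat.nth_lt_of_lt_count h3)

lemma four_mul_pow_le_rpow {A L : ℝ} {k : ℕ} (hL0 : 0 < L) (hk : 1 ≤ k) (hL : 1 ≤ Real.log L)
    (hk1 : (k : ℝ) ≤ Real.log L) (hk2 : k * Real.log (Real.log L) ≤ A * Real.log L) :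
    4 * (64 * (k : ℝ) ^ 2) ^ k ≤ L ^ (8 + 2 * A) := by
  have hk' : (1 : ℝ) ≤ k := by exact_mod_cast hk
  rw [← Real.log_le_log_iff (by positivity) (by positivity), Real.log_rpow hL0,
    Real.log_mul (by norm_num) (by positivity), Real.log_pow, Real.log_mul (by norm_num) (by positivity),
    Real.log_pow, show (4 : ℝ) = 2 ^ 2 by norm_num, show (64 : ℝ) = 2 ^ 6 by norm_num,
    Real.log_pow, Real.log_pow]
  push_cast
  have h2 := Real.log_two_lt_d9
  have h3 : Real.log k ≤ Real.log (Real.log L) := Real.log_le_log (by linarith) hk1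
  have h4 : k * Real.log k ≤ A * Real.log L := (mul_le_mul_of_nonneg_left h3 (by linarith)).trans hk2
  have h5 : k * Real.log 2 ≤ Real.log L * 1 :=
    mul_le_mul hk1 (by linarith) (Real.log_nonneg (by norm_num)) (by linarith)
  linarith

lemma squarefree_prod_nth_prime {k : ℕ} (S : Finset (Fin k)) :
    Squarefree (∏ j ∈ S, Nat.nth Nat.Prime (j : ℕ)) := by
  refine Finset.squarefree_prod_of_pairwise_isCoprime (fun i _ j _ hij => ?_)
    fun j _ => (Nat.prime_nth_prime j).squarefree
  rw [Function.onFun, ← Nat.coprime_iff_isRelPrime,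
    Nat.coprime_primes (Nat.prime_nth_prime i) (Nat.prime_nth_prime j)]
  exact fun h => hij (Fin.ext (Nat.nth_injective Nat.infinite_setOfPred_prime h))

lemma prod_nth_prime_le {k : ℕ} (hk : 1 ≤ k) (S : Finset (Fin k)) :
    ∏ j ∈ S, Nat.nth Nat.Prime (j : ℕ) ≤ (64 * k ^ 2) ^ k := by
  calc ∏ j ∈ S, Nat.nth Nat.Prime (j : ℕ) ≤ ∏ _j ∈ S, 64 * k ^ 2 := by
        refine Finset.prod_le_prod' fun j _ => (nth_prime_le_mul_sq j).trans ?_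
        have := j.isLt
        gcongr
        omega
    _ = (64 * k ^ 2) ^ S.card := by rw [Finset.prod_const]
    _ ≤ _ := by
        refine Nat.pow_le_pow_right (by positivity) ?_
        simpa using Finset.card_le_univ S

lemma abs_sum_prime_jacobiSym_le (D N : ℕ) [NeZero D] :
    |((∑ p ∈ (Finset.range (N + 1)).filter Nat.Prime, jacobiSym (D : ℤ) p : ℤ) : ℝ)| ≤
      ‖∑ p ∈ (Finset.range (N + 1)).filter Nat.Prime, jacobiChar D p‖ + 1 := by
  have h : ‖((∑ p ∈ (Finset.range (N + 1)).filter Nat.Prime, jacobiSym (D : ℤ) p : ℤ) : ℂ) -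
      ∑ p ∈ (Finset.range (N + 1)).filter Nat.Prime, jacobiChar D p‖ ≤ 1 := by
    rw [Int.cast_sum, ← Finset.sum_sub_distrib]
    calc _ ≤ ∑ p ∈ (Finset.range (N + 1)).filter Nat.Prime, if p = 2 then (1 : ℝ) else 0 := by
          refine norm_sum_le_of_le _ fun p hp => ?_
          rw [jacobiChar_natCast]
          rcases (Finset.mem_filter.1 hp).2.eq_two_or_odd' with rfl | hodd
          · rw [if_neg (by decide), if_pos rfl, sub_zero]
            rcases jacobiSym.trichotomy D 2 with h | h | h <;> rw [h] <;> norm_num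
          · rw [if_pos hodd, sub_self, norm_zero]
            split_ifs <;> norm_num
      _ ≤ 1 := by
          rw [Finset.sum_ite_eq']
          split_ifs <;> norm_num
  have h2 := norm_sub_norm_le ((∑ p ∈ (Finset.range (N + 1)).filter Nat.Prime,
    jacobiSym (D : ℤ) p : ℤ) : ℂ) (∑ p ∈ (Finset.range (N + 1)).filter Nat.Prime, jacobiChar D p)
  rw [Complex.norm_intCast] at h2
  linarith

lemma abs_inv_mul_sub_inv_two_pow_le {A C L N P I : ℝ} {k b : ℕ} (hC : 0 < C) (hL : 1 ≤ L)
    (hN : L ^ b ≤ N) (hP : N / (4 * L) ≤ P) (hk : (2 : ℝ) ^ k ≤ L) (hb : A + 3 ≤ b)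
    (h : |2 ^ k * I - P| ≤ 2 ^ k * (k + (C * (N / L ^ b) + 1))) :
    |P⁻¹ * I - ((2 : ℝ) ^ k)⁻¹| ≤ (4 + 4 * C) / (2 ^ k * L ^ A) := by
  have hL0 : 0 < L := by linarith
  have hN0 : 0 < N := lt_of_lt_of_le (by positivity) hN
  have hP0 : 0 < P := lt_of_lt_of_le (by positivity) hP
  have hk1 : (k : ℝ) + 1 ≤ L := by
    refine le_trans ?_ hk
    exact_mod_cast Nat.lt_two_pow_self
  have hLA : L ^ A * L ^ 3 ≤ L ^ b := by
    rw [← Real.rpow_natCast L b, ← Real.rpow_natCast L 3, ← Real.rpow_add hL0]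
    exact Real.rpow_le_rpow_of_exponent_le hL (by push_cast; exact hb)
  have e : P⁻¹ * I - ((2 : ℝ) ^ k)⁻¹ = (2 ^ k * I - P) / (2 ^ k * P) := by field_simp
  rw [e, abs_div, abs_of_pos (by positivity : (0 : ℝ) < 2 ^ k * P)]
  have h1 : N ≤ 4 * L * P := by rwa [div_le_iff₀' (by positivity)] at hP
  have h2 : (k + (C * (N / L ^ b) + 1)) * L ^ b ≤ (1 + C) * L * N := by
    calc _ = (k + 1) * L ^ b + C * N := by field_simp; ring
      _ ≤ L * N + C * (L * N) := by
          gcongr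
          exact le_mul_of_one_le_left hN0.le hL
      _ = _ := by ring
  calc |2 ^ k * I - P| / (2 ^ k * P) ≤ 2 ^ k * (k + (C * (N / L ^ b) + 1)) / (2 ^ k * P) := by
        gcongr
    _ = (k + (C * (N / L ^ b) + 1)) / P := by field_simp
    _ ≤ (1 + C) * L * N / L ^ b / P := by
        gcongr
        rwa [le_div_iff₀ (by positivity)]
    _ ≤ (1 + C) * L * (4 * L * P) / L ^ b / P := by gcongr
    _ = (4 + 4 * C) * L ^ 2 / L ^ b := by field_simp
    _ ≤ (4 + 4 * C) / (2 ^ k * L ^ A) := by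
        rw [div_le_div_iff₀ (by positivity) (by positivity), mul_assoc]
        gcongr
        calc L ^ 2 * (2 ^ k * L ^ A) ≤ L ^ 2 * (L * L ^ A) := by gcongr
          _ = L ^ A * L ^ 3 := by ring
          _ ≤ _ := hLA

/-- Fix `A ≥ 1`. There exist constants `C > 0` and `N₀ > 0`, depending only on
`A`, such that for every integer `N ≥ N₀`, every positive integer
`k ≤ A·(log log N)/(log log log N)`, and every tuple `v = (v_1,…,v_k) ∈ {−1,1}^k` (encoded by
`v : Fin k → Bool`, `true ↦ 1`, `false ↦ -1`), one has
`|(1/π(N))·#{primes p ≤ N : χ_p(q_j) = v_j for all 1 ≤ j ≤ k} − 2^{−k}| ≤ C/(2^k (log N)^A)`,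
where `q_j` is the `j`-th prime and `χ_p(q_j)` is the Legendre symbol, formalized via the Jacobi
symbol `J(q_j | p)`, which agrees with the Legendre symbol for prime `p`. -/
theorem randomness_char_sums_stmt10 (A : ℝ) (hA : 1 ≤ A) :
    ∃ C N0 : ℝ, 0 < C ∧ 0 < N0 ∧
      ∀ N : ℕ, N0 ≤ (N : ℝ) → ∀ k : ℕ, 1 ≤ k →
        (k : ℝ) ≤ A * Real.log (Real.log N) / Real.log (Real.log (Real.log N)) →
        ∀ v : Fin k → Bool,
          |((((Finset.range (N + 1)).filter Nat.Prime).card : ℝ))⁻¹ *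
              ((((Finset.range (N + 1)).filter (fun p => p.Prime ∧
                ∀ j : Fin k, jacobiSym (Nat.nth Nat.Prime (j : ℕ) : ℤ) p
                  = (if v j then 1 else -1))).card : ℝ))
            - ((2 : ℝ) ^ k)⁻¹|
          ≤ C / (2 ^ k * Real.log N ^ A) := by
  set b : ℕ := ⌈A⌉₊ + 3 with hb
  have hb' : A + 3 ≤ b := by rw [hb]; push_cast; linarith [Nat.le_ceil A]
  obtain ⟨C, hC, N₁, h1⟩ := exists_norm_sum_prime_jacobiChar_le (B := 8 + 2 * A) (by linarith) b
  obtain ⟨N₂, h2⟩ := exists_forall_log_pow_le b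
  have hlog := Real.tendsto_log_atTop.comp (tendsto_natCast_atTop_atTop (R := ℝ))
  obtain ⟨N₃, h3⟩ := Filter.eventually_atTop.1
    (((Real.tendsto_log_atTop.comp (Real.tendsto_log_atTop.comp hlog)).eventually_ge_atTop A).and
      (((Real.tendsto_log_atTop.comp hlog).eventually_ge_atTop 1).and
        (hlog.eventually_ge_atTop 1)))
  refine ⟨4 + 4 * C, (max (max N₁ N₂) (max N₃ 4) : ℕ), by positivity, by
    exact_mod_cast lt_of_lt_of_le (by norm_num : 0 < 4)
      ((le_max_right N₃ 4).trans (le_max_right _ _)), fun N hN k hk hkA v => ?_⟩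
  have hN : max (max N₁ N₂) (max N₃ 4) ≤ N := by exact_mod_cast hN
  rw [max_le_iff, max_le_iff, max_le_iff] at hN
  obtain ⟨⟨hN1, hN2⟩, hN3, hN4⟩ := hN
  obtain ⟨hLLL, hLL, hL⟩ := h3 N hN3
  simp only [Function.comp_apply] at hLLL hLL hL
  set L := Real.log N with hLdef
  have hL0 : 0 < L := by linarith
  have hk2 : k * Real.log (Real.log L) ≤ A * Real.log L := (le_div_iff₀ (by linarith)).1 hkA
  have hk1 : (k : ℝ) ≤ Real.log L := by
    refine hkA.trans ?_
    rw [div_le_iff₀ (by linarith), mul_comm]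
    gcongr
  have hk3 : (2 : ℝ) ^ k ≤ L := by
    calc (2 : ℝ) ^ k ≤ Real.exp 1 ^ k := by gcongr; linarith [Real.exp_one_gt_d9]
      _ = Real.exp k := by rw [← Real.exp_nat_mul, mul_one]
      _ ≤ Real.exp (Real.log L) := by gcongr
      _ = L := Real.exp_log hL0
  have hpi : N / (4 * L) ≤ (((Finset.range (N + 1)).filter Nat.Prime).card : ℝ) := by
    refine (div_four_mul_log_le_primeCounting hN4).trans (le_of_eq ?_)
    rw [Nat.primeCounting, Nat.primeCounting', Nat.count_eq_card_filter_range]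
  refine abs_inv_mul_sub_inv_two_pow_le (b := b) hC hL (h2 N hN2) hpi hk3 hb' ?_
  refine abs_two_pow_mul_card_sub_le (q := fun j : Fin k => Nat.nth Nat.Prime j)
    (fun j => Nat.prime_nth_prime j) (w := fun j => if v j then 1 else -1)
    (fun j => by cases v j <;> simp) (by positivity) fun S hS => ?_
  have hsf := squarefree_prod_nth_prime S
  have : NeZero (∏ j ∈ S, Nat.nth Nat.Prime (j : ℕ)) := ⟨hsf.ne_zero⟩
  refine (abs_sum_prime_jacobiSym_le _ N).trans ?_
  gcongr
  refine h1 N hN1 _ hsf ?_ ?_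
  · obtain ⟨j, hj⟩ := hS
    intro h
    exact (Nat.prime_nth_prime j).one_lt.not_ge
      (Nat.le_of_dvd one_pos (h ▸ Finset.dvd_prod_of_mem _ hj))
  · refine le_trans ?_ (four_mul_pow_le_rpow hL0 hk hLL hk1 hk2)
    rw [Nat.cast_mul, Nat.cast_ofNat]
    gcongr
    exact_mod_cast prod_nth_prime_le hk S
end

section
/- Let p be a prime, let r ≥ 2 be an integer, let z_1, ..., z_r be distinct elements of F_p, and let M be a nonempty finite subset of the algebraic closure of F_p such that 4·|M| < p^{1/r}. Then there exists j ∈ {1, ..., r} such that the translate M + z_j is not contained in the union over i ≠ j of the translates M + z_i (where each z_i is identified with its image in the algebraic closure of F_p). -/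
/-- Simultaneous Dirichlet approximation modulo `p`: if `N ^ |ι| < p`, some nonzero multiple of
the tuple `z` has integer representatives of absolute value less than `p / N`. -/
theorem ZMod.exists_ne_zero_mul_eq_intCast_abs_lt {ι : Type*} [Fintype ι] {p N : ℕ} [NeZero p]
    (hN : 0 < N) (hNp : N ^ Fintype.card ι < p) (z : ι → ZMod p) :
    ∃ d : ZMod p, d ≠ 0 ∧ ∃ u : ι → ℤ, ∀ i, (u i : ZMod p) = d * z i ∧ N * |u i| < p := by
  classical
  have hp : 0 < p := NeZero.pos p
  let box : ZMod p → ι → Fin N := fun t i =>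
    ⟨(t * z i).val * N / p, by
      rw [Nat.div_lt_iff_lt_mul hp, mul_comm N]
      exact Nat.mul_lt_mul_of_pos_right (ZMod.val_lt _) hN⟩
  obtain ⟨s, t, hst, hbox⟩ := Fintype.exists_ne_map_eq_of_card_lt box (by simpa using hNp)
  refine ⟨s - t, sub_ne_zero.mpr hst, fun i => (s * z i).val - (t * z i).val, fun i => ⟨?_, ?_⟩⟩
  · push_cast
    rw [ZMod.natCast_zmod_val, ZMod.natCast_zmod_val, sub_mul]
  · have hq : (s * z i).val * N / p = (t * z i).val * N / p := congrArg Fin.val (congrFun hbox i)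
    have hs := Nat.div_add_mod ((s * z i).val * N) p
    have ht := Nat.div_add_mod ((t * z i).val * N) p
    have hs' := Nat.mod_lt ((s * z i).val * N) hp
    have ht' := Nat.mod_lt ((t * z i).val * N) hp
    rw [hq] at hs
    have hs₀ := Nat.zero_le ((s * z i).val * N % p)
    have ht₀ := Nat.zero_le ((t * z i).val * N % p)
    rw [← Nat.abs_cast N, ← abs_mul, abs_lt, mul_sub]
    zify at hs ht hs' ht' hs₀ ht₀
    constructor <;> linarith

/-- A finite set with `m` elements has a point followed, in the direction `e`, by a gap of length
at least half of `addOrderOf e / m`. -/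
theorem Set.Finite.exists_mem_forall_add_nsmul_notMem {G : Type*} [AddGroup G] {M : Set G}
    (hfin : M.Finite) (hne : M.Nonempty) (e : G) :
    ∃ x ∈ M, ∀ w : ℕ, 0 < w → 2 * M.ncard * w < addOrderOf e → x + w • e ∉ M := by
  by_contra! h
  obtain ⟨x₀, hx₀⟩ := hne
  obtain ⟨-, -, hpos, -⟩ := h x₀ hx₀
  choose! w hw hlt hmem using h
  let S : ℕ → ℕ := fun k => Nat.rec 0 (fun _ s => s + w (x₀ + s • e)) k
  have hS : ∀ k, S (k + 1) = S k + w (x₀ + S k • e) := fun _ => rfl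
  have hSM : ∀ k, x₀ + S k • e ∈ M := by
    intro k
    induction k with
    | zero => simpa [S] using hx₀
    | succ k ih => rw [hS, add_nsmul, ← add_assoc]; exact hmem _ ih
  have hmono : StrictMono S := strictMono_nat_of_lt_succ fun k => by
    rw [hS]; exact Nat.lt_add_of_pos_right (hw _ (hSM k))
  have hbound : ∀ k, 2 * M.ncard * S k ≤ k * addOrderOf e := by
    intro k
    induction k with
    | zero => simp [S]
    | succ k ih => rw [hS, mul_add, add_mul, one_mul]; exact add_le_add ih (hlt _ (hSM k)).le
  have hm : 0 < M.ncard := (Set.ncard_pos hfin).mpr ⟨x₀, hx₀⟩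
  have hord : 0 < addOrderOf e := (Nat.zero_le _).trans_lt (hlt x₀ hx₀)
  have hSlt : ∀ k ≤ M.ncard, S k < addOrderOf e := by
    intro k hk
    have h1 : M.ncard * (2 * S k) ≤ M.ncard * addOrderOf e :=
      calc M.ncard * (2 * S k) = 2 * M.ncard * S k := by ring
        _ ≤ k * addOrderOf e := hbound k
        _ ≤ _ := Nat.mul_le_mul_right _ hk
    have := Nat.le_of_mul_le_mul_left h1 hm
    omega
  have hinj : Set.InjOn (fun k => x₀ + S k • e) (Finset.range (M.ncard + 1)) := by
    intro i hi k hk hik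
    simp only [Finset.coe_range, Set.mem_Iio, Nat.lt_succ_iff] at hi hk
    exact hmono.injective
      (nsmul_injOn_Iio_addOrderOf (hSlt i hi) (hSlt k hk) (add_left_cancel hik))
  have hle := Set.ncard_le_ncard (Set.image_subset_iff.mpr fun k _ => hSM k :
    (fun k => x₀ + S k • e) '' (Finset.range (M.ncard + 1)) ⊆ M) hfin
  rw [hinj.ncard_image, Set.ncard_coe_finset, Finset.card_range] at hle
  omega


/-- Let `p` be a prime, `r ≥ 2` an integer, `z_1, …, z_r` distinct elements of
`F_p`, and `M` a nonempty finite subset of the algebraic closure of `F_p` with `4·|M| < p^{1/r}`.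
Then there exists `j ∈ {1, …, r}` such that the translate `M + z_j` is not contained in
`⋃_{i ≠ j} (M + z_i)`, where `F_p` is embedded in its algebraic closure via `algebraMap`. -/
theorem randomness_char_sums_stmt12 (p : ℕ) [Fact p.Prime] (r : ℕ) (hr : 2 ≤ r)
    (z : Fin r → ZMod p) (hz : Function.Injective z)
    (M : Set (AlgebraicClosure (ZMod p))) (hfin : M.Finite) (hne : M.Nonempty)
    (hcard : (4 * M.ncard : ℝ) < (p : ℝ) ^ ((1 : ℝ) / r)) :
    ∃ j : Fin r,
      ¬ ((fun x => x + algebraMap (ZMod p) (AlgebraicClosure (ZMod p)) (z j)) '' M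
        ⊆ ⋃ i ∈ ({j}ᶜ : Set (Fin r)),
            (fun x => x + algebraMap (ZMod p) (AlgebraicClosure (ZMod p)) (z i)) '' M) := by
  have hp : p.Prime := Fact.out
  have hm : 0 < M.ncard := (Set.ncard_pos hfin).mpr hne
  have hNp : (4 * M.ncard) ^ Fintype.card (Fin r) < p := by
    rw [Fintype.card_fin]
    rw [one_div, Real.lt_rpow_inv_iff_of_pos (by positivity) (by positivity) (by positivity),
      Real.rpow_natCast] at hcard
    exact_mod_cast hcard
  obtain ⟨d, hd, u, hu⟩ :=
    ZMod.exists_ne_zero_mul_eq_intCast_abs_lt (by positivity : 0 < 4 * M.ncard) hNp z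
  set φ := algebraMap (ZMod p) (AlgebraicClosure (ZMod p))
  have horder : addOrderOf (φ d⁻¹) = p := by
    apply addOrderOf_eq_prime
    · rw [← map_nsmul, nsmul_eq_mul, CharP.cast_eq_zero, zero_mul, map_zero]
    · simpa using hd
  obtain ⟨x, hx, hgap⟩ := hfin.exists_mem_forall_add_nsmul_notMem hne (φ d⁻¹)
  have : Nonempty (Fin r) := ⟨⟨0, by omega⟩⟩
  obtain ⟨j, hj⟩ := Finite.exists_max u
  refine ⟨j, fun hsub => ?_⟩
  obtain ⟨i, hij, y, hy, hyx⟩ : ∃ i, i ≠ j ∧ ∃ y ∈ M, y + φ (z i) = x + φ (z j) := by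
    simpa only [Set.mem_iUnion, Set.mem_image, Set.mem_compl_iff, Set.mem_singleton_iff,
      exists_prop] using hsub (Set.mem_image_of_mem _ hx)
  have hne_u : u i ≠ u j := fun h => hij <| hz <| mul_left_cancel₀ hd <| by
    rw [← (hu i).1, ← (hu j).1, h]
  obtain ⟨w, hw⟩ := Int.eq_ofNat_of_zero_le (sub_nonneg.mpr (hj i))
  have hw_pos : 0 < w := by have := hj i; omega
  have hw_lt : 2 * M.ncard * w < p := by
    have h1 := (hu i).2
    have h2 := (hu j).2
    have h3 : ((4 * M.ncard : ℕ) : ℤ) * (u j - u i) ≤ (4 * M.ncard : ℕ) * (|u j| + |u i|) :=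
      mul_le_mul_of_nonneg_left (by linarith [le_abs_self (u j), neg_abs_le (u i)])
        (Int.natCast_nonneg _)
    rw [hw] at h3
    zify
    push_cast at h1 h2 h3
    linarith
  refine hgap w hw_pos (horder.symm ▸ hw_lt) ?_
  have hwd : (w : ZMod p) * d⁻¹ = z j - z i := by
    have h : ((u j - u i : ℤ) : ZMod p) = w := by rw [hw, Int.cast_natCast]
    rw [← h, Int.cast_sub, (hu i).1, (hu j).1]
    field_simp
  rw [← map_nsmul, nsmul_eq_mul, hwd, map_sub, ← add_sub_assoc, ← hyx, add_sub_cancel_right]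
  exact hy
end
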